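/- Let d, x, y, z be non-negative integers with d ≥ 41. Then the linear system L_3(d; 4^{×x}, 3^{×y}, 2^{×z}) is non-special; that is, there exist pairwise linearly independent points p_1,...,p_{x+y+z} ∈ ℚ^4 \ {0} such that the space of homogeneous polynomials of degree d in 4 variables over ℚ vanishing to order ≥ 4 at the first x points, ≥ 3 at the next y points, and ≥ 2 at the last z points has dimension exactly max(C(d+3,3) − 20x − 10y − 4z, 0). -/

import Mathlib

open MvPolynomial

/-- The differential operator `∂₀^{ν 0} ∂₁^{ν 1} ∂₂^{ν 2} ∂₃^{ν 3}` on polynomials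
in 4 variables over `ℚ`. -/
noncomputable def diffOp (ν : Fin 4 → ℕ) :
    Module.End ℚ (MvPolynomial (Fin 4) ℚ) :=
  ((pderiv (0 : Fin 4)).toLinearMap ^ ν 0) * ((pderiv (1 : Fin 4)).toLinearMap ^ ν 1) *
    ((pderiv (2 : Fin 4)).toLinearMap ^ ν 2) * ((pderiv (3 : Fin 4)).toLinearMap ^ ν 3)

/-- Polynomials all of whose partial derivatives of order `< m` (including order 0)
vanish at the point `pt : ℚ⁴`. -/
noncomputable def vanishingSpace (m : ℕ) (pt : Fin 4 → ℚ) :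
    Submodule ℚ (MvPolynomial (Fin 4) ℚ) :=
  ⨅ (ν : Fin 4 → ℕ) (_ : ∑ j, ν j < m),
    LinearMap.ker ((aeval pt).toLinearMap ∘ₗ
      (diffOp ν : MvPolynomial (Fin 4) ℚ →ₗ[ℚ] MvPolynomial (Fin 4) ℚ))

/-- `V(d; m_1,…,m_r; p_1,…,p_r)`: homogeneous polynomials of degree `d` in 4 variables
over `ℚ` vanishing to order `≥ ms[i]` at `pts i` for each `i`. -/
noncomputable def systemSpace (d : ℕ) (ms : List ℕ) (pts : Fin ms.length → Fin 4 → ℚ) :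
    Submodule ℚ (MvPolynomial (Fin 4) ℚ) :=
  homogeneousSubmodule (Fin 4) ℚ d ⊓ ⨅ i, vanishingSpace (ms.get i) (pts i)

/-- The virtual dimension `vdim L_3(d; m_1,…,m_r) = C(d+3,3) − Σ C(m_i+2,3) − 1`. -/
def vdim (d : ℕ) (ms : List ℕ) : ℤ :=
  ((d + 3).choose 3 : ℤ) - (ms.map fun m => ((m + 2).choose 3 : ℤ)).sum - 1

/-- The linear system `L_3(d; m_1,…,m_r)` is non-special: there exist pairwise linearly
independent points of `ℚ⁴ \ {0}` at which the space of degree-`d` homogeneous polynomials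
with the prescribed multiplicities has dimension `max (vdim + 1) 0`
(the expected dimension). -/
noncomputable def nonSpecial (d : ℕ) (ms : List ℕ) : Prop :=
  ∃ pts : Fin ms.length → Fin 4 → ℚ,
    (∀ i, pts i ≠ 0) ∧
    (∀ i j, i ≠ j → LinearIndependent ℚ ![pts i, pts j]) ∧
    (Module.finrank ℚ (systemSpace d ms pts) : ℤ) = max (vdim d ms + 1) 0


section
namespace TD

/-- Exponents of monomials in three variables. -/
abbrev E := ℕ × ℕ × ℕ
/-- Points of affine three-space. -/
abbrev Pt := ℚ × ℚ × ℚ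

/-- The monomial `p ^ a`. -/
def mon (p : Pt) (a : E) : ℚ := p.1 ^ a.1 * p.2.1 ^ a.2.1 * p.2.2 ^ a.2.2

/-- Polynomial functions of degree `< m` in the exponent. -/
inductive Pol : ℕ → (E → ℚ) → Prop
  | const (m : ℕ) (c : ℚ) : Pol (m + 1) (fun _ => c)
  | add {m : ℕ} {f g : E → ℚ} : Pol m f → Pol m g → Pol m (fun a => f a + g a)
  | mulx {m : ℕ} {g : E → ℚ} : Pol m g → Pol (m + 1) (fun a => (a.1 : ℚ) * g a)
  | muly {m : ℕ} {g : E → ℚ} : Pol m g → Pol (m + 1) (fun a => (a.2.1 : ℚ) * g a)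
  | mulz {m : ℕ} {g : E → ℚ} : Pol m g → Pol (m + 1) (fun a => (a.2.2 : ℚ) * g a)

theorem Pol.smul {m : ℕ} {g : E → ℚ} (h : Pol m g) (r : ℚ) : Pol m (fun a => r * g a) := by
  induction h with
  | const m c => exact Pol.const m (r * c)
  | add _ _ ih1 ih2 => simpa only [mul_add] using Pol.add ih1 ih2
  | mulx _ ih => simpa only [mul_left_comm] using Pol.mulx ih
  | muly _ ih => simpa only [mul_left_comm] using Pol.muly ih
  | mulz _ ih => simpa only [mul_left_comm] using Pol.mulz ih

theorem Pol.succ {m : ℕ} {g : E → ℚ} (h : Pol m g) : Pol (m + 1) g := by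
  induction h with
  | const m c => exact Pol.const _ c
  | add _ _ ih1 ih2 => exact Pol.add ih1 ih2
  | mulx _ ih => exact Pol.mulx ih
  | muly _ ih => exact Pol.muly ih
  | mulz _ ih => exact Pol.mulz ih

theorem Pol.mono {m n : ℕ} {g : E → ℚ} (h : Pol m g) (hmn : m ≤ n) : Pol n g := by
  induction hmn with
  | refl => exact h
  | step _ ih => exact ih.succ

theorem Pol.shift {m : ℕ} {g : E → ℚ} (h : Pol m g) (t : Pt) :
    ∀ φ : E → E, (∀ a, ((φ a).1 : ℚ) = a.1 + t.1) → (∀ a, ((φ a).2.1 : ℚ) = a.2.1 + t.2.1) →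
      (∀ a, ((φ a).2.2 : ℚ) = a.2.2 + t.2.2) → Pol m (fun a => g (φ a)) := by
  intro φ h1 h2 h3
  induction h with
  | const m c => exact Pol.const _ c
  | add _ _ ih1 ih2 => exact Pol.add ih1 ih2
  | mulx _ ih => simpa only [h1, add_mul] using Pol.add (Pol.mulx ih) (ih.smul t.1).succ
  | muly _ ih => simpa only [h2, add_mul] using Pol.add (Pol.muly ih) (ih.smul t.2.1).succ
  | mulz _ ih => simpa only [h3, add_mul] using Pol.add (Pol.mulz ih) (ih.smul t.2.2).succ

/-- The linear conditions given by the fat points `l` separate the coefficients on `D`. -/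
def Inj (D : Finset E) (l : Multiset (ℕ × Pt)) : Prop :=
  ∀ c : E → ℚ, (∀ q ∈ l, ∀ g, Pol q.1 g → ∑ a ∈ D, c a * (g a * mon q.2 a) = 0) →
    ∀ a ∈ D, c a = 0

/-- All coordinates are nonzero. -/
def NZ (p : Pt) : Prop := p.1 ≠ 0 ∧ p.2.1 ≠ 0 ∧ p.2.2 ≠ 0

/-- There are distinct torus points with multiplicities `ms` which give injective conditions. -/
def Good (D : Finset E) (ms : Multiset ℕ) : Prop :=
  ∃ l : Multiset (ℕ × Pt), l.map Prod.fst = ms ∧ (l.map Prod.snd).Nodup ∧ (∀ q ∈ l, NZ q.2) ∧ Inj D l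

/-- The span of the conditions. -/
def FF (l : Multiset (ℕ × Pt)) : Submodule ℚ (E → ℚ) :=
  Submodule.span ℚ {h | ∃ q ∈ l, ∃ g, Pol q.1 g ∧ h = fun a => g a * mon q.2 a}

theorem FF_annih {D : Finset E} {l : Multiset (ℕ × Pt)} {c : E → ℚ}
    (hc : ∀ q ∈ l, ∀ g, Pol q.1 g → ∑ a ∈ D, c a * (g a * mon q.2 a) = 0) {h : E → ℚ}
    (hh : h ∈ FF l) : ∑ a ∈ D, c a * h a = 0 := by
  unfold FF at hh
  induction hh using Submodule.span_induction with
  | mem x hx => obtain ⟨q, hq, g, hg, rfl⟩ := hx; exact hc q hq g hg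
  | zero => simp
  | add x y _ _ h1 h2 => simp only [Pi.add_apply, mul_add, Finset.sum_add_distrib, h1, h2, add_zero]
  | smul r x _ h1 =>
    have : ∀ a, c a * (r • x) a = r * (c a * x a) := by intro a; simp; ring
    simp only [this, ← Finset.mul_sum, h1, mul_zero]

theorem Inj.sur {D : Finset E} {l : Multiset (ℕ × Pt)} (H : Inj D l) :
    ∀ a ∈ D, ∃ h ∈ FF l, ∀ b ∈ D, h b = if b = a then 1 else 0 := by
  classical
  let res : (E → ℚ) →ₗ[ℚ] (D → ℚ) := LinearMap.pi fun a => LinearMap.proj a.1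
  have htop : (FF l).map res = ⊤ := by
    by_contra hne
    obtain ⟨f, hf, hle⟩ := Submodule.exists_le_ker_of_lt_top _ (lt_top_iff_ne_top.2 hne)
    apply hf
    let c : E → ℚ := fun a => if ha : a ∈ D then f (Pi.single ⟨a, ha⟩ 1) else 0
    have key : ∀ v : E → ℚ, f (res v) = ∑ a ∈ D, c a * v a := by
      intro v
      rw [LinearMap.pi_apply_eq_sum_univ f (res v), ← Finset.sum_coe_sort D]
      refine Finset.sum_congr rfl fun a _ => ?_
      have e : (Pi.single a 1 : D → ℚ) = fun j => if a = j then 1 else 0 := by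
        ext j; simp [Pi.single_apply, eq_comm]
      simp only [c, a.2, dif_pos, smul_eq_mul]
      rw [mul_comm]; congr 1; rw [← e]
    have hc := H c (fun q hq g hg => by
      rw [← key fun a => g a * mon q.2 a]
      exact hle ⟨_, Submodule.subset_span ⟨q, hq, g, hg, rfl⟩, rfl⟩)
    apply LinearMap.ext
    intro v
    obtain ⟨u, rfl⟩ : ∃ u, res u = v := ⟨fun a => if ha : a ∈ D then v ⟨a, ha⟩ else 0, by
      ext a; simp [res]⟩
    rw [key]
    exact Finset.sum_eq_zero fun a ha => by rw [hc a ha, zero_mul]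
  intro a ha
  have : (fun b : D => if b.1 = a then (1 : ℚ) else 0) ∈ (FF l).map res := by rw [htop]; trivial
  obtain ⟨h, hh, e⟩ := this
  exact ⟨h, hh, fun b hb => congrFun e ⟨b, hb⟩⟩

/-- Evaluate the weight. -/
def wt (w : ℤ × ℤ × ℤ) (a : E) : ℤ := w.1 * a.1 + w.2.1 * a.2.1 + w.2.2 * a.2.2

/-- Scale a point by a one-parameter subgroup. -/
def scale (w : ℤ × ℤ × ℤ) (s : ℚ) (p : Pt) : Pt :=
  (s ^ w.1 * p.1, s ^ w.2.1 * p.2.1, s ^ w.2.2 * p.2.2)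

theorem mon_scale (w : ℤ × ℤ × ℤ) {s : ℚ} (hs : s ≠ 0) (p : Pt) (a : E) :
    mon (scale w s p) a = s ^ wt w a * mon p a := by
  simp only [mon, scale, wt, mul_pow, zpow_add₀ hs, zpow_mul, zpow_natCast]
  ring

theorem FF_scale (w : ℤ × ℤ × ℤ) {s : ℚ} (hs : s ≠ 0) {l : Multiset (ℕ × Pt)} {h : E → ℚ}
    (hh : h ∈ FF l) :
    (fun a => s ^ wt w a * h a) ∈ FF (l.map fun q => (q.1, scale w s q.2)) := by
  unfold FF at hh
  induction hh using Submodule.span_induction with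
  | mem x hx =>
    obtain ⟨q, hq, g, hg, rfl⟩ := hx
    refine Submodule.subset_span ⟨(q.1, scale w s q.2), Multiset.mem_map_of_mem (fun q : ℕ × Pt => (q.1, scale w s q.2)) hq, g, hg, ?_⟩
    funext a; rw [mon_scale w hs]; ring
  | zero => convert (FF _).zero_mem using 1; ext; simp
  | add x y _ _ h1 h2 => convert (FF _).add_mem h1 h2 using 1; ext; simp [mul_add]
  | smul r x _ h1 => convert (FF _).smul_mem r h1 using 1; ext; simp; ring

theorem scale_ne (w : ℤ × ℤ × ℤ) (hw : w ≠ 0) (p q : Pt) (hp : NZ p) :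
    ∀ᶠ s : ℕ in Filter.atTop, scale w (s : ℚ) p ≠ q := by
  have aux : ∀ (k : ℤ) (x y : ℚ), k ≠ 0 → x ≠ 0 → ∀ᶠ s : ℕ in Filter.atTop, (s : ℚ) ^ k * x ≠ y := by
    intro k x y hk hx
    have hfin : {s : ℕ | 0 < s ∧ (s : ℚ) ^ k * x = y}.Subsingleton := by
      rintro a ⟨ha, ha'⟩ b ⟨hb, hb'⟩
      have h : (a : ℚ) ^ k = (b : ℚ) ^ k := mul_right_cancel₀ hx (ha'.trans hb'.symm)
      have := (zpow_left_inj₀ (by positivity) (by positivity) hk).1 h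
      exact_mod_cast this
    filter_upwards [Filter.eventually_gt_atTop 0, (Nat.cofinite_eq_atTop ▸ hfin.finite.eventually_cofinite_notMem : ∀ᶠ s : ℕ in Filter.atTop, s ∉ _)] with s h1 h2 h3
    exact h2 ⟨h1, h3⟩
  have : w.1 ≠ 0 ∨ w.2.1 ≠ 0 ∨ w.2.2 ≠ 0 := by
    by_contra h; push Not at h
    exact hw (Prod.ext h.1 (Prod.ext h.2.1 h.2.2))
  rcases this with h | h | h
  · filter_upwards [aux _ _ q.1 h hp.1] with s hs e; exact hs (by rw [← e]; rfl)
  · filter_upwards [aux _ _ q.2.1 h hp.2.1] with s hs e; exact hs (by rw [← e]; rfl)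
  · filter_upwards [aux _ _ q.2.2 h hp.2.2] with s hs e; exact hs (by rw [← e]; rfl)

theorem scale_inj (w : ℤ × ℤ × ℤ) {s : ℚ} (hs : s ≠ 0) : Function.Injective (scale w s) := by
  rintro ⟨a, b, c⟩ ⟨a', b', c'⟩ h
  simp only [scale, Prod.mk.injEq] at h
  obtain ⟨h1, h2, h3⟩ := h
  simp only [Prod.mk.injEq]
  exact ⟨mul_left_cancel₀ (zpow_ne_zero _ hs) h1, mul_left_cancel₀ (zpow_ne_zero _ hs) h2,
    mul_left_cancel₀ (zpow_ne_zero _ hs) h3⟩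

theorem Inj.cut {D1 D2 : Finset E} {l1 l2 : Multiset (ℕ × Pt)} (w : ℤ × ℤ × ℤ) (k : ℤ)
    (h1 : ∀ a ∈ D1, k ≤ wt w a) (h2 : ∀ a ∈ D2, wt w a < k) (H1 : Inj D1 l1) (H2 : Inj D2 l2) :
    ∀ᶠ s : ℕ in Filter.atTop, Inj (D1 ∪ D2) (l1.map (fun q => (q.1, scale w (s : ℚ) q.2)) + l2) := by
  classical
  have hdisj : Disjoint D1 D2 := Finset.disjoint_left.2 fun a ha hb => absurd (h1 a ha) (not_le.2 (h2 a hb))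
  choose! h hF hδ using H1.sur
  choose! g gF gδ using H2.sur
  let C : E → ℚ := fun b => ∑ a ∈ D1, |g b a| * ∑ b' ∈ D2, |h a b'|
  have hC : ∀ b, 0 ≤ C b := fun b => Finset.sum_nonneg fun a _ => mul_nonneg (abs_nonneg _) (Finset.sum_nonneg fun _ _ => abs_nonneg _)
  have hs : ∀ᶠ s : ℕ in Filter.atTop, (∑ b ∈ D2, C b) < (s : ℚ) := by
    obtain ⟨N, hN⟩ := exists_nat_gt (∑ b ∈ D2, C b)
    filter_upwards [Filter.eventually_ge_atTop N] with s hs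
    exact hN.trans_le (by exact_mod_cast hs)
  filter_upwards [hs, Filter.eventually_gt_atTop 0] with s hs hs0
  have hs0' : (0 : ℚ) < s := by exact_mod_cast hs0
  have hs1 : (1 : ℚ) ≤ s := by exact_mod_cast hs0
  intro c hc
  have hc1 : ∀ f ∈ FF (l1.map (fun q => (q.1, scale w (s : ℚ) q.2))), ∑ a ∈ D1, c a * f a + ∑ b ∈ D2, c b * f b = 0 := by
    intro f hf
    rw [← Finset.sum_union hdisj]
    exact FF_annih (fun q hq => hc q (Multiset.mem_add.2 (Or.inl hq))) hf
  have hc2 : ∀ f ∈ FF l2, ∑ a ∈ D1, c a * f a + ∑ b ∈ D2, c b * f b = 0 := by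
    intro f hf
    rw [← Finset.sum_union hdisj]
    exact FF_annih (fun q hq => hc q (Multiset.mem_add.2 (Or.inr hq))) hf
  -- coefficients on D1 in terms of D2
  have e1 : ∀ a ∈ D1, c a = - ∑ b ∈ D2, c b * ((s : ℚ) ^ (wt w b - wt w a) * h a b) := by
    intro a ha
    have := hc1 _ (Submodule.smul_mem _ ((s : ℚ) ^ (- wt w a)) (FF_scale w hs0'.ne' (hF a ha)))
    have t1 : ∑ a' ∈ D1, c a' * (((s : ℚ) ^ (- wt w a)) • fun b => (s : ℚ) ^ wt w b * h a b) a' = c a := by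
      rw [Finset.sum_eq_single_of_mem a ha]
      · simp only [Pi.smul_apply, hδ a ha a ha, smul_eq_mul, if_true, mul_one, ← zpow_add₀ hs0'.ne']
        simp
      · intro b hb hne
        simp [hδ a ha b hb, hne]
    rw [t1] at this
    rw [eq_neg_iff_add_eq_zero, ← this]
    congr 1
    refine Finset.sum_congr rfl fun b _ => ?_
    rw [sub_eq_neg_add, zpow_add₀ hs0'.ne']
    simp [mul_assoc]
  have e2 : ∀ b ∈ D2, c b = - ∑ a ∈ D1, c a * g b a := by
    intro b hb
    have := hc2 _ (gF b hb)
    rw [Finset.sum_eq_single_of_mem (s := D2) b hb] at this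
    · simp only [gδ b hb b hb, if_true, mul_one] at this
      linarith
    · intro b' hb' hne
      simp [gδ b hb b' hb', hne]
  have z2 : ∀ b ∈ D2, c b = 0 := by
    by_cases hne : D2.Nonempty
    · obtain ⟨b0, hb0, hmax⟩ := Finset.exists_max_image D2 (fun b => |c b|) hne
      have b1 : ∀ a ∈ D1, |c a| ≤ |c b0| * (s : ℚ)⁻¹ * ∑ b ∈ D2, |h a b| := by
        intro a ha
        rw [e1 a ha, abs_neg, Finset.mul_sum]
        refine (Finset.abs_sum_le_sum_abs _ _).trans (Finset.sum_le_sum fun b hb => ?_)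
        rw [abs_mul, abs_mul, ← mul_assoc]
        refine mul_le_mul_of_nonneg_right ?_ (abs_nonneg _)
        refine mul_le_mul (hmax b hb) ?_ (abs_nonneg _) (abs_nonneg _)
        rw [abs_of_pos (zpow_pos hs0' _), ← zpow_neg_one]
        exact zpow_le_zpow_right₀ hs1 (by have := h1 a ha; have := h2 b hb; omega)
      have b2 : |c b0| ≤ |c b0| * (s : ℚ)⁻¹ * C b0 := by
        conv_lhs => rw [e2 b0 hb0, abs_neg]
        refine (Finset.abs_sum_le_sum_abs _ _).trans ?_
        rw [Finset.mul_sum]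
        refine Finset.sum_le_sum fun a ha => ?_
        rw [abs_mul]
        calc |c a| * |g b0 a| ≤ (|c b0| * (s : ℚ)⁻¹ * ∑ b ∈ D2, |h a b|) * |g b0 a| :=
              mul_le_mul_of_nonneg_right (b1 a ha) (abs_nonneg _)
          _ = _ := by ring
      have b3 : C b0 < s := (Finset.single_le_sum (f := C) (fun b _ => hC b) hb0).trans_lt hs
      have b4 : (s : ℚ)⁻¹ * C b0 < 1 := by
        rw [inv_mul_lt_iff₀ hs0']; simpa using b3
      have b5 : |c b0| = 0 := by
        by_contra hne0
        have : 0 < |c b0| := lt_of_le_of_ne (abs_nonneg _) (Ne.symm hne0)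
        rw [mul_assoc] at b2
        nlinarith
      intro b hb
      have := hmax b hb
      simp only [b5] at this
      exact abs_eq_zero.1 (le_antisymm this (abs_nonneg _))
    · intro b hb; exact absurd ⟨b, hb⟩ hne
  intro a ha
  rcases Finset.mem_union.1 ha with ha | ha
  · rw [e1 a ha, Finset.sum_eq_zero, neg_zero]
    intro b hb; rw [z2 b hb, zero_mul]
  · exact z2 a ha

theorem Good.cut {D1 D2 : Finset E} {m1 m2 : Multiset ℕ} (w : ℤ × ℤ × ℤ) (hw : w ≠ 0) (k : ℤ)
    (h1 : ∀ a ∈ D1, k ≤ wt w a) (h2 : ∀ a ∈ D2, wt w a < k) (H1 : Good D1 m1) (H2 : Good D2 m2) :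
    Good (D1 ∪ D2) (m1 + m2) := by
  obtain ⟨l1, rfl, nd1, nz1, i1⟩ := H1
  obtain ⟨l2, rfl, nd2, nz2, i2⟩ := H2
  have hne : ∀ᶠ s : ℕ in Filter.atTop, ∀ q1 ∈ l1.toFinset, ∀ q2 ∈ l2.toFinset, scale w (s : ℚ) q1.2 ≠ q2.2 := by
    rw [Filter.eventually_all_finset]
    intro q1 hq1
    rw [Filter.eventually_all_finset]
    intro q2 _
    exact scale_ne w hw _ _ (nz1 q1 (Multiset.mem_toFinset.1 hq1))
  obtain ⟨s, hs1, hs2, hs3⟩ := ((i1.cut w k h1 h2 i2).and (hne.and (Filter.eventually_gt_atTop 0))).exists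
  have hs0 : (s : ℚ) ≠ 0 := by exact_mod_cast hs3.ne'
  refine ⟨_, ?_, ?_, ?_, hs1⟩
  · simp [Multiset.map_map, Function.comp_def]
  · rw [Multiset.map_add, Multiset.nodup_add]
    refine ⟨?_, nd2, ?_⟩
    · have : (l1.map (fun q => (q.1, scale w (s : ℚ) q.2))).map Prod.snd = (l1.map Prod.snd).map (scale w s) := by
        simp [Multiset.map_map, Function.comp_def]
      rw [this]
      exact nd1.map (scale_inj w hs0)
    · rw [Multiset.disjoint_left]
      intro p hp hp'
      simp only [Multiset.mem_map] at hp hp'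
      obtain ⟨_, ⟨q1, hq1, rfl⟩, rfl⟩ := hp
      obtain ⟨q2, hq2, e⟩ := hp'
      exact hs2 q1 (Multiset.mem_toFinset.2 hq1) q2 (Multiset.mem_toFinset.2 hq2) e.symm
  · intro q hq
    rcases Multiset.mem_add.1 hq with hq | hq
    · obtain ⟨q1, hq1, rfl⟩ := Multiset.mem_map.1 hq
      obtain ⟨a, b, c⟩ := nz1 q1 hq1
      exact ⟨mul_ne_zero (zpow_ne_zero _ hs0) a, mul_ne_zero (zpow_ne_zero _ hs0) b,
        mul_ne_zero (zpow_ne_zero _ hs0) c⟩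
    · exact nz2 q hq

theorem Good.add_one {D : Finset E} {ms : Multiset ℕ} (H : Good D ms) (m : ℕ) : Good D (m ::ₘ ms) := by
  obtain ⟨l, rfl, nd, nz, i⟩ := H
  obtain ⟨t, ht⟩ := Infinite.exists_notMem_finset ((l.map fun q => q.2.1).toFinset ∪ {0})
  simp only [Finset.mem_union, Multiset.mem_toFinset, Finset.mem_singleton, not_or] at ht
  refine ⟨(m, (t, 1, 1)) ::ₘ l, by simp, ?_, ?_, ?_⟩
  · rw [Multiset.map_cons, Multiset.nodup_cons]
    refine ⟨fun h => ht.1 ?_, nd⟩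
    obtain ⟨q, hq, e⟩ := Multiset.mem_map.1 h
    exact Multiset.mem_map.2 ⟨q, hq, by rw [e]⟩
  · intro q hq
    rcases Multiset.mem_cons.1 hq with rfl | hq
    · exact ⟨ht.2, one_ne_zero, one_ne_zero⟩
    · exact nz q hq
  · intro c hc
    exact i c fun q hq => hc q (Multiset.mem_cons_of_mem hq)

theorem Good.add {D : Finset E} {ms : Multiset ℕ} (H : Good D ms) (ms' : Multiset ℕ) : Good D (ms + ms') := by
  induction ms' using Multiset.induction with
  | empty => simpa using H
  | cons m s ih => rw [Multiset.add_cons]; exact ih.add_one m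

theorem Good.mono {D : Finset E} {ms ms' : Multiset ℕ} (H : Good D ms) (h : ms ≤ ms') : Good D ms' := by
  obtain ⟨u, rfl⟩ := Multiset.le_iff_exists_add.1 h
  exact H.add u

/-- Invariance under translation of the exponents. -/
theorem Good.shift {D D' : Finset E} {ms : Multiset ℕ} (H : Good D ms) (t : ℤ × ℤ × ℤ) (φ : E → E)
    (hφ : ∀ a, a ∈ D → φ a ∈ D') (hsurj : ∀ b ∈ D', ∃ a ∈ D, φ a = b)
    (h1 : ∀ a ∈ D, ((φ a).1 : ℤ) = a.1 + t.1) (h2 : ∀ a ∈ D, ((φ a).2.1 : ℤ) = a.2.1 + t.2.1)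
    (h3 : ∀ a ∈ D, ((φ a).2.2 : ℤ) = a.2.2 + t.2.2) : Good D' ms := by
  obtain ⟨l, rfl, nd, nz, i⟩ := H
  refine ⟨l, rfl, nd, nz, ?_⟩
  intro c hc
  have inj : Set.InjOn φ D := by
    intro a ha b hb e
    have := h1 a ha; have := h1 b hb; have := h2 a ha; have := h2 b hb
    have := h3 a ha; have := h3 b hb
    rw [e] at *
    refine Prod.ext ?_ (Prod.ext ?_ ?_) <;> omega
  have key := i (fun a => c (φ a)) (fun q hq g hg => by
    obtain ⟨n1, n2, n3⟩ := nz q hq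
    -- the polynomial on the other side
    have hP : ∃ g', Pol q.1 g' ∧ ∀ a ∈ D, g' (φ a) = g a := by
      have aux : ∀ m g, Pol m g → ∃ g', Pol m g' ∧ ∀ a ∈ D, g' (φ a) = g a := by
        intro m g hg
        induction hg with
        | const m c => exact ⟨_, Pol.const m c, fun _ _ => rfl⟩
        | add _ _ ih1 ih2 =>
          obtain ⟨f1, p1, e1⟩ := ih1
          obtain ⟨f2, p2, e2⟩ := ih2
          exact ⟨_, p1.add p2, fun a ha => by rw [e1 a ha, e2 a ha]⟩
        | mulx _ ih =>
          obtain ⟨f, p, e⟩ := ih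
          refine ⟨_, p.mulx.add (p.smul (-(t.1 : ℚ))).succ, fun a ha => ?_⟩
          have hh : (((φ a).1 : ℕ) : ℚ) = a.1 + t.1 := by exact_mod_cast h1 a ha
          simp only [e a ha, hh]; ring
        | muly _ ih =>
          obtain ⟨f, p, e⟩ := ih
          refine ⟨_, p.muly.add (p.smul (-(t.2.1 : ℚ))).succ, fun a ha => ?_⟩
          have hh : (((φ a).2.1 : ℕ) : ℚ) = a.2.1 + t.2.1 := by exact_mod_cast h2 a ha
          simp only [e a ha, hh]; ring
        | mulz _ ih =>
          obtain ⟨f, p, e⟩ := ih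
          refine ⟨_, p.mulz.add (p.smul (-(t.2.2 : ℚ))).succ, fun a ha => ?_⟩
          have hh : (((φ a).2.2 : ℕ) : ℚ) = a.2.2 + t.2.2 := by exact_mod_cast h3 a ha
          simp only [e a ha, hh]; ring
      exact aux _ _ hg
    obtain ⟨g', pg', eg'⟩ := hP
    have hs := hc q hq g' pg'
    have hD' : D' = D.image φ := by
      ext b; simp only [Finset.mem_image]
      exact ⟨fun hb => hsurj b hb, fun ⟨a, ha, e⟩ => e ▸ hφ a ha⟩
    rw [hD', Finset.sum_image inj] at hs
    have hm : ∀ a ∈ D, mon q.2 (φ a) = (q.2.1 ^ t.1 * q.2.2.1 ^ t.2.1 * q.2.2.2 ^ t.2.2) * mon q.2 a := by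
      intro a ha
      simp only [mon, ← zpow_natCast]
      rw [h1 a ha, h2 a ha, h3 a ha, zpow_add₀ n1, zpow_add₀ n2, zpow_add₀ n3]
      ring
    have hs' : (q.2.1 ^ t.1 * q.2.2.1 ^ t.2.1 * q.2.2.2 ^ t.2.2) * ∑ a ∈ D, c (φ a) * (g a * mon q.2 a) = 0 := by
      rw [← hs, Finset.mul_sum]
      refine Finset.sum_congr rfl fun a ha => ?_
      rw [hm a ha, eg' a ha]; ring
    refine (mul_eq_zero.1 hs').resolve_left ?_
    exact mul_ne_zero (mul_ne_zero (zpow_ne_zero _ n1) (zpow_ne_zero _ n2)) (zpow_ne_zero _ n3))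
  intro b hb
  obtain ⟨a, ha, rfl⟩ := hsurj b hb
  exact key a ha

end TD
end

section
namespace TD
open scoped Pointwise

/-- Profiles: numbers of quadruple, triple, double and simple points. -/
abbrev Pr := ℕ × ℕ × ℕ × ℕ

/-- The multiset of multiplicities of a profile. -/
def Ms (π : Pr) : Multiset ℕ :=
  Multiset.replicate π.1 4 + Multiset.replicate π.2.1 3 + Multiset.replicate π.2.2.1 2 +
    Multiset.replicate π.2.2.2 1

theorem Ms_add (π ρ : Pr) : Ms (π + ρ) = Ms π + Ms ρ := by
  simp only [Ms, Prod.fst_add, Prod.snd_add, Multiset.replicate_add]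
  abel

/-- All profiles of the family are good for `D`. -/
def Has (D : Finset E) (A : Set Pr) : Prop := ∀ π ∈ A, Good D (Ms π)

theorem Has.mono {D : Finset E} {A B : Set Pr} (h : Has D B) (hs : A ⊆ B) : Has D A :=
  fun π hπ => h π (hs hπ)

theorem Has.cut {D1 D2 : Finset E} {A B : Set Pr} (w : ℤ × ℤ × ℤ) (hw : w ≠ 0) (k : ℤ)
    (h1 : ∀ a ∈ D1, k ≤ wt w a) (h2 : ∀ a ∈ D2, wt w a < k) (H1 : Has D1 A) (H2 : Has D2 B) :
    Has (D1 ∪ D2) (A + B) := by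
  rintro _ ⟨π, hπ, ρ, hρ, rfl⟩
  show Good _ (Ms (π + ρ))
  rw [Ms_add]
  exact (H1 π hπ).cut w hw k h1 h2 (H2 ρ hρ)

/-- Pure profiles. -/
def Pure (k : ℕ) : Set Pr := {(k, 0, 0, 0), (0, 2 * k, 0, 0), (0, 0, 5 * k, 0)}
/-- Sums of pure profiles. -/
def Pures (ks : List ℕ) : Set Pr := (ks.map Pure).sum
/-- Mixed profiles. -/
def Mix (k : ℕ) : Set Pr := {π | ∃ a b c, a + b + c = k ∧ π = (a, 2 * b, 5 * c, 0)}
/-- Final profiles. -/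
def FinF (f : ℕ) : Set Pr :=
  {π | (π.2.2.2 = 0 ∧ f ≤ 20 * π.1 + 10 * π.2.1 + 4 * π.2.2.1) ∨
    (π.2.2.2 ≤ 3 ∧ f = 20 * π.1 + 10 * π.2.1 + 4 * π.2.2.1 + π.2.2.2)}

theorem Mix_zero : Mix 0 = {0} := by
  ext π; simp only [Mix, Set.mem_ofPred_eq, Set.mem_singleton_iff]
  constructor
  · rintro ⟨a, b, c, h, rfl⟩
    obtain ⟨rfl, rfl, rfl⟩ : a = 0 ∧ b = 0 ∧ c = 0 := by omega
    rfl
  · rintro rfl; exact ⟨0, 0, 0, rfl, rfl⟩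

theorem Mix_add (k l : ℕ) : Mix (k + l) ⊆ Mix k + Mix l := by
  rintro _ ⟨a, b, c, h, rfl⟩
  obtain ⟨a', b', c', h1, h2, h3, h4⟩ : ∃ a' b' c', a' ≤ a ∧ b' ≤ b ∧ c' ≤ c ∧ a' + b' + c' = k :=
    ⟨min a k, min b (k - min a k), k - min a k - min b (k - min a k), by omega, by omega, by omega, by omega⟩
  refine ⟨(a', 2 * b', 5 * c', 0), ⟨a', b', c', h4, rfl⟩, (a - a', 2 * (b - b'), 5 * (c - c'), 0),
    ⟨a - a', b - b', c - c', by omega, rfl⟩, ?_⟩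
  simp only [Prod.mk_add_mk]
  refine Prod.ext ?_ (Prod.ext ?_ (Prod.ext ?_ ?_)) <;> simp only <;> omega

theorem Pure_sub_Mix (k : ℕ) : Pure k ⊆ Mix k := by
  rintro π hπ
  simp only [Pure, Set.mem_insert_iff, Set.mem_singleton_iff] at hπ
  rcases hπ with rfl | rfl | rfl
  · exact ⟨k, 0, 0, by omega, rfl⟩
  · exact ⟨0, k, 0, by omega, rfl⟩
  · exact ⟨0, 0, k, by omega, rfl⟩

theorem Pures_append (ks ls : List ℕ) : Pures (ks ++ ls) = Pures ks + Pures ls := by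
  simp [Pures]

/-- Bulk regions: pure tiles of at most 16 units and `M` units of mixing tiles. -/
def HB (D : Finset E) (M : ℕ) : Prop :=
  ∃ ks : List ℕ, (∀ k ∈ ks, k ≤ 16) ∧ D.card = 20 * (ks.sum + M) ∧ Has D (Pures ks + Mix M)

/-- Final regions. -/
def HF (D : Finset E) (M : ℕ) : Prop :=
  ∃ (ks : List ℕ) (f : ℕ), (∀ k ∈ ks, k ≤ 16) ∧ 10 ≤ f ∧ D.card = 20 * (ks.sum + M) + f ∧
    Has D (Pures ks + Mix M + FinF f)

theorem cut_disj {D1 D2 : Finset E} {w : ℤ × ℤ × ℤ} {k : ℤ}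
    (h1 : ∀ a ∈ D1, k ≤ wt w a) (h2 : ∀ a ∈ D2, wt w a < k) : Disjoint D1 D2 :=
  Finset.disjoint_left.2 fun a ha hb => absurd (h1 a ha) (not_le.2 (h2 a hb))

theorem Has.cut' {D1 D2 : Finset E} {A B : Set Pr} {w : ℤ × ℤ × ℤ} (hw : w ≠ 0) {k : ℤ}
    (h : (∀ a ∈ D1, k ≤ wt w a) ∧ (∀ a ∈ D2, wt w a < k) ∨
      (∀ a ∈ D2, k ≤ wt w a) ∧ (∀ a ∈ D1, wt w a < k)) (H1 : Has D1 A) (H2 : Has D2 B) :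
    Has (D1 ∪ D2) (A + B) ∧ (D1 ∪ D2).card = D1.card + D2.card := by
  rcases h with ⟨h1, h2⟩ | ⟨h1, h2⟩
  · exact ⟨H1.cut w hw k h1 h2 H2, Finset.card_union_of_disjoint (cut_disj h1 h2)⟩
  · refine ⟨?_, Finset.card_union_of_disjoint (cut_disj h1 h2).symm⟩
    rw [Finset.union_comm, add_comm]
    exact H2.cut w hw k h1 h2 H1

theorem HB.cut {D1 D2 : Finset E} {M N : ℕ} {w : ℤ × ℤ × ℤ} (hw : w ≠ 0) {k : ℤ}
    (h : (∀ a ∈ D1, k ≤ wt w a) ∧ (∀ a ∈ D2, wt w a < k) ∨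
      (∀ a ∈ D2, k ≤ wt w a) ∧ (∀ a ∈ D1, wt w a < k)) (H1 : HB D1 M) (H2 : HB D2 N) :
    HB (D1 ∪ D2) (M + N) := by
  obtain ⟨ks, a1, a2, a3⟩ := H1
  obtain ⟨ls, b1, b2, b3⟩ := H2
  obtain ⟨c1, c2⟩ := a3.cut' hw h b3
  refine ⟨ks ++ ls, ?_, ?_, c1.mono ?_⟩
  · intro k hk; rcases List.mem_append.1 hk with h | h
    exacts [a1 k h, b1 k h]
  · rw [c2, a2, b2, List.sum_append]; ring
  · rw [Pures_append, add_add_add_comm]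
    exact Set.add_subset_add_left (Mix_add M N)

theorem HF.cut {D1 D2 : Finset E} {M N : ℕ} {w : ℤ × ℤ × ℤ} (hw : w ≠ 0) {k : ℤ}
    (h : (∀ a ∈ D1, k ≤ wt w a) ∧ (∀ a ∈ D2, wt w a < k) ∨
      (∀ a ∈ D2, k ≤ wt w a) ∧ (∀ a ∈ D1, wt w a < k)) (H1 : HB D1 M) (H2 : HF D2 N) :
    HF (D1 ∪ D2) (M + N) := by
  obtain ⟨ks, a1, a2, a3⟩ := H1
  obtain ⟨ls, f, b1, bf, b2, b3⟩ := H2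
  obtain ⟨c1, c2⟩ := a3.cut' hw h b3
  refine ⟨ks ++ ls, f, ?_, bf, ?_, c1.mono ?_⟩
  · intro k hk; rcases List.mem_append.1 hk with h | h
    exacts [a1 k h, b1 k h]
  · rw [c2, a2, b2, List.sum_append]; ring
  · have e : Pures ks + Mix M + (Pures ls + Mix N + FinF f) =
        (Pures ks + Pures ls) + (Mix M + Mix N) + FinF f := by abel
    rw [Pures_append, e]
    exact Set.add_subset_add_right (Set.add_subset_add_left (Mix_add M N))

theorem HB.pure_of_mix {D : Finset E} {M : ℕ} (hM : M ≤ 16) (h : Has D (Mix M)) (hc : D.card = 20 * M) : HB D 0 :=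
  ⟨[M], by simpa using hM, by simpa using hc, by
    rw [Mix_zero]
    refine h.mono ?_
    simpa [Pures] using Pure_sub_Mix M⟩

theorem HB.of_mix {D : Finset E} {M : ℕ} (h : Has D (Mix M)) (hc : D.card = 20 * M) : HB D M :=
  ⟨[], by simp, by simpa using hc, by simpa [Pures] using h⟩

theorem HB.of_pure {D : Finset E} {k : ℕ} (hk : k ≤ 16) (h : Has D (Pure k)) (hc : D.card = 20 * k) : HB D 0 :=
  ⟨[k], by simpa using hk, by simpa using hc, by
    rw [Mix_zero]
    simpa [Pures] using h⟩

theorem FinF_base (M f : ℕ) (hf : 10 ≤ f) : FinF (20 * M + f) ⊆ Mix M + FinF f := by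
  rintro ⟨x, y, z, s⟩ h
  simp only [FinF, Set.mem_ofPred_eq] at h
  obtain ⟨a, b, c, h1, h2, h3, h4⟩ : ∃ a b c, a + b + c = M ∧ a ≤ x ∧ 2 * b ≤ y ∧ 5 * c ≤ z := by
    refine ⟨min x M, min (y / 2) (M - min x M), M - min x M - min (y / 2) (M - min x M), ?_, ?_, ?_, ?_⟩ <;> omega
  refine ⟨(a, 2 * b, 5 * c, 0), ⟨a, b, c, h1, rfl⟩, (x - a, y - 2 * b, z - 5 * c, s), ?_, ?_⟩
  · simp only [FinF, Set.mem_ofPred_eq]; omega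
  · simp only [Prod.mk_add_mk, Prod.mk.injEq]; omega

theorem FinF_sub (ks : List ℕ) (hk : ∀ k ∈ ks, k ≤ 16) (M f : ℕ) (hM : 48 ≤ M) (hf : 10 ≤ f) :
    FinF (20 * (ks.sum + M) + f) ⊆ Pures ks + Mix M + FinF f := by
  induction ks with
  | nil => simpa [Pures] using FinF_base M f hf
  | cons k ks ih =>
    have ih := ih fun l hl => hk l (List.mem_cons_of_mem _ hl)
    have hk16 := hk k (List.mem_cons_self)
    have e : Pures (k :: ks) = Pure k + Pures ks := by simp [Pures]
    rw [e, add_assoc, add_assoc, ← add_assoc (Pures ks)]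
    refine Set.Subset.trans ?_ (Set.add_subset_add_left ih)
    rintro ⟨x, y, z, s⟩ h
    simp only [FinF, Set.mem_ofPred_eq, List.sum_cons] at h
    have hcase : k ≤ x ∨ 2 * k ≤ y ∨ 5 * k ≤ z := by omega
    rcases hcase with hc | hc | hc
    · refine ⟨(k, 0, 0, 0), by simp [Pure], (x - k, y, z, s), ?_, ?_⟩
      · simp only [FinF, Set.mem_ofPred_eq]; omega
      · simp only [Prod.mk_add_mk, Prod.mk.injEq]; omega
    · refine ⟨(0, 2 * k, 0, 0), by simp [Pure], (x, y - 2 * k, z, s), ?_, ?_⟩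
      · simp only [FinF, Set.mem_ofPred_eq]; omega
      · simp only [Prod.mk_add_mk, Prod.mk.injEq]; omega
    · refine ⟨(0, 0, 5 * k, 0), by simp [Pure], (x, y, z - 5 * k, s), ?_, ?_⟩
      · simp only [FinF, Set.mem_ofPred_eq]; omega
      · simp only [Prod.mk_add_mk, Prod.mk.injEq]; omega

theorem HF.final {D : Finset E} {M : ℕ} (hM : 48 ≤ M) (h : HF D M) : Has D (FinF D.card) := by
  obtain ⟨ks, f, h1, h2, h3, h4⟩ := h
  rw [h3]
  exact h4.mono (FinF_sub ks h1 M f hM h2)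

/-- Bulk regions given as sets. -/
def HBS (S : Set E) (M : ℕ) : Prop := ∃ D : Finset E, (D : Set E) = S ∧ HB D M
/-- Final regions given as sets. -/
def HFS (S : Set E) (M : ℕ) : Prop := ∃ D : Finset E, (D : Set E) = S ∧ HF D M

theorem HBS.cut {S S1 S2 : Set E} {M N : ℕ} (w : ℤ × ℤ × ℤ) (k : ℤ) (H1 : HBS S1 M) (H2 : HBS S2 N) (hw : w ≠ 0)
    (hS : S = S1 ∪ S2) (h1 : ∀ a ∈ S1, wt w a < k) (h2 : ∀ a ∈ S2, k ≤ wt w a) : HBS S (M + N) := by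
  obtain ⟨D1, rfl, H1⟩ := H1
  obtain ⟨D2, rfl, H2⟩ := H2
  exact ⟨D1 ∪ D2, by rw [hS, Finset.coe_union], H1.cut hw (Or.inr ⟨h2, h1⟩) H2⟩

theorem HFS.cut {S S1 S2 : Set E} {M N : ℕ} (w : ℤ × ℤ × ℤ) (k : ℤ) (H1 : HBS S1 M) (H2 : HFS S2 N) (hw : w ≠ 0)
    (hS : S = S1 ∪ S2) (h1 : ∀ a ∈ S1, wt w a < k) (h2 : ∀ a ∈ S2, k ≤ wt w a) : HFS S (M + N) := by
  obtain ⟨D1, rfl, H1⟩ := H1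
  obtain ⟨D2, rfl, H2⟩ := H2
  exact ⟨D1 ∪ D2, by rw [hS, Finset.coe_union], HF.cut hw (Or.inr ⟨h2, h1⟩) H1 H2⟩

theorem shift_aux {D : Finset E} {S' : Set E} (t : E) (hS : S' = {a | ∃ b ∈ D, a = b + t}) :
    ∃ D' : Finset E, (D' : Set E) = S' ∧ D'.card = D.card ∧ ∀ ms, Good D ms → Good D' ms := by
  refine ⟨D.image (· + t), ?_, Finset.card_image_of_injective _ (add_left_injective t), ?_⟩
  · rw [hS]; ext a; simp [eq_comm]
  · intro ms h
    refine h.shift (t.1, t.2.1, t.2.2) (· + t) (fun a ha => Finset.mem_image_of_mem _ ha)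
      (fun b hb => by simpa using hb) ?_ ?_ ?_ <;> intro a _ <;> simp

theorem HBS.shift {S S' : Set E} {M : ℕ} (H : HBS S M) (t : E) (hS : S' = {a | ∃ b ∈ S, a = b + t}) : HBS S' M := by
  obtain ⟨D, rfl, ks, h1, h2, h3⟩ := H
  obtain ⟨D', e, hc, hg⟩ := shift_aux t hS
  exact ⟨D', e, ks, h1, hc.trans h2, fun π hπ => hg _ (h3 π hπ)⟩

theorem HFS.shift {S S' : Set E} {M : ℕ} (H : HFS S M) (t : E) (hS : S' = {a | ∃ b ∈ S, a = b + t}) : HFS S' M := by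
  obtain ⟨D, rfl, ks, f, h1, hf, h2, h3⟩ := H
  obtain ⟨D', e, hc, hg⟩ := shift_aux t hS
  exact ⟨D', e, ks, f, h1, hf, hc.trans h2, fun π hπ => hg _ (h3 π hπ)⟩

theorem HFS.unshift {S S' : Set E} {M : ℕ} (H : HFS S' M) (t : E) (hS : S' = {a | ∃ b ∈ S, a = b + t}) : HFS S M := by
  obtain ⟨D, e, ks, f, h1, hf, h2, h3⟩ := H
  have hmem : ∀ a, a ∈ D ↔ ∃ b ∈ S, a = b + t := by
    intro a; rw [← Finset.mem_coe, e, hS]; rfl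
  have hsub : ∀ a : E, a + t - t = a := by
    intro a; exact add_tsub_cancel_right a t
  have hinj : Set.InjOn (fun a : E => a - t) D := by
    intro a ha b hb hab
    obtain ⟨a', _, rfl⟩ := (hmem a).1 ha
    obtain ⟨b', _, rfl⟩ := (hmem b).1 hb
    simp only [hsub] at hab
    rw [hab]
  refine ⟨D.image (fun a => a - t), ?_, ks, f, h1, hf, ?_, fun π hπ => ?_⟩
  · ext a
    simp only [Finset.coe_image, Set.mem_image, Finset.mem_coe]
    constructor
    · rintro ⟨x, hx, rfl⟩
      obtain ⟨b, hb, rfl⟩ := (hmem x).1 hx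
      rwa [hsub]
    · intro ha
      exact ⟨a + t, (hmem _).2 ⟨a, ha, rfl⟩, hsub a⟩
  · rw [Finset.card_image_of_injOn hinj, h2]
  · refine (h3 π hπ).shift (-t.1, -t.2.1, -t.2.2) (fun a => a - t) (fun a ha => Finset.mem_image_of_mem _ ha)
      (fun b hb => by simpa using hb) ?_ ?_ ?_ <;> intro a ha <;> obtain ⟨b, _, rfl⟩ := (hmem a).1 ha <;> simp

end TD
end

section
namespace TD

/-- The prime used for rank certificates. -/
def P : ℕ := 10007

theorem P_pos : 0 < P := by norm_num [P]

/-- Evaluate the natural number `x` before passing it on. -/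
noncomputable def force {α : Type} (x : ℕ) (f : ℕ → α) : α :=
  Nat.rec (motive := fun _ => α) (f 0) (fun n _ => f n) (Nat.add x 1)

theorem force_eq {α : Type} (x : ℕ) (f : ℕ → α) : force x f = f x := rfl

/-- The base of the packed representation. -/
def BB : ℕ := 281474976710656

/-- Find a row whose lowest digit is not divisible by `P`. -/
noncomputable def findPiv (rows : List ℕ) : List ℕ → (ℕ → List ℕ → List ℕ → Bool) → Bool :=
  List.rec (motive := fun _ => List ℕ → (ℕ → List ℕ → List ℕ → Bool) → Bool) (fun _ _ => false)
    (fun r t ih acc k => Bool.rec (motive := fun _ => Bool) (k r t acc) (ih (r :: acc) k)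
      (Nat.beq (Nat.mod (Nat.mod r BB) P) 0)) rows

theorem findPiv_cons (r : ℕ) (t acc : List ℕ) (k : ℕ → List ℕ → List ℕ → Bool) : findPiv (r :: t) acc k =
    bif Nat.beq (r % BB % P) 0 then findPiv t (r :: acc) k else k r t acc := by
  cases h : Nat.beq (r % BB % P) 0
  · change Bool.rec (motive := fun _ => Bool) (k r t acc) (findPiv t (r :: acc) k) (Nat.beq (r % BB % P) 0) = _
    rw [h]; rfl
  · change Bool.rec (motive := fun _ => Bool) (k r t acc) (findPiv t (r :: acc) k) (Nat.beq (r % BB % P) 0) = _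
    rw [h]; rfl

/-- Reduce all digits modulo `P`, up to a small multiple of `P`. -/
def red (mask r : ℕ) : ℕ :=
  Nat.sub r (Nat.mul P (Nat.div (Nat.land (Nat.mul r 53649) mask) 536870912))

theorem red_eq (mask r : ℕ) : red mask r = r - P * (Nat.land (r * 53649) mask / 536870912) := rfl

/-- The mask for `red`. -/
def mkMask : ℕ → ℕ
  | 0 => 0
  | n + 1 => 281474439839744 + BB * mkMask n

/-- Eliminate the lowest digit of all rows. -/
noncomputable def updRows (mask x p : ℕ) (rows : List ℕ) : List ℕ → (List ℕ → Bool) → Bool :=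
  List.rec (motive := fun _ => List ℕ → (List ℕ → Bool) → Bool) (fun acc k => k acc)
    (fun r _ ih acc k =>
      force (Nat.div (Nat.add (Nat.mul r x) (Nat.mul (Nat.sub P (Nat.mod (Nat.mod r BB) P)) p)) BB) fun s =>
        force (red mask s) fun r' => ih (r' :: acc) k) rows

theorem updRows_cons (mask x p r : ℕ) (t acc : List ℕ) (k : List ℕ → Bool) : updRows mask x p (r :: t) acc k =
    force ((r * x + (P - r % BB % P) * p) / BB) fun s => force (red mask s) fun r' =>
      updRows mask x p t (r' :: acc) k := rfl

/-- Gaussian elimination on packed rows. -/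
noncomputable def elim (mask n : ℕ) : List ℕ → Bool :=
  Nat.rec (motive := fun _ => List ℕ → Bool) (fun _ => true) (fun _ ih rows =>
    findPiv rows [] fun p t a => force (Nat.mod (Nat.mod p BB) P) fun x =>
      updRows mask x p a [] fun s => updRows mask x p t s fun s => ih s) n

theorem elim_succ (mask n : ℕ) (rows : List ℕ) : elim mask (n + 1) rows =
    findPiv rows [] fun p t a => force (p % BB % P) fun x =>
      updRows mask x p a [] fun s => updRows mask x p t s fun s => elim mask n s := rfl

theorem findPiv_spec {rows acc : List ℕ} {k : ℕ → List ℕ → List ℕ → Bool} (h : findPiv rows acc k = true) :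
    ∃ p t a, k p t a = true ∧ p % BB % P ≠ 0 ∧ p ∈ rows ∧ ∀ r ∈ t ++ a, r ∈ rows ∨ r ∈ acc := by
  induction rows generalizing acc with
  | nil => exact absurd h Bool.false_ne_true
  | cons r t ih =>
    rw [findPiv_cons] at h
    cases hb : Nat.beq (r % BB % P) 0 with
    | true =>
      rw [hb, cond_true] at h
      obtain ⟨p, t', a', h1, h2, h3, h4⟩ := ih h
      refine ⟨p, t', a', h1, h2, List.mem_cons_of_mem _ h3, fun q hq => ?_⟩
      rcases h4 q hq with h | h
      · exact Or.inl (List.mem_cons_of_mem _ h)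
      · rcases List.mem_cons.1 h with rfl | h
        · exact Or.inl (List.mem_cons_self)
        · exact Or.inr h
    | false =>
      rw [hb, cond_false] at h
      refine ⟨r, t, acc, h, Nat.ne_of_beq_eq_false hb, List.mem_cons_self, fun q hq => ?_⟩
      rcases List.mem_append.1 hq with h | h
      · exact Or.inl (List.mem_cons_of_mem _ h)
      · exact Or.inr h

/-- The pairing of a row and a vector. -/
def dot : List ℕ → List ℤ → ℤ
  | d :: ds, v :: vs => d * v + dot ds vs
  | _, _ => 0

theorem dot_comb (x y : ℕ) (vs : List ℤ) : ∀ (ds es : List ℕ), ds.length = vs.length → es.length = vs.length →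
    dot (List.zipWith (fun d e => x * d + y * e) ds es) vs = x * dot ds vs + y * dot es vs := by
  induction vs with
  | nil => intro ds es h1 h2; simp [List.length_eq_zero_iff.1 h1, dot]
  | cons v vs ih =>
    intro ds es h1 h2
    match ds, es with
    | d :: ds, e :: es =>
      simp only [List.length_cons, add_left_inj] at h1 h2
      simp only [List.zipWith_cons_cons, dot, ih ds es h1 h2]
      push_cast; ring

theorem ofDigits_comb (B x y : ℕ) : ∀ (ds es : List ℕ), ds.length = es.length →
    Nat.ofDigits B (List.zipWith (fun d e => x * d + y * e) ds es) =
      x * Nat.ofDigits B ds + y * Nat.ofDigits B es := by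
  intro ds
  induction ds with
  | nil => intro es h; rw [List.length_nil] at h; simp [List.length_eq_zero_iff.1 h.symm]
  | cons d ds ih =>
    intro es h
    match es with
    | e :: es =>
      simp only [List.length_cons, add_left_inj] at h
      simp only [List.zipWith_cons_cons, Nat.ofDigits_cons, ih es h]
      ring

theorem prime_P : Nat.Prime P := by norm_num [P]

theorem bound_comb {x y d e β : ℕ} (hx : x ≤ P) (hy : y ≤ P) (hd : d ≤ β) (he : e ≤ β) :
    x * d + y * e ≤ 2 * P * β := by
  have h1 := Nat.mul_le_mul hx hd
  have h2 := Nat.mul_le_mul hy he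
  calc x * d + y * e ≤ P * β + P * β := add_le_add h1 h2
    _ = 2 * P * β := by ring

theorem zipWith_bound {x y β : ℕ} (hx : x ≤ P) (hy : y ≤ P) : ∀ (ds es : List ℕ), (∀ d ∈ ds, d ≤ β) → (∀ d ∈ es, d ≤ β) →
    ∀ z ∈ List.zipWith (fun d e => x * d + y * e) ds es, z ≤ 2 * P * β := by
  intro ds
  induction ds with
  | nil => simp
  | cons d ds ih =>
    intro es h1 h2
    match es with
    | [] => simp
    | e :: es =>
      simp only [List.zipWith_cons_cons, List.mem_cons, forall_eq_or_imp] at h1 h2 ⊢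
      exact ⟨bound_comb hx hy h1.1 h2.1, ih es h1.2 h2.2⟩

theorem updRows_spec {mask x p : ℕ} (rows acc : List ℕ) (k : List ℕ → Bool) :
    updRows mask x p rows acc k =
      k ((rows.map fun r => red mask ((r * x + (P - r % BB % P) * p) / BB)).reverse ++ acc) := by
  induction rows generalizing acc with
  | nil => rfl
  | cons r t ih => rw [updRows_cons, force_eq, force_eq, ih]; simp

theorem land_split {w a b c d : ℕ} (hb : b < 2 ^ w) (hd : d < 2 ^ w) :
    Nat.land (2 ^ w * a + b) (2 ^ w * c + d) = 2 ^ w * Nat.land a c + Nat.land b d := by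
  have hbd : Nat.land b d < 2 ^ w := Nat.and_lt_two_pow _ hd
  apply Nat.eq_of_testBit_eq
  intro i
  have e := Nat.testBit_and (2 ^ w * a + b) (2 ^ w * c + d) i
  have e1 := Nat.testBit_and a c (i - w)
  have e2 := Nat.testBit_and b d i
  refine Eq.trans e ?_
  rw [Nat.testBit_two_pow_mul_add _ hb, Nat.testBit_two_pow_mul_add _ hd, Nat.testBit_two_pow_mul_add _ hbd]
  split
  · exact e2.symm
  · exact e1.symm

theorem land_digit {e : ℕ} (he : e < 2 ^ 48) : Nat.land e 281474439839744 = 2 ^ 29 * (e / 2 ^ 29) := by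
  have h := land_split (w := 29) (a := e / 2 ^ 29) (b := e % 2 ^ 29) (c := 2 ^ 19 - 1) (d := 0)
    (Nat.mod_lt _ (by norm_num)) (by norm_num)
  rw [Nat.div_add_mod] at h
  have h1 : Nat.land (e / 2 ^ 29) (2 ^ 19 - 1) = e / 2 ^ 29 := by
    have := Nat.and_two_pow_sub_one_eq_mod (e / 2 ^ 29) 19
    refine Eq.trans this (Nat.mod_eq_of_lt ?_)
    omega
  have h2 : Nat.land (e % 2 ^ 29) 0 = 0 := Nat.and_zero _
  rw [h1, h2] at h
  exact h

theorem land_mask (ds : List ℕ) : ∀ n, ds.length ≤ n → (∀ d ∈ ds, d < BB) →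
    Nat.land (Nat.ofDigits BB ds) (mkMask n) = 2 ^ 29 * Nat.ofDigits BB (ds.map fun d => d / 2 ^ 29) := by
  induction ds with
  | nil => intro n _ _; simp only [Nat.ofDigits_nil, List.map_nil, mul_zero]; exact Nat.zero_and _
  | cons d ds ih =>
    intro n hn hd
    match n with
    | n + 1 =>
      simp only [List.length_cons, add_le_add_iff_right] at hn
      simp only [List.mem_cons, forall_eq_or_imp] at hd
      have hB : BB = 2 ^ 48 := by norm_num [BB]
      have hd1 : d < 2 ^ 48 := hB ▸ hd.1
      rw [mkMask, Nat.ofDigits_cons, List.map_cons, Nat.ofDigits_cons]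
      have h := land_split (w := 48) (a := Nat.ofDigits BB ds) (c := mkMask n) hd1
        (show 281474439839744 < 2 ^ 48 by norm_num)
      rw [ih n hn hd.2, land_digit hd1, ← hB] at h
      rw [add_comm d, add_comm 281474439839744, h]
      ring

/-- Reduction of one digit. -/
def rho (d : ℕ) : ℕ := d - P * (d * 53649 / 2 ^ 29)

theorem rho_spec {d : ℕ} (hd : d ≤ 400560196) : d = rho d + P * (d * 53649 / 2 ^ 29) ∧ rho d ≤ 2 * P := by
  unfold rho P
  omega

theorem red_spec {n : ℕ} (ds : List ℕ) (hn : ds.length ≤ n) (hd : ∀ d ∈ ds, d ≤ 400560196) :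
    red (mkMask n) (Nat.ofDigits BB ds) = Nat.ofDigits BB (ds.map rho) := by
  have h1 : Nat.ofDigits BB ds * 53649 = Nat.ofDigits BB (ds.map fun d => d * 53649) := by
    clear hn hd
    induction ds with
    | nil => simp
    | cons d ds ih => simp only [List.map_cons, Nat.ofDigits_cons, ← ih]; ring
  have h2 := land_mask (ds.map fun d => d * 53649) n (by simpa using hn) (by
    intro e he
    obtain ⟨d, hd', rfl⟩ := List.mem_map.1 he
    have := hd d hd'
    unfold BB
    omega)
  have h3 : Nat.ofDigits BB ds = Nat.ofDigits BB (ds.map rho) +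
      P * Nat.ofDigits BB ((ds.map fun d => d * 53649).map fun d => d / 2 ^ 29) := by
    clear h1 h2 hn
    induction ds with
    | nil => simp
    | cons d ds ih =>
      simp only [List.mem_cons, forall_eq_or_imp] at hd
      simp only [List.map_cons, Nat.ofDigits_cons, ih hd.2]
      have := (rho_spec hd.1).1
      generalize rho d = y at *
      generalize d * 53649 / 2 ^ 29 = z at *
      rw [this]; ring
  rw [red_eq, h1, h2]
  have h4 : (536870912 : ℕ) = 2 ^ 29 := by norm_num
  rw [h4, Nat.mul_div_cancel_left _ (by norm_num)]
  omega

theorem dot_rho (ds : List ℕ) : ∀ vs : List ℤ, (∀ d ∈ ds, d ≤ 400560196) →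
    (P : ℤ) ∣ dot ds vs - dot (ds.map rho) vs := by
  induction ds with
  | nil => intro vs _; simp [dot]
  | cons d ds ih =>
    intro vs hd
    simp only [List.mem_cons, forall_eq_or_imp] at hd
    cases vs with
    | nil => simp [dot]
    | cons v vs =>
      simp only [List.map_cons, dot]
      obtain ⟨u, hu⟩ := ih vs hd.2
      have := (rho_spec hd.1).1
      generalize rho d = y at *
      generalize d * 53649 / 2 ^ 29 = z at *
      refine ⟨z * v + u, ?_⟩
      rw [mul_add, ← hu, this]; push_cast; ring

theorem elim_spec {n : ℕ} (vs : List ℤ) : ∀ (rows : List ℕ), vs.length ≤ n →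
    elim (mkMask n) vs.length rows = true →
    (∀ r ∈ rows, ∃ ds : List ℕ, ds.length = vs.length ∧ r = Nat.ofDigits BB ds ∧ (∀ d ∈ ds, d ≤ 2 * P) ∧
      (P : ℤ) ∣ dot ds vs) → ∀ v ∈ vs, (P : ℤ) ∣ v := by
  induction vs with
  | nil => simp
  | cons v vs ih =>
    intro rows hn h hr
    rw [List.length_cons, elim_succ] at h
    obtain ⟨p, t, a, h1, h2, h3, h4⟩ := findPiv_spec h
    rw [force_eq, updRows_spec, updRows_spec, List.append_nil, ← List.reverse_append, ← List.map_append] at h1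
    replace h4 : ∀ r ∈ a ++ t, r ∈ rows ∨ r ∈ ([] : List ℕ) := fun r hr => h4 r (by simpa [or_comm] using hr)
    obtain ⟨es, le, rfl, be, de⟩ := hr p h3
    match es with
    | e :: es =>
    simp only [List.length_cons, add_left_inj] at le
    simp only [List.mem_cons, forall_eq_or_imp] at be
    have hPP : 2 * P * (2 * P) = 400560196 := by norm_num [P]
    have hβB : 2 * P * (2 * P) < BB := by norm_num [P, BB]
    have hβB' : 2 * P < BB := by norm_num [P, BB]
    have hdig : ∀ (d : ℕ) (ds : List ℕ), d ≤ 2 * P → Nat.ofDigits BB (d :: ds) % BB = d := by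
      intro d ds hd
      rw [Nat.ofDigits_cons, Nat.add_mul_mod_self_left, Nat.mod_eq_of_lt]
      omega
    rw [hdig e es be.1] at h1 h2
    set x := e % P with hx
    have hxP : x ≤ P := (Nat.mod_lt _ P_pos).le
    have hB0 : 0 < BB := by norm_num [BB]
    have key := ih _ (by rw [List.length_cons] at hn; omega) h1 (by
      intro r hr'
      simp only [List.mem_reverse, List.mem_map] at hr'
      obtain ⟨s, hs, rfl⟩ := hr'
      have hs' : s ∈ rows := by
        rcases h4 s hs with h | h
        · exact h
        · simp at h
      obtain ⟨ds, ld, rfl, bd, dd⟩ := hr s hs'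
      match ds with
      | d :: ds =>
      simp only [List.length_cons, add_left_inj] at ld
      simp only [List.mem_cons, forall_eq_or_imp] at bd
      rw [hdig d ds bd.1]
      set y := P - d % P with hy
      have hyP : y ≤ P := Nat.sub_le _ _
      have hzb := zipWith_bound hxP hyP ds es bd.2 be.2
      rw [hPP] at hzb
      refine ⟨(List.zipWith (fun d e => x * d + y * e) ds es).map rho, by simp [ld, le], ?_, ?_, ?_⟩
      · rw [← red_spec (n := n) _ (by simp only [List.length_zipWith, ld, le]; rw [List.length_cons] at hn; omega) hzb]
        congr 1
        rw [ofDigits_comb BB x y ds es (ld.trans le.symm), Nat.ofDigits_cons, Nat.ofDigits_cons]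
        have e1 : (d + BB * Nat.ofDigits BB ds) * x + y * (e + BB * Nat.ofDigits BB es) =
            (x * d + y * e) + BB * (x * Nat.ofDigits BB ds + y * Nat.ofDigits BB es) := by ring
        rw [e1, Nat.add_mul_div_left _ _ hB0, Nat.div_eq_of_lt, zero_add]
        exact lt_of_le_of_lt (bound_comb hxP hyP bd.1 be.1) hβB
      · intro z hz
        obtain ⟨z', hz', rfl⟩ := List.mem_map.1 hz
        exact (rho_spec (hzb z' hz')).2
      · refine (dvd_sub_right ?_).1 (dot_rho _ vs hzb)
        rw [dot_comb x y vs ds es ld le]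
        simp only [dot] at dd de
        have e2 : (P : ℤ) ∣ (x * d + y * e : ℤ) := by
          have hlt := Nat.mod_lt d P_pos
          have hy' : (y : ℤ) = P - (d % P : ℕ) := by rw [hy]; push_cast [hlt.le]; ring
          have hx' : (x : ℤ) = (e : ℤ) % (P : ℤ) := by rw [hx]; push_cast; ring
          have hd' : ((d % P : ℕ) : ℤ) = (d : ℤ) % (P : ℤ) := by push_cast; ring
          rw [hy', hx', hd']
          rw [Int.emod_def, Int.emod_def]
          exact ⟨-((e : ℤ) / P) * d + e + ((d : ℤ) / P) * e, by ring⟩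
        have e3 : (x : ℤ) * dot ds vs + y * dot es vs =
            x * (d * v + dot ds vs) + y * (e * v + dot es vs) - v * (x * d + y * e) := by ring
        rw [e3]
        exact dvd_sub (dvd_add (Dvd.dvd.mul_left dd _) (Dvd.dvd.mul_left de _)) (Dvd.dvd.mul_left e2 _))
    have hdot : (P : ℤ) ∣ dot es vs := by
      have : ∀ (vs : List ℤ) (es : List ℕ), (∀ v ∈ vs, (P : ℤ) ∣ v) → (P : ℤ) ∣ dot es vs := by
        intro vs
        induction vs with
        | nil => intro es _; cases es <;> simp [dot]
        | cons v vs ih =>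
          intro es h
          cases es with
          | nil => simp [dot]
          | cons e es =>
            rw [dot]
            exact dvd_add (Dvd.dvd.mul_left (h v List.mem_cons_self) _)
              (ih es fun u hu => h u (List.mem_cons_of_mem _ hu))
      exact this vs es key
    have hv : (P : ℤ) ∣ e * v := by
      rw [dot] at de
      exact (dvd_add_left hdot).1 de
    have hv' : (P : ℤ) ∣ v := by
      rcases (Nat.prime_iff_prime_int.1 prime_P).dvd_or_dvd hv with h | h
      · exfalso
        apply h2
        rw [hx]
        exact Nat.mod_eq_zero_of_dvd (by exact_mod_cast h)
      · exact h
    intro u hu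
    rcases List.mem_cons.1 hu with rfl | hu
    · exact hv'
    · exact key u hu

/-- The points used in the certificates. -/
def pts : List E :=
  [(1, 1, 1), (2, 3, 5), (3, 7, 2), (5, 2, 11), (7, 13, 3), (11, 5, 17), (13, 17, 7), (17, 11, 19), (19, 23, 13),
    (23, 19, 29), (29, 31, 23), (31, 29, 37), (37, 41, 31), (41, 37, 43), (43, 47, 41), (47, 43, 53), (53, 59, 47),
    (59, 53, 61), (61, 67, 59), (67, 61, 71), (71, 73, 67), (73, 71, 79), (79, 83, 73), (83, 79, 89), (89, 97, 83),
    (97, 89, 101), (101, 103, 97), (103, 101, 107), (107, 109, 103), (109, 107, 113)]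

/-- Monomial values at a point. -/
noncomputable def monL (p1 p2 p3 : ℕ) (D : List E) : (List ℕ → Bool) → Bool :=
  List.rec (motive := fun _ => (List ℕ → Bool) → Bool) (fun k => k [])
    (fun a _ ih k => Prod.rec (motive := fun _ => Bool) (fun a bc => Prod.rec (motive := fun _ => Bool) (fun b c =>
      force (Nat.mod (Nat.mul (Nat.mul (Nat.pow p1 a) (Nat.pow p2 b)) (Nat.pow p3 c)) P)
        fun x => ih fun s => k (x :: s)) bc) a) D

/-- Componentwise product. -/
noncomputable def mulL (A : List ℕ) : List ℕ → (List ℕ → Bool) → Bool :=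
  List.rec (motive := fun _ => List ℕ → (List ℕ → Bool) → Bool) (fun _ k => k [])
    (fun a _ ih L k => List.rec (motive := fun _ => Bool) (k [])
      (fun l L _ => force (Nat.mul a l) fun x => ih L fun s => k (x :: s)) L) A

/-- A packed row. -/
noncomputable def pack (L : List ℕ) : ℕ :=
  List.rec (motive := fun _ => ℕ) 0 (fun a _ ih => Nat.add a (Nat.mul BB ih)) L

/-- Generate rows. -/
noncomputable def genZ (mask : ℕ) (C : List ℕ) (m : ℕ) : List ℕ → List ℕ → (List ℕ → Bool) → Bool :=
  Nat.rec (motive := fun _ => List ℕ → List ℕ → (List ℕ → Bool) → Bool) (fun _ acc k => k acc)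
    (fun m ih L acc k => force (red mask (pack L)) fun r =>
      Nat.rec (motive := fun _ => Bool) (k (r :: acc)) (fun _ _ => mulL C L fun L' => ih L' (r :: acc) k) m) m

/-- Generate rows. -/
noncomputable def genY (mask : ℕ) (B C : List ℕ) (m : ℕ) : List ℕ → List ℕ → (List ℕ → Bool) → Bool :=
  Nat.rec (motive := fun _ => List ℕ → List ℕ → (List ℕ → Bool) → Bool) (fun _ acc k => k acc)
    (fun m ih L acc k => Nat.rec (motive := fun _ => Bool) (force (red mask (pack L)) fun r => k (r :: acc))
      (fun _ _ => genZ mask C (Nat.succ m) L acc fun acc' => mulL B L fun L' => ih L' acc' k) m) m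

/-- Generate rows. -/
noncomputable def genX (mask : ℕ) (A B C : List ℕ) (m : ℕ) : List ℕ → List ℕ → (List ℕ → Bool) → Bool :=
  Nat.rec (motive := fun _ => List ℕ → List ℕ → (List ℕ → Bool) → Bool) (fun _ acc k => k acc)
    (fun m ih L acc k => Nat.rec (motive := fun _ => Bool) (force (red mask (pack L)) fun r => k (r :: acc))
      (fun _ _ => genY mask B C (Nat.succ m) L acc fun acc' => mulL A L fun L' => ih L' acc' k) m) m

/-- All rows. -/
noncomputable def mkRows (mask : ℕ) (D : List E) (A B C : List ℕ) (ms : List ℕ) :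
    List E → List ℕ → (List ℕ → Bool) → Bool :=
  List.rec (motive := fun _ => List E → List ℕ → (List ℕ → Bool) → Bool) (fun _ acc k => k acc)
    (fun m _ ih ps acc k => List.rec (motive := fun _ => Bool) false (fun p ps _ =>
      Prod.rec (motive := fun _ => Bool) (fun p1 p23 => Prod.rec (motive := fun _ => Bool) (fun p2 p3 =>
        monL p1 p2 p3 D fun L => genX mask A B C m L acc fun acc' => ih ps acc' k) p23) p) ps) ms

theorem mkRows_cons (mask : ℕ) (D : List E) (A B C : List ℕ) (m : ℕ) (ms : List ℕ) (p1 p2 p3 : ℕ) (ps : List E)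
    (acc : List ℕ) (k : List ℕ → Bool) : mkRows mask D A B C (m :: ms) ((p1, p2, p3) :: ps) acc k =
    monL p1 p2 p3 D fun L => genX mask A B C m L acc fun acc' => mkRows mask D A B C ms ps acc' k := rfl

theorem mulL_cons (a l : ℕ) (A L : List ℕ) (k : List ℕ → Bool) :
    mulL (a :: A) (l :: L) k = force (a * l) fun x => mulL A L fun s => k (x :: s) := rfl

theorem monL_cons (p1 p2 p3 a b c : ℕ) (D : List E) (k : List ℕ → Bool) : monL p1 p2 p3 ((a, b, c) :: D) k =
    force ((p1 ^ a * p2 ^ b * p3 ^ c) % P) fun x => monL p1 p2 p3 D fun s => k (x :: s) := rfl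

theorem genZ_one (mask : ℕ) (C : List ℕ) (L acc : List ℕ) (k : List ℕ → Bool) :
    genZ mask C 1 L acc k = k (red mask (pack L) :: acc) := rfl

theorem genZ_succ (mask : ℕ) (C : List ℕ) (m : ℕ) (L acc : List ℕ) (k : List ℕ → Bool) :
    genZ mask C (m + 2) L acc k =
      mulL C L fun L' => genZ mask C (m + 1) L' (red mask (pack L) :: acc) k := rfl

theorem genY_one (mask : ℕ) (B C : List ℕ) (L acc : List ℕ) (k : List ℕ → Bool) :
    genY mask B C 1 L acc k = k (red mask (pack L) :: acc) := rfl

theorem genY_succ (mask : ℕ) (B C : List ℕ) (m : ℕ) (L acc : List ℕ) (k : List ℕ → Bool) :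
    genY mask B C (m + 2) L acc k =
      genZ mask C (m + 2) L acc fun acc' => mulL B L fun L' => genY mask B C (m + 1) L' acc' k := rfl

theorem genX_one (mask : ℕ) (A B C : List ℕ) (L acc : List ℕ) (k : List ℕ → Bool) :
    genX mask A B C 1 L acc k = k (red mask (pack L) :: acc) := rfl

theorem genX_succ (mask : ℕ) (A B C : List ℕ) (m : ℕ) (L acc : List ℕ) (k : List ℕ → Bool) :
    genX mask A B C (m + 2) L acc k =
      genY mask B C (m + 2) L acc fun acc' => mulL A L fun L' => genX mask A B C (m + 1) L' acc' k := rfl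

theorem monL_eq (p1 p2 p3 : ℕ) (D : List E) : ∀ k,
    monL p1 p2 p3 D k = k (D.map fun a => (p1 ^ a.1 * p2 ^ a.2.1 * p3 ^ a.2.2) % P) := by
  induction D with
  | nil => intro k; rfl
  | cons a D ih => intro k; obtain ⟨a, b, c⟩ := a; rw [monL_cons, force_eq, ih]; rfl

theorem mulL_eq (D : List E) (f g : E → ℕ) : ∀ k, mulL (D.map f) (D.map g) k = k (D.map fun a => f a * g a) := by
  induction D with
  | nil => intro k; rfl
  | cons a D ih => intro k; simp only [List.map_cons, mulL_cons, force_eq, ih]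

theorem pack_eq (L : List ℕ) : pack L = Nat.ofDigits BB L := by
  induction L with
  | nil => rfl
  | cons a D ih => change a + BB * pack D = _; rw [ih, Nat.ofDigits_cons]

/-- Rows of the form produced by `genX`. -/
def IsRow (mask : ℕ) (D : List E) (M : ℕ) (μ : E → ℕ) (r : ℕ) : Prop :=
  ∃ g : E → ℕ, Pol M (fun a => (g a : ℚ)) ∧ (∀ a, a ∈ D → g a ≤ 20 ^ 3) ∧
    r = red mask (Nat.ofDigits BB (D.map fun a => g a * μ a))

/-- Intermediate functions. -/
def IsFun (D : List E) (j : ℕ) (g : E → ℕ) : Prop :=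
  Pol (j + 1) (fun a => (g a : ℚ)) ∧ ∀ a, a ∈ D → g a ≤ 20 ^ j

theorem IsFun.mulx {D : List E} (hD : ∀ a ∈ D, a.1 ≤ 20) {j : ℕ} {g : E → ℕ} (h : IsFun D j g) :
    IsFun D (j + 1) fun a => a.1 * g a :=
  ⟨by simpa using Pol.mulx h.1, fun a ha => by rw [pow_succ, mul_comm (20 ^ j)]; exact Nat.mul_le_mul (hD a ha) (h.2 a ha)⟩

theorem IsFun.muly {D : List E} (hD : ∀ a ∈ D, a.2.1 ≤ 20) {j : ℕ} {g : E → ℕ} (h : IsFun D j g) :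
    IsFun D (j + 1) fun a => a.2.1 * g a :=
  ⟨by simpa using Pol.muly h.1, fun a ha => by rw [pow_succ, mul_comm (20 ^ j)]; exact Nat.mul_le_mul (hD a ha) (h.2 a ha)⟩

theorem IsFun.mulz {D : List E} (hD : ∀ a ∈ D, a.2.2 ≤ 20) {j : ℕ} {g : E → ℕ} (h : IsFun D j g) :
    IsFun D (j + 1) fun a => a.2.2 * g a :=
  ⟨by simpa using Pol.mulz h.1, fun a ha => by rw [pow_succ, mul_comm (20 ^ j)]; exact Nat.mul_le_mul (hD a ha) (h.2 a ha)⟩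

theorem IsFun.row {D : List E} {j M : ℕ} {g : E → ℕ} (h : IsFun D j g) (hj : j < M) (hM : M ≤ 4) (mask : ℕ) (μ : E → ℕ) :
    IsRow mask D M μ (red mask (pack (D.map fun a => g a * μ a))) :=
  ⟨g, h.1.mono hj, fun a ha => (h.2 a ha).trans (Nat.pow_le_pow_right (by norm_num) (by omega)), by rw [pack_eq]⟩

theorem genZ_spec {mask : ℕ} {D : List E} {M : ℕ} (hM : M ≤ 4) (hC : ∀ a ∈ D, a.2.2 ≤ 20) {μ : E → ℕ} (m : ℕ) :
    ∀ (j : ℕ) (g : E → ℕ) (acc : List ℕ) (k : List ℕ → Bool), j + m ≤ M → IsFun D j g →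
    genZ mask (D.map fun a => a.2.2) m (D.map fun a => g a * μ a) acc k = true →
    ∃ rows, k rows = true ∧ ∀ r ∈ rows, r ∈ acc ∨ IsRow mask D M μ r := by
  induction m with
  | zero => intro j g acc k _ _ h; exact ⟨acc, h, fun r hr => Or.inl hr⟩
  | succ m ih =>
    intro j g acc k hj hg h
    have hrow := hg.row (M := M) (by omega) hM mask μ
    cases m with
    | zero =>
      rw [genZ_one] at h
      refine ⟨_, h, fun r hr => ?_⟩
      rcases List.mem_cons.1 hr with rfl | hr
      · exact Or.inr hrow
      · exact Or.inl hr
    | succ m =>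
      simp only [genZ_succ, mulL_eq, ← mul_assoc] at h
      obtain ⟨rows, h1, h2⟩ := ih (j + 1) _ _ _ (by omega) (hg.mulz hC) h
      refine ⟨rows, h1, fun r hr => ?_⟩
      rcases h2 r hr with h | h
      · rcases List.mem_cons.1 h with rfl | h
        · exact Or.inr hrow
        · exact Or.inl h
      · exact Or.inr h

theorem genY_spec {mask : ℕ} {D : List E} {M : ℕ} (hM : M ≤ 4) (hB : ∀ a ∈ D, a.2.1 ≤ 20) (hC : ∀ a ∈ D, a.2.2 ≤ 20)
    {μ : E → ℕ} (m : ℕ) :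
    ∀ (j : ℕ) (g : E → ℕ) (acc : List ℕ) (k : List ℕ → Bool), j + m ≤ M → IsFun D j g →
    genY mask (D.map fun a => a.2.1) (D.map fun a => a.2.2) m (D.map fun a => g a * μ a) acc k = true →
    ∃ rows, k rows = true ∧ ∀ r ∈ rows, r ∈ acc ∨ IsRow mask D M μ r := by
  induction m with
  | zero => intro j g acc k _ _ h; exact ⟨acc, h, fun r hr => Or.inl hr⟩
  | succ m ih =>
    intro j g acc k hj hg h
    cases m with
    | zero =>
      rw [genY_one] at h
      refine ⟨_, h, fun r hr => ?_⟩
      rcases List.mem_cons.1 hr with rfl | hr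
      · exact Or.inr (hg.row (M := M) (by omega) hM mask μ)
      · exact Or.inl hr
    | succ m =>
      rw [genY_succ] at h
      obtain ⟨rows, h1, h2⟩ := genZ_spec hM hC (m + 2) j g _ _ hj hg h
      simp only [mulL_eq, ← mul_assoc] at h1
      obtain ⟨rows', h1', h2'⟩ := ih (j + 1) _ _ _ (by omega) (hg.muly hB) h1
      refine ⟨rows', h1', fun r hr => ?_⟩
      rcases h2' r hr with h | h
      · exact h2 r h
      · exact Or.inr h

theorem genX_spec {mask : ℕ} {D : List E} {M : ℕ} (hM : M ≤ 4) (hA : ∀ a ∈ D, a.1 ≤ 20) (hB : ∀ a ∈ D, a.2.1 ≤ 20)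
    (hC : ∀ a ∈ D, a.2.2 ≤ 20) {μ : E → ℕ} (m : ℕ) :
    ∀ (j : ℕ) (g : E → ℕ) (acc : List ℕ) (k : List ℕ → Bool), j + m ≤ M → IsFun D j g →
    genX mask (D.map fun a => a.1) (D.map fun a => a.2.1) (D.map fun a => a.2.2) m (D.map fun a => g a * μ a) acc k = true →
    ∃ rows, k rows = true ∧ ∀ r ∈ rows, r ∈ acc ∨ IsRow mask D M μ r := by
  induction m with
  | zero => intro j g acc k _ _ h; exact ⟨acc, h, fun r hr => Or.inl hr⟩
  | succ m ih =>
    intro j g acc k hj hg h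
    cases m with
    | zero =>
      rw [genX_one] at h
      refine ⟨_, h, fun r hr => ?_⟩
      rcases List.mem_cons.1 hr with rfl | hr
      · exact Or.inr (hg.row (M := M) (by omega) hM mask μ)
      · exact Or.inl hr
    | succ m =>
      rw [genX_succ] at h
      obtain ⟨rows, h1, h2⟩ := genY_spec hM hB hC (m + 2) j g _ _ hj hg h
      simp only [mulL_eq, ← mul_assoc] at h1
      obtain ⟨rows', h1', h2'⟩ := ih (j + 1) _ _ _ (by omega) (hg.mulx hA) h1
      refine ⟨rows', h1', fun r hr => ?_⟩
      rcases h2' r hr with h | h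
      · exact h2 r h
      · exact Or.inr h

/-- The monomial as a natural number. -/
def monN (p a : E) : ℕ := p.1 ^ a.1 * p.2.1 ^ a.2.1 * p.2.2 ^ a.2.2

theorem mkRows_spec {mask : ℕ} {D : List E} (hA : ∀ a ∈ D, a.1 ≤ 20) (hB : ∀ a ∈ D, a.2.1 ≤ 20)
    (hC : ∀ a ∈ D, a.2.2 ≤ 20) (ms : List ℕ) : ∀ (ps : List E) (acc : List ℕ) (k : List ℕ → Bool), (∀ m ∈ ms, m ≤ 4) →
    mkRows mask D (D.map fun a => a.1) (D.map fun a => a.2.1) (D.map fun a => a.2.2) ms ps acc k = true →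
      ms.length ≤ ps.length ∧ ∃ rows, k rows = true ∧
      ∀ r ∈ rows, r ∈ acc ∨ ∃ q ∈ ms.zip ps, IsRow mask D q.1 (fun a => monN q.2 a % P) r := by
  induction ms with
  | nil => intro ps acc k _ h; exact ⟨by simp, acc, h, fun r hr => Or.inl hr⟩
  | cons m ms ih =>
    intro ps acc k hm h
    simp only [List.mem_cons, forall_eq_or_imp] at hm
    cases ps with
    | nil => exact absurd h Bool.false_ne_true
    | cons p ps =>
      obtain ⟨p1, p2, p3⟩ := p
      rw [mkRows_cons, monL_eq] at h
      have h0 : IsFun D 0 (fun _ => 1) := ⟨by simpa using Pol.const 0 1, by simp⟩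
      obtain ⟨rows, h1, h2⟩ := genX_spec (M := m) (μ := fun a => monN (p1, p2, p3) a % P) hm.1 hA hB hC m 0 _ acc _
        (by omega) h0 (by simpa only [one_mul, monN] using h)
      obtain ⟨h1, rows', h2', h3⟩ := ih _ _ _ hm.2 h1
      refine ⟨by simpa using h1, rows', h2', fun r hr => ?_⟩
      rcases h3 r hr with h | ⟨q, hq, h⟩
      · rcases h2 r h with h | h
        · exact Or.inl h
        · exact Or.inr ⟨(m, (p1, p2, p3)), by simp, h⟩
      · exact Or.inr ⟨q, by simp [hq], h⟩

/-- The multiplicities of a profile as a list. -/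
def MsL (x y z s : ℕ) : List ℕ :=
  List.replicate x 4 ++ (List.replicate y 3 ++ (List.replicate z 2 ++ List.replicate s 1))

theorem MsL_coe (x y z s : ℕ) : (MsL x y z s : Multiset ℕ) = Ms (x, y, z, s) := by
  simp only [MsL, Ms, ← Multiset.coe_add, Multiset.coe_replicate, add_assoc]

theorem MsL_le (x y z s : ℕ) : ∀ m ∈ MsL x y z s, m ≤ 4 := by
  intro m hm
  simp only [MsL, List.mem_append, List.mem_replicate] at hm
  omega

/-- Coordinates of a region. -/
noncomputable def coords (D : List E) : (List ℕ → List ℕ → List ℕ → Bool) → Bool :=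
  List.rec (motive := fun _ => (List ℕ → List ℕ → List ℕ → Bool) → Bool) (fun k => k [] [] [])
    (fun x _ ih k => Prod.rec (motive := fun _ => Bool) (fun a bc => Prod.rec (motive := fun _ => Bool) (fun b c =>
      Nat.ble a 20 && Nat.ble b 20 && Nat.ble c 20 && ih fun A B C => k (a :: A) (b :: B) (c :: C)) bc) x) D

theorem coords_cons (a b c : ℕ) (D : List E) (k : List ℕ → List ℕ → List ℕ → Bool) : coords ((a, b, c) :: D) k =
    (Nat.ble a 20 && Nat.ble b 20 && Nat.ble c 20 && coords D fun A B C => k (a :: A) (b :: B) (c :: C)) := rfl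

theorem coords_spec (D : List E) : ∀ k, coords D k = true → (∀ a ∈ D, a.1 ≤ 20) ∧ (∀ a ∈ D, a.2.1 ≤ 20) ∧
    (∀ a ∈ D, a.2.2 ≤ 20) ∧ k (D.map fun a => a.1) (D.map fun a => a.2.1) (D.map fun a => a.2.2) = true := by
  induction D with
  | nil => intro k h; exact ⟨by simp, by simp, by simp, h⟩
  | cons a D ih =>
    intro k h
    obtain ⟨a, b, c⟩ := a
    simp only [coords_cons, Bool.and_eq_true] at h
    obtain ⟨⟨⟨ha, hb⟩, hc⟩, h⟩ := h
    obtain ⟨h1, h2, h3, h4⟩ := ih _ h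
    simp only [List.mem_cons, forall_eq_or_imp]
    exact ⟨⟨Nat.le_of_ble_eq_true ha, h1⟩, ⟨Nat.le_of_ble_eq_true hb, h2⟩, ⟨Nat.le_of_ble_eq_true hc, h3⟩, h4⟩

/-- Full column rank modulo `P`. -/
noncomputable def fullL (D : List E) (ms : List ℕ) : Bool :=
  force D.length fun n => force (mkMask n) fun mask => coords D fun A B C =>
    mkRows mask D A B C ms pts [] fun rows => elim mask n rows

theorem dot_map (D : List E) (f : E → ℕ) (v : E → ℤ) :
    dot (D.map f) (D.map v) = (D.map fun a => (f a : ℤ) * v a).sum := by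
  induction D with
  | nil => simp [dot]
  | cons a D ih => simp [dot, ih]

theorem sum_mod (D : List E) (g f : E → ℕ) (v : E → ℤ) :
    (P : ℤ) ∣ (D.map fun a => ((g a * f a : ℕ) : ℤ) * v a).sum -
      (D.map fun a => ((g a * (f a % P) : ℕ) : ℤ) * v a).sum := by
  induction D with
  | nil => simp
  | cons a D ih =>
    simp only [List.map_cons, List.sum_cons]
    have h : (P : ℤ) ∣ (f a : ℤ) - ((f a % P : ℕ) : ℤ) := by
      push_cast; exact Int.dvd_self_sub_emod
    have e : ∀ u x y z w t : ℤ, u * x * t + z - (u * y * t + w) = (x - y) * (u * t) + (z - w) := by intros; ring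
    rw [Nat.cast_mul, Nat.cast_mul, e]
    exact dvd_add (Dvd.dvd.mul_right h _) ih

theorem fullL_spec {D : List E} {ms : List ℕ} (hms : ∀ m ∈ ms, m ≤ 4) (h : fullL D ms = true) :
    ms.length ≤ pts.length ∧
    ∀ v : E → ℤ, (∀ q ∈ ms.zip pts, ∀ g : E → ℕ, Pol q.1 (fun a => (g a : ℚ)) →
      (D.map fun a => ((g a * monN q.2 a : ℕ) : ℤ) * v a).sum = 0) →
      ∀ a ∈ D, (P : ℤ) ∣ v a := by
  rw [fullL, force_eq, force_eq] at h
  obtain ⟨hA, hB, hC, h⟩ := coords_spec D _ h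
  obtain ⟨h1, rows, h2, h3⟩ := mkRows_spec hA hB hC ms pts [] _ hms h
  refine ⟨h1, fun v hv => ?_⟩
  have hl : D.length = (D.map v).length := by simp
  have key := elim_spec (n := D.length) (D.map v) rows hl.ge
    (by rw [← hl]; exact h2) (by
      intro r hr
      rcases h3 r hr with h | ⟨q, hq, g, hg, hb, rfl⟩
      · simp at h
      · have hbd : ∀ d ∈ D.map (fun a => g a * (monN q.2 a % P)), d ≤ 400560196 := by
          intro d hd
          obtain ⟨a, ha, rfl⟩ := List.mem_map.1 hd
          calc _ ≤ 20 ^ 3 * P := Nat.mul_le_mul (hb a ha) (Nat.mod_lt _ P_pos).le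
            _ ≤ _ := by norm_num [P]
        refine ⟨_, ?_, red_spec _ (by simp) hbd, ?_, ?_⟩
        · simp
        · intro d hd
          obtain ⟨d, hd', rfl⟩ := List.mem_map.1 hd
          exact (rho_spec (hbd d hd')).2
        · refine (dvd_sub_right ?_).1 (dot_rho _ (D.map v) hbd)
          rw [dot_map]
          have := sum_mod D g (fun a => monN q.2 a) v
          rw [hv q hq g hg, zero_sub] at this
          exact (dvd_neg.1 this))
  intro a ha
  exact key _ (List.mem_map_of_mem ha)

/-- Rational coordinates. -/
def toQ (p : E) : Pt := (p.1, p.2.1, p.2.2)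

theorem toQ_inj : Function.Injective toQ := by
  rintro ⟨a, b, c⟩ ⟨a', b', c'⟩ h
  simpa [toQ] using h

theorem fullL_good {D : List E} (hD : D.Nodup) {ms : List ℕ} (hms : ∀ m ∈ ms, m ≤ 4)
    (h : fullL D ms = true) :
    Good D.toFinset (ms : Multiset ℕ) := by
  obtain ⟨h1, h2⟩ := fullL_spec hms h
  refine ⟨((ms.zip pts).map fun q => (q.1, toQ q.2) : List (ℕ × Pt)), ?_, ?_, ?_, ?_⟩
  · rw [Multiset.map_coe, List.map_map]
    have : (Prod.fst ∘ fun q : ℕ × E => (q.1, toQ q.2)) = Prod.fst := rfl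
    rw [this, List.map_fst_zip h1]
  · rw [Multiset.map_coe, List.map_map, Multiset.coe_nodup]
    have e : (Prod.snd ∘ fun q : ℕ × E => (q.1, toQ q.2)) = toQ ∘ Prod.snd := rfl
    rw [e, ← List.map_map]
    refine List.Nodup.map toQ_inj ?_
    have e2 : ∀ (ms : List ℕ) (ps : List E), ((ms.zip ps).map Prod.snd).Sublist ps := by
      intro ms
      induction ms with
      | nil => simp
      | cons m ms ih =>
        intro ps
        cases ps with
        | nil => simp
        | cons p ps => simpa using ih ps
    exact List.Nodup.sublist (e2 _ _) (by decide)
  · intro q hq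
    simp only [Multiset.mem_coe, List.mem_map] at hq
    obtain ⟨q, hq, rfl⟩ := hq
    have hp : q.2 ∈ pts := (List.of_mem_zip hq).2
    have : ∀ p ∈ pts, p.1 ≠ 0 ∧ p.2.1 ≠ 0 ∧ p.2.2 ≠ 0 := by decide
    obtain ⟨a, b, c⟩ := this _ hp
    exact ⟨by simpa [toQ] using a, by simpa [toQ] using b, by simpa [toQ] using c⟩
  · intro c hc
    obtain ⟨N, hN⟩ := IsLocalization.exist_integer_multiples_of_finset (nonZeroDivisors ℤ) (D.toFinset.image c)
    have hN0 : ((N : ℤ) : ℚ) ≠ 0 := by exact_mod_cast nonZeroDivisors.coe_ne_zero N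
    have hv : ∀ a, ∃ v : ℤ, a ∈ D → (v : ℚ) = (N : ℤ) * c a := by
      intro a
      by_cases ha : a ∈ D
      · obtain ⟨v, hv⟩ := hN (c a) (Finset.mem_image_of_mem _ (List.mem_toFinset.2 ha))
        exact ⟨v, fun _ => by simpa [Algebra.smul_def] using hv⟩
      · exact ⟨0, fun h => absurd h ha⟩
    choose v hv using hv
    have hsum : ∀ q ∈ ms.zip pts, ∀ g : E → ℕ, Pol q.1 (fun a => (g a : ℚ)) →
        (D.map fun a => ((g a * monN q.2 a : ℕ) : ℤ) * v a).sum = 0 := by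
      intro q hq g hg
      have hp := hc (q.1, toQ q.2) (Multiset.mem_coe.2 (List.mem_map.2 ⟨q, hq, rfl⟩)) _ hg
      have hq' : (((D.map fun a => ((g a * monN q.2 a : ℕ) : ℤ) * v a).sum : ℤ) : ℚ) = 0 := by
        rw [← List.sum_toFinset _ hD, Int.cast_sum]
        calc _ = ∑ a ∈ D.toFinset, ((N : ℤ) : ℚ) * (c a * ((g a : ℚ) * mon (toQ q.2) a)) := by
              refine Finset.sum_congr rfl fun a ha => ?_
              have := hv a (List.mem_toFinset.1 ha)
              simp only [monN, mon, toQ]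
              push_cast
              rw [this]; ring
          _ = 0 := by rw [← Finset.mul_sum, hp, mul_zero]
      exact_mod_cast hq'
    have hpow : ∀ k : ℕ, ∃ u : E → ℤ, ∀ a ∈ D, v a = (P : ℤ) ^ k * u a := by
      intro k
      induction k with
      | zero => exact ⟨v, fun a _ => by simp⟩
      | succ k ih =>
        obtain ⟨u, hu⟩ := ih
        have := h2 u (by
          intro q hq g hg
          have h0 := hsum q hq g hg
          have e1 : (D.map fun a => ((g a * monN q.2 a : ℕ) : ℤ) * v a) = D.map fun a => (P : ℤ) ^ k * (((g a * monN q.2 a : ℕ) : ℤ) * u a) := by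
            refine List.map_congr_left fun a ha => ?_
            rw [hu a ha]; ring
          rw [e1, List.sum_map_mul_left] at h0
          exact (mul_eq_zero.1 h0).resolve_left (pow_ne_zero _ (by exact_mod_cast P_pos.ne')))
        refine ⟨fun a => u a / P, fun a ha => ?_⟩
        rw [hu a ha, pow_succ, mul_assoc, Int.mul_ediv_cancel' (this a ha)]
    intro a ha
    have ha := List.mem_toFinset.1 ha
    have hva : v a = 0 := by
      by_contra hne
      obtain ⟨u, hu⟩ := hpow (v a).natAbs
      have hd : (P : ℤ) ^ (v a).natAbs ∣ v a := ⟨_, hu a ha⟩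
      have h3 := Int.natAbs_dvd_natAbs.2 hd
      have h4 := Nat.le_of_dvd (Int.natAbs_pos.2 hne) h3
      rw [Int.natAbs_pow, Int.natAbs_natCast] at h4
      exact absurd (Nat.lt_pow_self (n := (v a).natAbs) (show 1 < P by norm_num [P])) (not_lt.2 h4)
    have := hv a ha
    rw [hva, Int.cast_zero] at this
    exact (mul_eq_zero.1 this.symm).resolve_left hN0

end TD
end

section
namespace TD
open scoped Pointwise

/-- Cutting trees; a node carries the code of a linear functional and a threshold. -/
inductive Tr : Type
  | l : Tr
  | n : ℕ → Tr → Tr → Tr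

/-- Trees of bulk tiles. -/
inductive PTr : Type
  | p : Tr → Tr → Tr → PTr
  | q : ℕ → PTr → PTr → PTr

/-- Split a list with a linear functional. -/
noncomputable def part (w0 w1 w2 t : ℕ) (D : List E) : List E → List E → (List E → List E → Bool) → Bool :=
  List.rec (motive := fun _ => List E → List E → (List E → List E → Bool) → Bool) (fun l r k => k l r)
    (fun x _ ih l r k => Bool.rec (motive := fun _ => Bool) (ih l (x :: r) k) (ih (x :: l) r k)
      (Prod.rec (motive := fun _ => Bool) (fun a bc => Prod.rec (motive := fun _ => Bool) (fun b c =>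
        Nat.ble (Nat.add (Nat.add (Nat.add (Nat.mul w0 a) (Nat.mul w1 b)) (Nat.mul w2 c)) 301)
          (Nat.add t (Nat.mul 6 (Nat.add (Nat.add a b) c)))) bc) x)) D

theorem part_cons (w0 w1 w2 t a b c : ℕ) (D l r : List E) (k : List E → List E → Bool) :
    part w0 w1 w2 t ((a, b, c) :: D) l r k =
    bif Nat.ble (w0 * a + w1 * b + w2 * c + 301) (t + 6 * (a + b + c)) then part w0 w1 w2 t D ((a, b, c) :: l) r k
    else part w0 w1 w2 t D l ((a, b, c) :: r) k := by
  have h : part w0 w1 w2 t ((a, b, c) :: D) l r k =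
    Bool.rec (motive := fun _ => Bool) (part w0 w1 w2 t D l ((a, b, c) :: r) k) (part w0 w1 w2 t D ((a, b, c) :: l) r k)
      (Nat.ble (w0 * a + w1 * b + w2 * c + 301) (t + 6 * (a + b + c))) := rfl
  rw [h]
  cases Nat.ble (w0 * a + w1 * b + w2 * c + 301) (t + 6 * (a + b + c)) <;> rfl

/-- Split a list with the functional of the given code. -/
noncomputable def cutL (c : ℕ) (D : List E) (k : List E → List E → Bool) : Bool :=
  bif Nat.beq (c / 1000) 1098 then false else
    force (c / 169000) fun w0 => force (c / 13000 % 13) fun w1 => force (c / 1000 % 13) fun w2 =>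
      force (c % 1000) fun t => part w0 w1 w2 t D [] [] k

theorem part_spec (w0 w1 w2 t : ℕ) (D : List E) : ∀ (l r : List E) (k : List E → List E → Bool),
    (l ++ r ++ D).Nodup →
    part w0 w1 w2 t D l r k = true →
    ∃ l' r', k l' r' = true ∧ (l' ++ r').Nodup ∧ (∀ a, a ∈ l' ∨ a ∈ r' ↔ a ∈ l ∨ a ∈ r ∨ a ∈ D) ∧
      (∀ a ∈ l', a ∈ l ∨ wt ((w0 : ℤ) - 6, (w1 : ℤ) - 6, (w2 : ℤ) - 6) a < (t : ℤ) - 300) ∧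
      (∀ a ∈ r', a ∈ r ∨ (t : ℤ) - 300 ≤ wt ((w0 : ℤ) - 6, (w1 : ℤ) - 6, (w2 : ℤ) - 6) a) := by
  induction D with
  | nil =>
    intro l r k hn h
    exact ⟨l, r, h, by simpa using hn, by simp, fun a ha => Or.inl ha, fun a ha => Or.inl ha⟩
  | cons a D ih =>
    intro l r k hn h
    obtain ⟨a, b, c⟩ := a
    rw [part_cons] at h
    have hw : wt ((w0 : ℤ) - 6, (w1 : ℤ) - 6, (w2 : ℤ) - 6) (a, b, c) =
        ((w0 * a + w1 * b + w2 * c : ℕ) : ℤ) - 6 * (a + b + c) := by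
      simp only [wt]; push_cast; ring
    cases hb : Nat.ble (w0 * a + w1 * b + w2 * c + 301) (t + 6 * (a + b + c)) with
    | true =>
      rw [hb, cond_true] at h
      have hb := Nat.le_of_ble_eq_true hb
      obtain ⟨l', r', h1, h2, h3, h4, h5⟩ := ih _ _ _ (by
        refine (List.Perm.nodup_iff ?_).1 hn
        simp only [List.cons_append]
        exact List.perm_middle) h
      refine ⟨l', r', h1, h2, ?_, ?_, h5⟩
      · intro x; rw [h3]; simp only [List.mem_cons]; tauto
      · intro x hx
        rcases h4 x hx with h | h
        · rcases List.mem_cons.1 h with rfl | h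
          · right; rw [hw]; omega
          · exact Or.inl h
        · exact Or.inr h
    | false =>
      rw [hb, cond_false] at h
      have hb : ¬ _ := fun h' => absurd (Nat.ble_eq_true_of_le h') (by rw [hb]; simp)
      obtain ⟨l', r', h1, h2, h3, h4, h5⟩ := ih _ _ _ (by
        refine (List.Perm.nodup_iff ?_).1 hn
        rw [List.append_assoc, List.append_assoc]
        refine List.Perm.append_left l ?_
        rw [List.cons_append]
        exact List.perm_middle) h
      refine ⟨l', r', h1, h2, ?_, h4, ?_⟩
      · intro x; rw [h3]; simp only [List.mem_cons]; tauto
      · intro x hx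
        rcases h5 x hx with h | h
        · rcases List.mem_cons.1 h with rfl | h
          · right; rw [hw]; omega
          · exact Or.inl h
        · exact Or.inr h

theorem cutL_spec {c : ℕ} {D : List E} {k : List E → List E → Bool} (hn : D.Nodup) (h : cutL c D k = true) :
    ∃ (w : ℤ × ℤ × ℤ) (t : ℤ) (l r : List E), w ≠ 0 ∧ k l r = true ∧ l.Nodup ∧ r.Nodup ∧
      D.toFinset = l.toFinset ∪ r.toFinset ∧ D.length = l.length + r.length ∧ (∀ a ∈ l.toFinset, wt w a < t) ∧
      (∀ a ∈ r.toFinset, t ≤ wt w a) := by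
  rw [cutL] at h
  cases hb : Nat.beq (c / 1000) 1098 with
  | true => simp [hb] at h
  | false =>
    rw [hb, cond_false, force_eq, force_eq, force_eq, force_eq] at h
    obtain ⟨l, r, h1, h2, h3, h4, h5⟩ := part_spec _ _ _ _ D [] [] k (by simpa using hn) h
    have e : D.toFinset = l.toFinset ∪ r.toFinset := by
      ext a
      have := h3 a
      simp only [List.not_mem_nil, false_or] at this
      simp only [List.mem_toFinset, Finset.mem_union, this]
    obtain ⟨hl, hr, hd⟩ := List.nodup_append'.1 h2
    refine ⟨(((c / 169000 : ℕ) : ℤ) - 6, ((c / 13000 % 13 : ℕ) : ℤ) - 6, ((c / 1000 % 13 : ℕ) : ℤ) - 6),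
      ((c % 1000 : ℕ) : ℤ) - 300, l, r, ?_, h1, hl, hr, e, ?_, fun a ha => ?_, fun a ha => ?_⟩
    · have hb := Nat.ne_of_beq_eq_false hb
      intro h0
      simp only [Prod.mk_eq_zero] at h0
      omega
    · rw [← List.toFinset_card_of_nodup hn, e, ← List.toFinset_append, List.toFinset_card_of_nodup h2, List.length_append]
    · simpa using h4 a (List.mem_toFinset.1 ha)
    · simpa using h5 a (List.mem_toFinset.1 ha)

/-- Check a pure tree. -/
noncomputable def chk (m u : ℕ) : Tr → List E → Bool
  | .l, D => force D.length fun n => Nat.beq (n % u) 0 && fullL D (List.replicate (n / u) m)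
  | .n c x y, D => cutL c D fun l r => chk m u x l && chk m u y r

theorem chk_spec {m u : ℕ} (hm : m ≤ 4) (t : Tr) : ∀ {D : List E}, D.Nodup → chk m u t D = true →
    ∃ k, D.length = u * k ∧ Good D.toFinset (Multiset.replicate k m) := by
  induction t with
  | l =>
    intro D hn h
    rw [chk, force_eq, Bool.and_eq_true] at h
    have h0 := Nat.eq_of_beq_eq_true h.1
    refine ⟨D.length / u, (Nat.mul_div_cancel' (Nat.dvd_of_mod_eq_zero h0)).symm, ?_⟩
    have := fullL_good hn (fun i hi => by rw [List.eq_of_mem_replicate hi]; exact hm) h.2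
    rwa [Multiset.coe_replicate] at this
  | n c x y ihx ihy =>
    intro D hn h
    rw [chk] at h
    obtain ⟨w, t, l, r, hw, hk, hl, hr, he, hlen, h1, h2⟩ := cutL_spec hn h
    rw [Bool.and_eq_true] at hk
    obtain ⟨k1, e1, g1⟩ := ihx hl hk.1
    obtain ⟨k2, e2, g2⟩ := ihy hr hk.2
    refine ⟨k2 + k1, by rw [hlen, e1, e2]; ring, ?_⟩
    rw [he, Finset.union_comm, Multiset.replicate_add]
    exact g2.cut w hw t h2 h1 g1

/-- Check a bulk tree. -/
noncomputable def chkP : PTr → List E → Bool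
  | .p t4 t3 t2, D => force D.length fun n =>
      Nat.beq (n % 20) 0 && Nat.ble n 320 && chk 4 20 t4 D && chk 3 10 t3 D && chk 2 4 t2 D
  | .q c x y, D => cutL c D fun l r => chkP x l && chkP y r

theorem chkP_spec (t : PTr) : ∀ {D : List E}, D.Nodup → chkP t D = true → HB D.toFinset 0 := by
  induction t with
  | p t4 t3 t2 =>
    intro D hn h
    simp only [chkP, force_eq, Bool.and_eq_true] at h
    obtain ⟨⟨⟨⟨h0, hle⟩, h4⟩, h3⟩, h2⟩ := h
    have h0 := Nat.eq_of_beq_eq_true h0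
    have hle := Nat.le_of_ble_eq_true hle
    obtain ⟨k4, e4, g4⟩ := chk_spec (by norm_num) t4 hn h4
    obtain ⟨k3, e3, g3⟩ := chk_spec (by norm_num) t3 hn h3
    obtain ⟨k2, e2, g2⟩ := chk_spec (by norm_num) t2 hn h2
    refine HB.of_pure (k := k4) (by omega) ?_ (by rw [List.toFinset_card_of_nodup hn, e4])
    intro π hπ
    simp only [Pure, Set.mem_insert_iff, Set.mem_singleton_iff] at hπ
    obtain rfl : k3 = 2 * k4 := by omega
    obtain rfl : k2 = 5 * k4 := by omega
    rcases hπ with rfl | rfl | rfl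
    · simpa [Ms] using g4
    · simpa [Ms] using g3
    · simpa [Ms] using g2
  | q c x y ihx ihy =>
    intro D hn h
    rw [chkP] at h
    obtain ⟨w, t, l, r, hw, hk, hl, hr, he, hlen, h1, h2⟩ := cutL_spec hn h
    rw [Bool.and_eq_true] at hk
    rw [he]
    exact HB.cut hw (Or.inr ⟨h2, h1⟩) (ihx hl hk.1) (ihy hr hk.2)

/-- Bounded universal quantification. -/
def allLt : ℕ → (ℕ → Bool) → Bool
  | 0, _ => true
  | n + 1, p => p n && allLt n p

theorem allLt_spec {n : ℕ} {p : ℕ → Bool} (h : allLt n p = true) : ∀ i < n, p i = true := by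
  induction n with
  | zero => simp
  | succ n ih =>
    rw [allLt, Bool.and_eq_true] at h
    intro i hi
    rcases Nat.lt_succ_iff_lt_or_eq.1 hi with h' | rfl
    · exact ih h.2 i h'
    · exact h.1

/-- Check the minimal final profiles with given numbers of quadruple and triple points. -/
noncomputable def chkXY (D : List E) (f x y : ℕ) : Bool :=
  bif Nat.ble f (20 * x + 10 * y) then fullL D (MsL x y 0 0)
  else force (f - (20 * x + 10 * y)) fun r =>
    fullL D (MsL x y ((r + 3) / 4) 0) && (Nat.beq (r % 4) 0 || fullL D (MsL x y (r / 4) (r % 4)))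

/-- Check all final profiles. -/
noncomputable def leafF (D : List E) : Bool :=
  force D.length fun f => Nat.ble 10 f &&
    allLt ((f + 19) / 20 + 1) fun x => allLt ((f - 20 * x + 9) / 10 + 1) fun y => chkXY D f x y

theorem Ms_le {x y z s x' y' z' s' : ℕ} (h1 : x ≤ x') (h2 : y ≤ y') (h3 : z ≤ z') (h4 : s ≤ s') :
    Ms (x, y, z, s) ≤ Ms (x', y', z', s') := by
  have : (x', y', z', s') = (x, y, z, s) + (x' - x, y' - y, z' - z, s' - s) := by
    simp only [Prod.mk_add_mk]
    refine Prod.ext ?_ (Prod.ext ?_ (Prod.ext ?_ ?_)) <;> simp only <;> omega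
  rw [this, Ms_add]
  exact Multiset.le_add_right _ _

theorem leafF_spec {D : List E} (hn : D.Nodup) (h : leafF D = true) : HF D.toFinset 0 := by
  simp only [leafF, force_eq, Bool.and_eq_true] at h
  obtain ⟨h10, h⟩ := h
  have h10 := Nat.le_of_ble_eq_true h10
  refine ⟨[], D.length, by simp, h10, by rw [List.toFinset_card_of_nodup hn]; simp, ?_⟩
  rw [Mix_zero]
  have e : Pures [] + ({0} : Set Pr) + FinF D.length = FinF D.length := by simp [Pures]
  rw [e]
  rintro ⟨x, y, z, s⟩ hπ
  simp only [FinF, Set.mem_ofPred_eq] at hπ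
  set f := D.length with hf
  have key := allLt_spec (allLt_spec h (min x ((f + 19) / 20)) (by omega))
    (min y ((f - 20 * min x ((f + 19) / 20) + 9) / 10)) (by omega)
  set x' := min x ((f + 19) / 20) with hx'
  set y' := min y ((f - 20 * x' + 9) / 10) with hy'
  rw [chkXY, force_eq] at key
  cases hb : Nat.ble f (20 * x' + 10 * y') with
  | true =>
    rw [hb, cond_true] at key
    have g := fullL_good hn (MsL_le _ _ _ _) key
    rw [MsL_coe] at g
    exact g.mono (Ms_le (by omega) (by omega) (by omega) (by omega))
  | false =>
    have hlt : ¬ f ≤ 20 * x' + 10 * y' := fun h' => absurd (Nat.ble_eq_true_of_le h') (by rw [hb]; simp)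
    rw [hb, cond_false, Bool.and_eq_true, Bool.or_eq_true] at key
    have hx : x' = x := by omega
    have hy : y' = y := by omega
    rw [hx, hy] at key hlt
    obtain ⟨k1, k2⟩ := key
    by_cases hs : s = 0
    · have g := fullL_good hn (MsL_le _ _ _ _) k1
      rw [MsL_coe] at g
      exact g.mono (Ms_le le_rfl le_rfl (by omega) (by omega))
    · rcases k2 with k2 | k2
      · have := Nat.eq_of_beq_eq_true k2
        omega
      · have g := fullL_good hn (MsL_le _ _ _ _) k2
        rw [MsL_coe] at g
        exact g.mono (Ms_le le_rfl le_rfl (by omega) (by omega))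

/-- Check a tip certificate. -/
noncomputable def chkT : List (ℕ × PTr) → List E → Bool
  | [], D => leafF D
  | (c, t) :: s, D => cutL c D fun l r => chkP t l && chkT s r

theorem chkT_spec (s : List (ℕ × PTr)) : ∀ {D : List E}, D.Nodup → chkT s D = true → HF D.toFinset 0 := by
  induction s with
  | nil => intro D hn h; exact leafF_spec hn h
  | cons q s ih =>
    intro D hn h
    obtain ⟨c, t⟩ := q
    rw [chkT] at h
    obtain ⟨w, t, l, r, hw, hk, hl, hr, he, hlen, h1, h2⟩ := cutL_spec hn h
    rw [Bool.and_eq_true] at hk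
    rw [he]
    exact HF.cut hw (Or.inr ⟨h2, h1⟩) (chkP_spec _ hl hk.1) (ih hr hk.2)

/-- Check all mixed profiles on a region of 80 elements. -/
noncomputable def leafM (D : List E) : Bool :=
  allLt 5 fun a => allLt (5 - a) fun b => fullL D (MsL a (2 * b) (5 * (4 - a - b)) 0)

theorem leafM_spec {D : List E} (hn : D.Nodup) (h : leafM D = true) : Has D.toFinset (Mix 4) := by
  rintro _ ⟨a, b, c, h', rfl⟩
  have := fullL_good hn (MsL_le _ _ _ _) (allLt_spec (allLt_spec h a (by omega)) b (by omega))
  rw [MsL_coe] at this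
  obtain rfl : c = 4 - a - b := by omega
  exact this

/-- Check the mixing box. -/
noncomputable def chkM (c : ℕ) (D : List E) : Bool :=
  cutL c D fun l r => leafM l && leafM r

theorem chkM_spec {c : ℕ} {D : List E} (hn : D.Nodup) (h : chkM c D = true) : Has D.toFinset (Mix 8) := by
  rw [chkM] at h
  obtain ⟨w, t, l, r, hw, hk, hl, hr, he, hlen, h1, h2⟩ := cutL_spec hn h
  rw [Bool.and_eq_true] at hk
  rw [he]
  exact ((Has.cut' hw (Or.inr ⟨h2, h1⟩) (leafM_spec hl hk.1) (leafM_spec hr hk.2)).1).mono (Mix_add 4 4)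

/-- Enumeration of a region in the cube of side 20. -/
noncomputable def en3 (p : ℕ → ℕ → ℕ → Bool) (a b c : ℕ) : List E → (List E → Bool) → Bool :=
  Nat.rec (motive := fun _ => List E → (List E → Bool) → Bool) (fun acc k => k acc)
    (fun c ih acc k => Bool.rec (motive := fun _ => Bool) (ih acc k) (ih ((a, b, c) :: acc) k) (p a b c)) c

theorem en3_succ (p : ℕ → ℕ → ℕ → Bool) (a b c : ℕ) (acc : List E) (k : List E → Bool) : en3 p a b (c + 1) acc k =
    bif p a b c then en3 p a b c ((a, b, c) :: acc) k else en3 p a b c acc k := by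
  have h : en3 p a b (c + 1) acc k =
    Bool.rec (motive := fun _ => Bool) (en3 p a b c acc k) (en3 p a b c ((a, b, c) :: acc) k) (p a b c) := rfl
  rw [h]
  cases p a b c <;> rfl

/-- Enumeration of a region in the cube of side 20. -/
noncomputable def en2 (p : ℕ → ℕ → ℕ → Bool) (a : ℕ) : ℕ → List E → (List E → Bool) → Bool
  | 0, acc, k => k acc
  | b + 1, acc, k => en3 p a b 20 acc fun s => en2 p a b s k

/-- Enumeration of a region in the cube of side 20. -/
noncomputable def en1 (p : ℕ → ℕ → ℕ → Bool) : ℕ → List E → (List E → Bool) → Bool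
  | 0, acc, k => k acc
  | a + 1, acc, k => en2 p a 20 acc fun s => en1 p a s k

theorem en3_spec (p : ℕ → ℕ → ℕ → Bool) (a b : ℕ) (c : ℕ) : ∀ (acc : List E) (k : List E → Bool),
    en3 p a b c acc k = true → acc.Nodup → (∀ i < c, (a, b, i) ∉ acc) → ∃ s, k s = true ∧ s.Nodup ∧
      ∀ x, x ∈ s ↔ x ∈ acc ∨ (x.1 = a ∧ x.2.1 = b ∧ x.2.2 < c ∧ p x.1 x.2.1 x.2.2 = true) := by
  induction c with
  | zero => intro acc k h hn _; exact ⟨acc, h, hn, by simp⟩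
  | succ c ih =>
    intro acc k h hn hi
    rw [en3_succ] at h
    cases hp : p a b c with
    | true =>
      rw [hp, cond_true] at h
      obtain ⟨s, h1, h2, h3⟩ := ih _ _ h (List.nodup_cons.2 ⟨hi c (by omega), hn⟩) (by
        intro i hic hmem
        rcases List.mem_cons.1 hmem with h | h
        · simp only [Prod.mk.injEq, true_and] at h; omega
        · exact hi i (by omega) h)
      refine ⟨s, h1, h2, fun ⟨x, y, z⟩ => ?_⟩
      rw [h3, List.mem_cons]
      simp only [Prod.mk.injEq]
      constructor
      · rintro ((⟨rfl, rfl, rfl⟩ | h) | ⟨rfl, rfl, h, h'⟩)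
        · exact Or.inr ⟨rfl, rfl, by omega, hp⟩
        · exact Or.inl h
        · exact Or.inr ⟨rfl, rfl, by omega, h'⟩
      · rintro (h | ⟨rfl, rfl, h, h'⟩)
        · exact Or.inl (Or.inr h)
        · rcases Nat.lt_succ_iff_lt_or_eq.1 h with h | rfl
          · exact Or.inr ⟨rfl, rfl, h, h'⟩
          · exact Or.inl (Or.inl ⟨rfl, rfl, rfl⟩)
    | false =>
      rw [hp, cond_false] at h
      obtain ⟨s, h1, h2, h3⟩ := ih _ _ h hn fun i hic => hi i (by omega)
      refine ⟨s, h1, h2, fun ⟨x, y, z⟩ => ?_⟩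
      rw [h3]
      constructor
      · rintro (h | ⟨h1, h2, h, h'⟩)
        · exact Or.inl h
        · exact Or.inr ⟨h1, h2, Nat.lt_succ_of_lt h, h'⟩
      · rintro (h | ⟨rfl, rfl, h, h'⟩)
        · exact Or.inl h
        · rcases Nat.lt_succ_iff_lt_or_eq.1 h with h | h
          · exact Or.inr ⟨rfl, rfl, h, h'⟩
          · simp only at h h'
            rw [h, hp] at h'
            exact absurd h' (by simp)

theorem en2_spec (p : ℕ → ℕ → ℕ → Bool) (a : ℕ) (b : ℕ) : ∀ (acc : List E) (k : List E → Bool),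
    en2 p a b acc k = true → acc.Nodup → (∀ i < b, ∀ j, (a, i, j) ∉ acc) → ∃ s, k s = true ∧ s.Nodup ∧
      ∀ x, x ∈ s ↔ x ∈ acc ∨ (x.1 = a ∧ x.2.1 < b ∧ x.2.2 < 20 ∧ p x.1 x.2.1 x.2.2 = true) := by
  induction b with
  | zero => intro acc k h hn _; exact ⟨acc, h, hn, by simp⟩
  | succ b ih =>
    intro acc k h hn hi
    rw [en2] at h
    obtain ⟨s, h1, h2, h3⟩ := en3_spec p a b 20 _ _ h hn fun i _ => hi b (by omega) i
    obtain ⟨s', h1', h2', h3'⟩ := ih _ _ h1 h2 (by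
      intro i hib j hmem
      rcases (h3 _).1 hmem with h | h
      · exact hi i (by omega) j h
      · simp only at h; omega)
    refine ⟨s', h1', h2', fun x => ?_⟩
    rw [h3', h3]
    constructor
    · rintro ((h | ⟨h1, h2, h⟩) | ⟨h1, h2, h⟩)
      · exact Or.inl h
      · exact Or.inr ⟨h1, by omega, h⟩
      · exact Or.inr ⟨h1, by omega, h⟩
    · rintro (h | ⟨h1, h2, h⟩)
      · exact Or.inl (Or.inl h)
      · rcases Nat.lt_succ_iff_lt_or_eq.1 h2 with h2 | h2
        · exact Or.inr ⟨h1, h2, h⟩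
        · exact Or.inl (Or.inr ⟨h1, h2, h⟩)

theorem en1_spec (p : ℕ → ℕ → ℕ → Bool) (a : ℕ) : ∀ (acc : List E) (k : List E → Bool),
    en1 p a acc k = true → acc.Nodup → (∀ i < a, ∀ j, (i, j) ∉ acc) → ∃ s, k s = true ∧ s.Nodup ∧
      ∀ x, x ∈ s ↔ x ∈ acc ∨ (x.1 < a ∧ x.2.1 < 20 ∧ x.2.2 < 20 ∧ p x.1 x.2.1 x.2.2 = true) := by
  induction a with
  | zero => intro acc k h hn _; exact ⟨acc, h, hn, by simp⟩
  | succ a ih =>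
    intro acc k h hn hi
    rw [en1] at h
    obtain ⟨s, h1, h2, h3⟩ := en2_spec p a 20 _ _ h hn fun i _ j => hi a (by omega) (i, j)
    obtain ⟨s', h1', h2', h3'⟩ := ih _ _ h1 h2 (by
      intro i hib j hmem
      rcases (h3 _).1 hmem with h | h
      · exact hi i (by omega) j h
      · simp only at h; omega)
    refine ⟨s', h1', h2', fun x => ?_⟩
    rw [h3', h3]
    constructor
    · rintro ((h | ⟨h1, h⟩) | ⟨h1, h⟩)
      · exact Or.inl h
      · exact Or.inr ⟨by omega, h⟩
      · exact Or.inr ⟨by omega, h⟩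
    · rintro (h | ⟨h1, h⟩)
      · exact Or.inl (Or.inl h)
      · rcases Nat.lt_succ_iff_lt_or_eq.1 h1 with h1 | h1
        · exact Or.inr ⟨h1, h⟩
        · exact Or.inl (Or.inr ⟨h1, h⟩)

theorem en_spec {p : ℕ → ℕ → ℕ → Bool} {k : List E → Bool} (h : en1 p 20 [] k = true) {S : Set E}
    (hS : ∀ a b c, (a, b, c) ∈ S ↔ a < 20 ∧ b < 20 ∧ c < 20 ∧ p a b c = true) :
    ∃ s, k s = true ∧ s.Nodup ∧ (s.toFinset : Set E) = S := by
  obtain ⟨s, h1, h2, h3⟩ := en1_spec p 20 [] k h List.nodup_nil (by simp)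
  refine ⟨s, h1, h2, ?_⟩
  ext ⟨a, b, c⟩
  rw [hS, List.coe_toFinset, Set.mem_ofPred_eq, h3]
  simp

theorem HBS.ofP {p : ℕ → ℕ → ℕ → Bool} {S : Set E} (t : PTr)
    (hS : ∀ a b c, (a, b, c) ∈ S ↔ a < 20 ∧ b < 20 ∧ c < 20 ∧ p a b c = true)
    (h : en1 p 20 [] (chkP t) = true) : HBS S 0 := by
  obtain ⟨s, h1, h2, h3⟩ := en_spec h hS
  exact ⟨_, h3, chkP_spec t h2 h1⟩

theorem HFS.ofT {p : ℕ → ℕ → ℕ → Bool} {S : Set E} (t : List (ℕ × PTr))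
    (hS : ∀ a b c, (a, b, c) ∈ S ↔ a < 20 ∧ b < 20 ∧ c < 20 ∧ p a b c = true)
    (h : en1 p 20 [] (chkT t) = true) : HFS S 0 := by
  obtain ⟨s, h1, h2, h3⟩ := en_spec h hS
  exact ⟨_, h3, chkT_spec t h2 h1⟩

end TD
end

section
namespace TD
open Tr PTr
set_option linter.unusedSimpArgs false
set_option maxRecDepth 100000

/-- A corner of a triangle. -/
def cor (r l c : ℕ) : Prop := c ≤ l ∧ (r = 5 ∧ 2 * l + c < 6 ∨ r = 10 ∧ l < 4 ∨ r = 15 ∧ l < 5)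
/-- A box. -/
def box4 : Set E := {p | p.1 < 10 ∧ p.2.1 < 4 ∧ p.2.2 < 4}
/-- A box. -/
def box5 : Set E := {p | p.1 < 8 ∧ p.2.1 < 5 ∧ p.2.2 < 4}
/-- A column. -/
def col (n : ℕ) : Set E := {p | p.1 < 10 ∧ p.2.1 < 4 ∧ p.1 + p.2.1 + p.2.2 < n}
/-- A column. -/
def col5 (n : ℕ) : Set E := {p | p.1 < 8 ∧ p.2.1 < 5 ∧ p.1 + p.2.1 + p.2.2 < n}
/-- A slab. -/
def strip (n : ℕ) : Set E := {p | p.1 < 10 ∧ p.1 + p.2.1 + p.2.2 < n}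
/-- A thin slab. -/
def slab (n : ℕ) : Set E := {p | p.1 < 4 ∧ p.1 + p.2.1 + p.2.2 < n}
/-- A wedge. -/
def wedge (n r : ℕ) : Set E :=
  {p | p.2.1 < 5 ∧ p.1 + p.2.1 + p.2.2 < n ∧ ¬ (p.2.1 = 4 ∧ p.1 + 5 ≤ n ∧ cor r (n - 5 - p.1) p.2.2)}
/-- A simplex with a corner added. -/
def tip (n r : ℕ) : Set E :=
  {p | (1 ≤ p.2.1 ∧ p.1 + p.2.1 + p.2.2 < n + 1) ∨ (p.2.1 = 0 ∧ p.1 ≤ n ∧ cor r (n - p.1) p.2.2)}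
/-- The full simplex. -/
def simp3 (n : ℕ) : Set E := {p | p.1 + p.2.1 + p.2.2 < n}


theorem blt_iff (a b : ℕ) : Nat.blt a b = true ↔ a < b := by rw [Nat.blt_eq]
theorem ble_iff (a b : ℕ) : Nat.ble a b = true ↔ a ≤ b := by rw [Nat.ble_eq]
theorem beq_iff (a b : ℕ) : Nat.beq a b = true ↔ a = b := by rw [Nat.beq_eq]
theorem nandL_iff (x y : Bool) : (!(x && y)) = true ↔ ¬ (x = true ∧ y = true) := by cases x <;> cases y <;> decide

theorem cor0 (l c : ℕ) : cor 0 l c ↔ False := by simp [cor]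
theorem cor5 (l c : ℕ) : cor 5 l c ↔ c ≤ l ∧ 2 * l + c < 6 := by simp [cor]
theorem cor10 (l c : ℕ) : cor 10 l c ↔ c ≤ l ∧ l < 4 := by simp [cor]
theorem cor15 (l c : ℕ) : cor 15 l c ↔ c ≤ l ∧ l < 5 := by simp [cor]

theorem cert_mix : Has ((Finset.range 10) ×ˢ (Finset.range 4) ×ˢ (Finset.range 4)) (Mix 8) := by
  have h : en1 (fun a b c => Nat.blt a 10 && Nat.blt b 4 && Nat.blt c 4) 20 [] (chkM 2153335) = true := by
    decide +kernel
  obtain ⟨s, h1, h2, h3⟩ := en_spec (S := box4) h (by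
    intro a b c
    simp only [box4, Set.mem_ofPred_eq, Bool.and_eq_true, blt_iff]
    omega)
  have e : (Finset.range 10) ×ˢ (Finset.range 4) ×ˢ (Finset.range 4) = s.toFinset := by
    apply Finset.coe_injective
    rw [h3]
    ext ⟨a, b, c⟩
    simp [box4, and_assoc]
  rw [e]
  exact chkM_spec h2 h1

theorem cert_box854 : HBS box5 0 := by
  refine HBS.ofP (p := fun a b c => Nat.blt a 8 && Nat.blt b 5 && Nat.blt c 4)
    ((p (n 615291 (n 366260 l (n 788294 l (n 1805331 l l))) (n 2000316 l (n 1253297 l (n 703280 l l)))) (n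
      1279300 l (n 772293 (n 954296 (n 941293 l (n 1446307 l l)) (n 965296 l (n 1433307 l (n 954299 l l)))) (n
      190274 (n 1798320 l l) (n 1119298 (n 384288 l (n 632305 l l)) (n 2016315 l (n 313305 l l)))))) (n 653305 (n
      1425317 (n 1087302 (n 1698306 (n 915293 (n 894287 l (n 1797322 l l)) (n 554287 l (n 1645307 l (n 8282 l
      l)))) (n 2168344 (n 1920318 l (n 171265 l (n 1462312 l l))) (n 901285 l (n 1294311 l (n 1402310 l l))))) (n
      147282 (n 542287 (n 476288 l (n 881295 l l)) (n 1628305 l (n 796286 l (n 1423308 l l)))) (n 1917306 (n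
      916298 l (n 1279299 l (n 996309 l l))) (n 1127309 l (n 929297 l (n 942300 l l)))))) (n 785286 l l)) (n
      1399292 l (n 1882295 (n 374288 l (n 954305 l l)) (n 1983319 l (n 464300 l (n 785302 l l)))))))) ?_ ?_
  · intro a b c
    simp only [box5, Set.mem_ofPred_eq, Bool.and_eq_true, Bool.or_eq_true, blt_iff, ble_iff, beq_iff, nandL_iff, cor0,
      cor5, cor10, cor15, and_false, or_false, not_false_eq_true, and_true]
    omega
  · decide +kernel

theorem cert_top14 : HBS (col 14) 0 := by
  refine HBS.ofP (p := fun a b c => Nat.blt a 10 && Nat.blt b 4 && Nat.blt (a + b + c) 14)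
    ((p (n 1253297 (n 916297 l (n 1080252 l (n 930305 l l))) (n 289272 (n 943295 l (n 603277 l (n 1236280 l l)))
      (n 1281304 l (n 820286 l (n 748291 l l))))) (n 1297322 (n 1790322 (n 463302 (n 1903305 l l) (n 558300 l l))
      (n 1037298 l (n 594282 l (n 1801322 l l)))) (n 1421298 (n 1736306 l (n 451320 (n 320305 l l) l)) (n 1252295
      l l))) (n 1973339 (n 412299 (n 1604308 (n 1397299 (n 1449305 l (n 1257302 l (n 1457300 l l))) (n 1255302 l
      (n 966295 l (n 1328301 l l)))) (n 457282 (n 308283 (n 703281 l (n 770288 l l)) (n 693281 l (n 770285 l l)))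
      (n 1551304 (n 2066316 l (n 1113305 l l)) (n 1620313 l (n 691282 l l))))) (n 785297 (n 77312 (n 942299 l l)
      (n 609328 (n 385300 l (n 965284 l (n 1731285 l l))) (n 1322323 l (n 1135286 l (n 1253293 l l))))) (n 1771293
      (n 1230301 l (n 943306 l (n 800312 l (n 928294 l l)))) (n 380281 l (n 191293 l (n 944303 l (n 505317 l
      l))))))) (n 1628303 (n 1129352 (n 204302 (n 1209262 (n 459274 l (n 568303 l (n 816332 l l))) (n 904299 l (n
      1590301 l (n 580297 l l)))) (n 1452334 (n 1721285 l (n 1266296 (n 2090338 l (n 1751329 l (n 467343 l (n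
      899261 l l)))) l)) l)) (n 73315 l (n 1096278 l (n 1674350 l l)))) (n 1125306 (n 1086302 (n 917291 l (n
      1388314 l (n 930293 l (n 290263 l l)))) (n 2096326 l (n 749289 l (n 1630318 l (n 1464324 l l))))) (n 562270
      (n 746281 (n 1254306 l (n 773286 l l)) (n 569290 l (n 954294 l (n 1282317 l l)))) (n 1082289 l (n 813301 l
      l)))))))) ?_ ?_
  · intro a b c
    simp only [col, Set.mem_ofPred_eq, Bool.and_eq_true, Bool.or_eq_true, blt_iff, ble_iff, beq_iff, nandL_iff, cor0,
      cor5, cor10, cor15, and_false, or_false, not_false_eq_true, and_true]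
    omega
  · decide +kernel

theorem cert_top16 : HBS (col 16) 0 := by
  refine HBS.ofP (p := fun a b c => Nat.blt a 10 && Nat.blt b 4 && Nat.blt (a + b + c) 16)
    ((q 1545329 (p (n 497295 (n 2088326 (n 1253296 l (n 750303 l l)) (n 917292 l (n 939288 l (n 1583321 l l))))
      (n 1255301 l (n 472298 l l))) (n 288278 (n 965292 (n 928291 l (n 620296 l (n 783283 l l))) (n 589274 l (n
      315272 l (n 749288 l l)))) (n 1823307 (n 1283307 l (n 1829316 l (n 710298 l l))) (n 1457300 l (n 213274 l (n
      2121310 l l))))) (n 1461308 (n 1010321 (n 1974320 (n 660306 (n 2012309 l (n 943300 l l)) (n 807294 l (n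
      914295 l (n 941301 l l)))) (n 1484294 (n 931307 l (n 398306 l l)) (n 1194306 l (n 1562293 l (n 1423306 l (n
      1205310 l l)))))) (n 1245318 (n 1114312 l (n 1425307 l (n 581304 l (n 1254299 l l)))) (n 721288 l (n 917303
      l (n 1295317 l (n 1266294 l l)))))) (n 1484304 (n 1946335 l l) (n 758286 (n 938287 (n 1436312 l (n 1562297 l
      (n 734280 l (n 722285 l l)))) (n 581277 (n 1577321 l (n 786286 l l)) (n 1161306 l (n 904290 l l)))) (n
      1654318 (n 1269307 (n 1426305 l (n 1813319 l l)) (n 1592310 l (n 1636326 l l))) (n 1281309 (n 772289 l (n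
      57266 l (n 576286 l l))) (n 736286 l l))))))) (p (n 593305 (n 1617308 l (n 1290290 l l)) (n 1097289 l (n
      1279293 l l))) (n 410293 (n 626264 (n 1594329 l (n 467300 l (n 606293 l (n 776312 l l)))) (n 1397304 l (n
      602272 l (n 1639294 l (n 1257317 l l))))) (n 388338 (n 471268 l (n 775311 l (n 1463313 l (n 1482262 l l))))
      (n 596346 l (n 1097288 l (n 1279291 l (n 1011352 l l)))))) (n 577281 (n 595305 (n 412278 (n 1779346 l (n
      1227302 l (n 1493335 l l))) (n 1828334 l (n 760286 (n 917296 l (n 899270 l l)) (n 976271 l (n 1464324 l (n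
      1166325 l l)))))) (n 592293 (n 1125310 (n 958314 l (n 905306 l (n 1421297 l l))) (n 970315 l l)) (n 1461304
      (n 2144378 l (n 1796274 l (n 1751341 l (n 1461301 l l)))) (n 1225275 l l)))) (n 709302 (n 1648342 (n 2042288
      (n 1445277 l (n 1112308 l l)) (n 1096290 l (n 1437313 l l))) (n 917304 l (n 1450314 l (n 601267 l (n 245334
      l (n 376348 l l)))))) (n 1279289 (n 1274222 l l) (n 745275 (n 453354 l (n 629288 l l)) (n 913272 (n 944319 l
      (n 1655282 l (n 1655286 l l))) (n 1666271 l (n 1816325 l (n 564288 l l))))))))))) ?_ ?_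
  · intro a b c
    simp only [col, Set.mem_ofPred_eq, Bool.and_eq_true, Bool.or_eq_true, blt_iff, ble_iff, beq_iff, nandL_iff, cor0,
      cor5, cor10, cor15, and_false, or_false, not_false_eq_true, and_true]
    omega
  · decide +kernel

theorem cert_strip10 : HBS (strip 10) 0 := by
  refine HBS.ofP (p := fun a b c => Nat.blt a 10 && Nat.blt (a + b + c) 10)
    ((p (n 944303 (n 929295 l (n 943299 l (n 1280305 l l))) (n 1084295 (n 1282310 l (n 1097295 l (n 601290 l l)))
      (n 1434298 l (n 165309 l l)))) (n 724295 (n 1732316 (n 1931306 (n 942304 l (n 784308 l (n 1306321 l l))) (n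
      799297 l (n 1255300 l (n 1231297 l (n 1863301 l l))))) (n 929294 l l)) (n 1222264 (n 1099307 l l) (n 2039316
      (n 1451305 l (n 997316 l (n 337332 l l))) (n 559263 l (n 592292 l (n 594303 l (n 618301 l l))))))) (n
      2117341 (n 645309 (n 644287 l (n 1891309 (n 1426309 (n 1432302 (n 1203294 l (n 631301 l (n 1200294 l l))) (n
      526273 l (n 1707298 l (n 892293 l l)))) (n 386294 l (n 439308 l (n 1086304 l l)))) (n 383284 (n 1534294 l (n
      645292 l (n 1236296 l (n 522275 l l)))) (n 25283 l (n 945302 l (n 1432292 l (n 762300 l l))))))) (n 958315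
      (n 1215286 (n 800314 (n 1919299 l (n 1057284 l l)) (n 1163330 l (n 733285 l l))) (n 385293 (n 1755293 l (n
      644310 l l)) (n 218299 l (n 1228296 l l)))) (n 554298 (n 772301 (n 928296 l l) (n 879273 l (n 1243292 l (n
      1659328 l l)))) (n 1207321 (n 971320 l (n 349309 l l)) (n 985327 l (n 785295 l l)))))) (n 788296 (n 1075300
      l (n 188265 l (n 1087303 l l))) (n 1266295 l (n 1421295 l (n 1253300 l l))))))) ?_ ?_
  · intro a b c
    simp only [strip, Set.mem_ofPred_eq, Bool.and_eq_true, Bool.or_eq_true, blt_iff, ble_iff, beq_iff, nandL_iff, cor0,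
      cor5, cor10, cor15, and_false, or_false, not_false_eq_true, and_true]
    omega
  · decide +kernel

theorem cert_strip12 : HBS (strip 12) 0 := by
  refine HBS.ofP (p := fun a b c => Nat.blt a 10 && Nat.blt (a + b + c) 12)
    ((q 199270 (p (n 429272 (n 478284 l (n 723292 l l)) (n 980309 l (n 1059279 l (n 903286 l l)))) (n 1231301 (n
      904287 (n 1146324 l (n 758296 l (n 889274 l l))) (n 34260 l (n 421286 l (n 725287 l (n 1138321 l l))))) (n
      1211286 (n 1424307 l (n 1800318 l (n 429262 l l))) (n 1627309 l (n 943294 l (n 1363309 l (n 632286 l l))))))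
      (n 797320 (n 1255304 (n 1069278 (n 567294 l (n 1291301 l l)) (n 1424303 (n 551275 (n 1811325 l (n 1634324 l
      (n 1109306 l l))) (n 1617307 l (n 243287 l (n 1310325 l l)))) (n 957305 (n 1592312 l (n 915291 l l)) (n
      660318 (n 917292 l (n 1385295 l l)) (n 927291 l (n 733283 l l)))))) (n 1787316 (n 1258321 l (n 1110296 l l))
      (n 1846310 (n 875281 l (n 1265295 l (n 2015302 l (n 1603310 l l)))) (n 1086302 (n 1918330 (n 711283 l (n
      2012339 l (n 1063302 l (n 1461312 l l)))) (n 170250 (n 891287 l (n 115264 l l)) (n 606278 l (n 734286 l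
      l)))) (n 1813331 l l))))) (n 942308 l (n 941308 l (n 1217264 l l))))) (p (n 1463308 l (n 1437307 (n 1123304
      l l) (n 926277 l (n 901286 l l)))) (n 1574290 (n 584311 l (n 917303 (n 978291 l (n 1659320 l l)) (n 1102324
      l (n 686318 l (n 912265 l l))))) (n 248280 l (n 1281303 l (n 984305 l (n 1421298 l l))))) (n 2165320 (n
      1447296 (n 1421287 (n 1067251 l (n 958324 l (n 1292294 l (n 50334 l l)))) (n 1238284 (n 209264 l (n 751319 l
      l)) (n 914290 l (n 1627288 l l)))) (n 927295 (n 928296 l (n 179298 l l)) (n 1139306 (n 1281302 l (n 1893306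
      l (n 1265301 l l))) (n 1061292 l (n 1610308 l (n 706288 l l)))))) (n 1594308 (n 2025337 (n 1374282 l (n
      781297 l (n 1582302 l l))) (n 807299 l (n 1268302 l (n 1447301 l (n 1671329 l l))))) (n 1097297 (n 1634326
      (n 942299 l (n 1727324 l l)) (n 695286 l (n 575271 l (n 1555315 l l)))) (n 941296 (n 892298 l (n 362298 l
      l)) (n 1253299 l (n 1425307 l (n 59276 l l)))))))))) ?_ ?_
  · intro a b c
    simp only [strip, Set.mem_ofPred_eq, Bool.and_eq_true, Bool.or_eq_true, blt_iff, ble_iff, beq_iff, nandL_iff, cor0,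
      cor5, cor10, cor15, and_false, or_false, not_false_eq_true, and_true]
    omega
  · decide +kernel

theorem cert_w14 : HBS (slab 14) 0 := by
  refine HBS.ofP (p := fun a b c => Nat.blt a 4 && Nat.blt (a + b + c) 14)
    ((q 1768284 (p (n 244317 (n 538270 l l) (n 985333 l l)) (n 581313 (n 787310 (n 1736303 l (n 1408290 l (n
      1087310 l l))) (n 175258 l (n 555297 l (n 1239282 l l)))) (n 901279 (n 710302 l (n 1242307 l (n 932331 l
      l))) (n 1126316 l (n 737317 l (n 1648339 l l))))) (n 776320 (n 830336 (n 1810294 (n 1421289 l (n 1269310 l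
      (n 373310 l (n 916299 l l)))) (n 1112306 l (n 2193333 l (n 917301 l (n 1461302 l l))))) (n 1091326 (n
      1318317 l (n 1658331 l (n 577286 l (n 564281 l l)))) (n 1381272 l (n 554295 l (n 595319 l (n 893312 l
      l)))))) (n 1119264 (n 917308 (n 1071286 l (n 1996318 l (n 1112310 l (n 930308 l l)))) (n 1635340 l (n
      1281312 l (n 1847249 l (n 772289 l l))))) (n 1255304 (n 882297 l (n 1112311 l (n 783290 l (n 555300 l l))))
      (n 125313 l (n 186264 l (n 375324 l (n 1110295 l l)))))))) (p (n 892286 (n 747288 l l) (n 720282 l (n 943301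
      l l))) (n 474312 (n 1395295 (n 1133296 l (n 1654312 l (n 1912297 l l))) (n 913291 l (n 788300 l (n 914296 l
      l)))) (n 1459314 (n 957311 l (n 681252 l (n 901282 l (n 712284 l l)))) (n 955313 l (n 1058268 l (n 1255293 l
      (n 282311 l l)))))) (n 580287 (n 861247 l (n 916289 l (n 1448313 l l))) (n 1679324 (n 1205298 (n 911288 (n
      1474310 l (n 734288 l (n 105281 l (n 1255300 l l)))) (n 775299 l (n 1241295 l (n 918298 l (n 831314 l l)))))
      (n 1266300 (n 1113305 l (n 1253297 l (n 1475305 l (n 1138307 l l)))) (n 1084297 l (n 633297 l (n 941297 l (n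
      1709304 l l)))))) (n 1285315 (n 1918302 (n 783311 (n 731283 l (n 537274 l (n 1596299 l l))) (n 643329 l (n
      1351355 l (n 224277 l l)))) (n 919295 l l)) (n 1399285 (n 621320 l (n 745285 l (n 1311336 l (n 1111311 l
      l)))) (n 1320330 (n 785304 l (n 615303 l l)) (n 1515347 l (n 49276 l l)))))))))) ?_ ?_
  · intro a b c
    simp only [slab, Set.mem_ofPred_eq, Bool.and_eq_true, Bool.or_eq_true, blt_iff, ble_iff, beq_iff, nandL_iff, cor0,
      cor5, cor10, cor15, and_false, or_false, not_false_eq_true, and_true]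
    omega
  · decide +kernel

theorem cert_w18 : HBS (slab 18) 0 := by
  refine HBS.ofP (p := fun a b c => Nat.blt a 4 && Nat.blt (a + b + c) 18)
    ((q 1870302 (p (n 916288 (n 1085287 l (n 758294 l l)) (n 917293 (n 1266300 l (n 1448312 l l)) (n 1268305 (n
      916293 l (n 732286 l (n 1059291 l l))) (n 1047271 l (n 938283 l (n 1075300 l l)))))) (n 1268304 (n 876265 (n
      915286 (n 1153357 l (n 1035232 l l)) (n 914286 l (n 745286 l (n 550267 l l)))) (n 943306 (n 1307309 l (n
      1070290 l (n 1736295 l l))) (n 1740287 l (n 1539270 l l)))) (n 942311 (n 1253291 (n 657343 (n 1057267 l (n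
      1110302 l l)) (n 573257 l (n 1661358 l (n 1290307 l (n 1086293 l l))))) (n 1303307 l (n 2047276 l (n 1255299
      l (n 1125315 l l))))) l)) (n 1067245 l (n 915293 (n 803331 (n 1262295 (n 1555287 (n 956314 l (n 1292313 l (n
      917293 l l))) (n 521249 l (n 294307 l (n 1529280 l (n 1581302 l l))))) (n 1228278 (n 1519355 l (n 480332 l
      (n 1511360 l (n 1730276 l l)))) (n 1737286 l (n 1423298 l (n 1244291 l (n 954308 l l)))))) (n 568287 (n
      1123323 (n 1993351 (n 215265 (n 1291316 l (n 1990339 l (n 876254 l l))) (n 733275 l (n 1315332 l (n 725275 l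
      l)))) (n 1070274 l l)) (n 1547244 (n 1677369 l (n 1083283 l (n 303353 l (n 1297333 l l)))) (n 745281 l (n
      2000356 l (n 1890253 l (n 1227264 l l)))))) (n 1318334 (n 694249 (n 808310 l l) (n 1974343 (n 1217281 (n
      917295 l (n 1139332 l l)) (n 668326 l (n 1725292 l l))) (n 2144356 (n 425311 l (n 1629306 l l)) (n 1460304 l
      (n 1603294 l (n 515258 l l)))))) (n 771298 l (n 1669346 l (n 542268 l (n 52250 l l))))))) (n 1149313 (n
      1569297 l (n 1094296 l (n 929299 l (n 380293 l l)))) (n 1241290 l (n 1464312 l (n 1828324 l (n 1409294 l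
      l)))))))) (p (n 2050315 (n 985338 l l) (n 1461295 l (n 377239 l l))) (n 1244319 (n 953296 (n 620316 (n
      940290 l l) (n 885241 l (n 915287 l l))) (n 1953302 l l)) (n 1588273 (n 460294 (n 117225 (n 759283 l l) (n
      1252277 l (n 1441349 l l))) (n 958334 l l)) l)) (n 1961350 (n 1385302 (n 1254298 (n 1350362 (n 1243304 l (n
      938279 l l)) (n 1084288 l (n 1241292 l l))) (n 1029270 (n 614287 (n 1520354 l (n 1477324 l (n 1139323 l (n
      1087311 l l)))) (n 1123304 l l)) (n 1603302 (n 904298 l (n 1789308 l (n 191297 l (n 576290 l l)))) (n 931300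
      l (n 1084296 l l))))) (n 1074316 (n 1413308 (n 644296 l l) (n 957312 (n 1395291 l (n 1097297 (n 953288 l (n
      915293 l (n 591297 l l))) (n 1389314 l (n 470284 l l)))) (n 531322 l (n 720289 l (n 1454336 l l))))) l)) (n
      1255310 (n 383281 (n 1812321 (n 1629299 (n 1494380 l (n 1266292 l l)) (n 1230300 l (n 563266 l (n 1279300 l
      l)))) (n 697277 l l)) (n 957327 (n 135287 l (n 1852316 l (n 956313 l (n 941293 l l)))) (n 1635350 l (n
      1107257 l (n 35309 l (n 1282327 l l)))))) (n 71291 (n 1142360 (n 1588265 l (n 1459277 l (n 1099309 l (n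
      1241301 l l)))) (n 1314237 l (n 1485270 l (n 1556334 l (n 1427353 l l))))) (n 1401349 (n 1101333 l (n
      1451325 l (n 891305 l (n 1253287 l l)))) (n 944327 l (n 1324375 l (n 1264255 l (n 812304 l l))))))))))) ?_ ?_
  · intro a b c
    simp only [slab, Set.mem_ofPred_eq, Bool.and_eq_true, Bool.or_eq_true, blt_iff, ble_iff, beq_iff, nandL_iff, cor0,
      cor5, cor10, cor15, and_false, or_false, not_false_eq_true, and_true]
    omega
  · decide +kernel

theorem cert_t13 : HBS (col5 13) 0 := by
  refine HBS.ofP (p := fun a b c => Nat.blt a 8 && Nat.blt b 5 && Nat.blt (a + b + c) 13)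
    ((p (n 1224272 (n 1044276 l l) (n 1084296 (n 1280308 (n 917298 l (n 1601284 l (n 589279 l l))) l) (n 1883320
      (n 1281304 l l) (n 928293 l l)))) (n 1297321 (n 1720302 (n 1575292 l (n 716279 l l)) (n 566287 (n 1447309 l
      (n 943296 l l)) l)) (n 770279 (n 1304290 l (n 1211270 l l)) (n 1359305 (n 332309 l (n 1921317 l l)) l))) (n
      200284 (n 1938285 (n 1109288 (n 1279295 (n 1227288 l (n 971328 l l)) (n 147273 l (n 1816335 l l))) (n 444278
      (n 1974346 l (n 580306 l l)) (n 216298 l (n 1662345 l l)))) (n 1628319 (n 764292 l (n 748294 (n 213268 (n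
      551275 (n 157254 l (n 1758306 l (n 580285 l (n 1123304 l l)))) (n 1783309 l (n 1447307 l (n 1967329 l l))))
      (n 1254302 (n 2063305 l (n 881289 l (n 1590304 l l))) (n 113276 l (n 1458302 l (n 1406302 l (n 915295 l
      l)))))) (n 935321 (n 1253298 (n 1113307 l (n 239285 l (n 901288 l l))) (n 941294 l (n 1301292 l (n 407283 l
      (n 1576301 l l))))) (n 1086304 (n 543296 l (n 1798304 l (n 874271 l (n 796290 l l)))) (n 945312 l (n 930302
      l (n 1477320 l (n 1310333 l l)))))))) (n 1139310 (n 1111302 l (n 1448315 l l)) (n 257273 l (n 1282312 l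
      l))))) (n 1250285 (n 927286 (n 744268 l (n 220345 l (n 737327 l l))) (n 392272 l (n 1108284 l (n 358296 l (n
      1295312 l l))))) (n 1305303 (n 1268302 l (n 1265295 l (n 223283 l (n 1628299 l l)))) (n 1069290 l (n 943301
      l (n 1322311 l (n 908301 l l))))))))) ?_ ?_
  · intro a b c
    simp only [col5, Set.mem_ofPred_eq, Bool.and_eq_true, Bool.or_eq_true, blt_iff, ble_iff, beq_iff, nandL_iff, cor0,
      cor5, cor10, cor15, and_false, or_false, not_false_eq_true, and_true]
    omega
  · decide +kernel

theorem cert_t15 : HBS (col5 15) 0 := by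
  refine HBS.ofP (p := fun a b c => Nat.blt a 8 && Nat.blt b 5 && Nat.blt (a + b + c) 15)
    ((q 1070288 (p (n 1727336 (n 1268307 l (n 1424307 l (n 473294 l l))) (n 1097290 l (n 191294 l (n 75315 l (n
      2186280 l l))))) (n 619313 (n 603284 (n 942296 l (n 1086304 l (n 757269 l l))) (n 1434292 l (n 812304 l (n
      940290 l (n 632311 l l))))) (n 440333 (n 931311 l l) (n 1225267 (n 916297 l (n 1121269 l l)) (n 1227286 l (n
      1926267 l (n 783275 l l)))))) (n 288265 (n 634329 (n 761298 (n 1269316 l (n 1547271 l (n 425293 l (n 574257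
      l l)))) (n 1379266 (n 927279 l (n 1950274 l l)) (n 551279 l (n 210254 l l)))) (n 1782263 (n 1589268 (n
      1112313 l (n 1643291 l l)) (n 1252279 l (n 758276 l (n 729246 l (n 2071285 l l))))) (n 905311 l (n 732276 l
      l)))) (n 547256 (n 1097293 (n 985342 l (n 469263 l (n 1134285 l (n 785298 l l)))) (n 1620325 (n 554297 l (n
      1928293 l l)) (n 1295322 l (n 645316 l l)))) (n 720291 (n 1086302 (n 381267 l (n 1796294 l (n 1472303 l (n
      557300 l l)))) (n 1043271 l (n 1961333 l (n 1224270 l (n 2011335 l (n 604296 l l)))))) l)))) (p (n 1614304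
      (n 386291 l (n 1951290 l l)) (n 633291 l (n 1670320 l l))) (n 2055304 (n 2006309 (n 1128310 l (n 1266297 l
      (n 1987328 l l))) (n 857294 (n 294301 l (n 1255299 l l)) (n 1916306 l (n 955300 l l)))) (n 926282 l (n
      1569315 (n 97272 l (n 1192291 l (n 1963316 l l))) (n 1087301 l (n 775293 l (n 1268308 l (n 705274 l l)))))))
      (n 210271 (n 450288 (n 1841336 (n 1576312 (n 285285 l (n 272289 l l)) (n 1281308 l (n 1152306 l l))) (n
      1781315 (n 803305 l (n 1967328 l l)) (n 206257 l (n 1296315 l (n 1478327 l l))))) (n 462290 (n 297295 l (n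
      1242308 l (n 637258 l l))) (n 1810314 (n 1601288 l (n 821279 l (n 1374307 l (n 959315 l l)))) (n 944301 l (n
      301280 l (n 1266302 l (n 1594313 l l))))))) (n 1044294 (n 769292 (n 1939289 (n 188295 l (n 1367280 l l)) (n
      540289 l (n 1281306 l (n 775305 l l)))) (n 1086298 (n 1461309 l (n 1487319 l l)) (n 442290 l (n 562287 l (n
      1582300 l (n 1123304 l l)))))) (n 1409303 (n 749299 l (n 1112302 l (n 1435300 l l))) (n 1606310 l (n 269281
      l (n 1418301 l l))))))))) ?_ ?_
  · intro a b c
    simp only [col5, Set.mem_ofPred_eq, Bool.and_eq_true, Bool.or_eq_true, blt_iff, ble_iff, beq_iff, nandL_iff, cor0,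
      cor5, cor10, cor15, and_false, or_false, not_false_eq_true, and_true]
    omega
  · decide +kernel

theorem cert_wedge11 : HBS (wedge 11 10) 0 := by
  refine HBS.ofP (p := fun a b c => Nat.blt b 5 && Nat.blt (a + b + c) 11 && !(Nat.beq b 4 && (Nat.ble a 6 && Nat.ble c (6 - a) && Nat.blt (6 - a) 4)))
    ((p (n 1672320 (n 1464308 l l) (n 1422300 l (n 760288 l l))) (n 506316 (n 432278 (n 1587298 l (n 408269 l (n
      660290 l l))) (n 785293 l (n 1281303 l (n 1735304 l (n 1776314 l l))))) (n 310321 (n 459283 l (n 1425303 l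
      (n 1595311 l l))) (n 1589287 (n 1097293 l (n 373304 l l)) l))) (n 373292 (n 464282 (n 1097299 l (n 305260 l
      (n 652278 l (n 1620321 l (n 991300 l l))))) (n 620301 (n 905292 (n 1848336 l l) (n 1411304 (n 660305 l l) (n
      321286 (n 1449310 l (n 1073300 l (n 1097298 l l))) (n 1294307 l (n 1282309 l (n 693276 l (n 1240300 l
      l))))))) (n 1276298 (n 1425305 l (n 1450311 l (n 882303 l l))) (n 1960308 l (n 1294309 l (n 763300 l l))))))
      (n 1222271 (n 1448296 (n 203309 l (n 1097292 l (n 192327 l l))) (n 608323 (n 401315 (n 749303 l (n 1597328 l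
      l)) (n 746289 l (n 912275 l (n 1643302 l l)))) (n 443270 l (n 554303 l l)))) (n 1591303 (n 1099303 (n 829305
      l (n 904298 l (n 1500305 l l))) (n 1264289 l (n 1280302 l (n 1292301 l (n 1253296 l l))))) (n 1894316 l (n
      759288 l (n 1711315 l (n 544307 l l))))))))) ?_ ?_
  · intro a b c
    simp only [wedge, Set.mem_ofPred_eq, Bool.and_eq_true, Bool.or_eq_true, blt_iff, ble_iff, beq_iff, nandL_iff, cor0,
      cor5, cor10, cor15, and_false, or_false, not_false_eq_true, and_true]
    omega
  · decide +kernel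

theorem cert_wedge13 : HBS (wedge 13 15) 0 := by
  refine HBS.ofP (p := fun a b c => Nat.blt b 5 && Nat.blt (a + b + c) 13 && !(Nat.beq b 4 && (Nat.ble a 8 && Nat.ble c (8 - a) && Nat.blt (8 - a) 5)))
    ((p (n 1750318 (n 756286 (n 914284 l l) (n 1557297 l l)) (n 1954322 (n 1382286 l l) (n 929292 l l))) (n
      566292 (n 1797320 (n 592291 (n 938279 l l) (n 1291300 l (n 1318310 l l))) (n 971299 l (n 916291 l l))) (n
      480332 (n 1997318 (n 892297 l l) (n 1617303 l l)) (n 1698310 (n 1071287 l l) (n 972329 l l)))) (n 1792329 (n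
      576289 (n 943300 (n 293282 (n 772290 l (n 813295 l l)) (n 343271 l (n 276281 l l))) (n 714302 (n 1076298 l
      (n 942300 l (n 447296 l l))) (n 948317 l (n 971316 l (n 887279 l l))))) (n 567296 (n 943302 (n 983302 l (n
      1461307 l l)) (n 770298 l (n 941303 l l))) (n 1076306 (n 1815305 l (n 885284 l (n 2023313 l l))) (n 1291294
      l (n 26272 l (n 800302 l (n 1544308 l l))))))) (n 774294 (n 619283 (n 1617326 (n 548266 l (n 777289 l l)) (n
      1660332 l (n 253250 l (n 444262 l (n 1633332 l l))))) (n 769284 (n 78246 (n 1789335 l (n 1811325 l l)) (n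
      449278 l (n 304272 l (n 732282 l l)))) (n 968300 l l))) (n 567286 l (n 451313 (n 1829336 (n 1268308 (n
      711296 l (n 1799307 l (n 1452319 l l))) (n 2134296 l (n 943301 l (n 815311 l l)))) (n 1335329 (n 1411312 l
      (n 1967311 l (n 1279301 l l))) (n 404255 l (n 215277 l (n 579293 l l))))) (n 759291 (n 1099309 (n 2176308 l
      (n 1564284 l (n 553296 l l))) (n 1206335 l (n 734298 l (n 1223247 l l)))) (n 1804332 (n 1254299 l (n 629295
      l l)) (n 1904296 (n 576281 l (n 1125314 l l)) (n 913276 l (n 1522261 l l))))))))))) ?_ ?_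
  · intro a b c
    simp only [wedge, Set.mem_ofPred_eq, Bool.and_eq_true, Bool.or_eq_true, blt_iff, ble_iff, beq_iff, nandL_iff, cor0,
      cor5, cor10, cor15, and_false, or_false, not_false_eq_true, and_true]
    omega
  · decide +kernel

theorem cert_wedge15 : HBS (wedge 15 0) 0 := by
  refine HBS.ofP (p := fun a b c => Nat.blt b 5 && Nat.blt (a + b + c) 15)
    ((q 649316 (p (n 290268 (n 1914325 l (n 760280 l l)) (n 412287 l l)) (n 1446309 (n 1294311 (n 607299 (n
      2151321 l (n 1634318 l l)) (n 986310 l l)) (n 1279304 l (n 1219307 l l))) (n 1329314 (n 1579319 l (n 369254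
      l (n 1448316 l l))) (n 1786334 (n 1759317 l l) (n 1909339 l l)))) (n 1622328 (n 916295 (n 617288 (n 614283
      (n 1615316 l (n 1280308 l (n 1413314 l l))) (n 811295 l l)) (n 395279 (n 1627313 l (n 1295312 l (n 489298 l
      (n 198259 l l)))) (n 959306 l l))) (n 772296 (n 783289 (n 1422304 l (n 928294 l l)) (n 1901306 l (n 1244304
      l (n 462289 l l)))) (n 735295 (n 381284 l (n 1253299 l l)) (n 1730293 l (n 325294 l (n 1123302 l l)))))) (n
      752293 (n 1058295 (n 425266 (n 1646339 l (n 606273 l l)) (n 618281 l (n 618283 l (n 2144362 l l)))) (n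
      730274 (n 1167308 l (n 928288 l l)) (n 1691329 l (n 1840344 l (n 1804348 l l))))) (n 1283324 (n 213257 (n
      1960357 (n 1399313 l (n 1669328 l l)) (n 929291 l (n 1305308 l l))) (n 439287 (n 1478324 l l) (n 1831343 l
      (n 1657321 l (n 1576304 l (n 1829342 l l)))))) l)))) (p (n 1901287 (n 1080246 l (n 2171260 l (n 763314 l
      l))) (n 809286 l l)) (n 791319 (n 1643307 l (n 573263 l (n 2131327 l l))) (n 769270 (n 11326 (n 1892311 l (n
      606300 l (n 725318 l l))) (n 1097289 l (n 1822268 l (n 95271 l l)))) (n 803324 (n 580297 l (n 549276 l l))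
      (n 435295 l (n 945318 l (n 1224265 l l)))))) (n 473297 (n 1291292 (n 401319 l (n 2141327 (n 940288 l l) (n
      1147275 (n 747298 (n 1255312 l (n 1110290 l (n 42252 l l))) (n 1262240 l (n 564287 l (n 1413331 l l)))) (n
      1567318 (n 747295 (n 1291289 l (n 1196250 l l)) (n 810284 l (n 944315 l (n 1147280 l l)))) l)))) (n 965286
      (n 762304 (n 1290288 l (n 575264 l (n 1641303 l l))) (n 789312 l (n 1254301 l (n 629286 l (n 1823302 l
      l))))) (n 1087306 (n 1265297 l (n 1628312 l l)) (n 1502317 (n 1603296 l l) (n 1385300 l (n 1281310 l (n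
      1668314 l (n 192285 l l)))))))) (n 931309 (n 817323 (n 1304301 l (n 307306 l (n 385288 l (n 581301 l l))))
      (n 1645318 (n 1334321 l (n 739309 l l)) (n 1249278 l (n 2082294 l l)))) (n 1198256 (n 787313 l (n 1607318 l
      (n 614276 l (n 1401328 l l)))) (n 1395283 (n 1568303 l (n 1920317 l (n 696290 l l))) (n 744281 l l)))))))) ?_ ?_
  · intro a b c
    simp only [wedge, Set.mem_ofPred_eq, Bool.and_eq_true, Bool.or_eq_true, blt_iff, ble_iff, beq_iff, nandL_iff, cor0,
      cor5, cor10, cor15, and_false, or_false, not_false_eq_true, and_true]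
    omega
  · decide +kernel

theorem cert_wedge17 : HBS (wedge 17 5) 0 := by
  refine HBS.ofP (p := fun a b c => Nat.blt b 5 && Nat.blt (a + b + c) 17 && !(Nat.beq b 4 && (Nat.ble a 12 && Nat.ble c (12 - a) && Nat.blt (2 * (12 - a) + c) 6)))
    ((q 592293 (p (n 606281 (n 929288 l (n 1632332 l (n 875278 l l))) (n 803307 (n 600266 l (n 1463313 l (n
      1794318 l l))) (n 1896333 l (n 383265 l (n 233300 l l))))) (n 1437311 l (n 27228 (n 1435315 (n 1837327 l l)
      (n 1759339 l (n 604261 l l))) (n 1595326 (n 225262 l (n 943297 l l)) (n 1265300 l (n 1410314 l l))))) (n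
      1704307 (n 745277 (n 1110298 (n 427307 (n 1734322 (n 1111302 l (n 748290 l l)) (n 749294 l (n 287230 l l)))
      (n 369264 (n 1076324 l (n 1904332 l l)) (n 1634340 l (n 944311 l l)))) (n 1841355 (n 1452329 l (n 602275 l
      l)) (n 789300 l (n 1759320 l l)))) (n 899280 (n 1241301 (n 940291 l (n 1252295 l (n 576275 l l))) (n 922311
      l (n 970305 l (n 937271 l (n 1422305 l l))))) (n 582295 (n 1435310 (n 1810317 l (n 319290 l (n 738288 l (n
      1316312 l (n 1777319 l l))))) (n 562273 l l)) (n 1082291 l l)))) (n 1112302 (n 673280 (n 1451325 (n 278249 l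
      (n 943292 l l)) (n 2172379 l (n 563256 l l))) (n 1565311 l (n 1564315 l (n 1240306 l l)))) (n 248270 (n
      241246 (n 91231 (n 1304314 (n 1266310 l (n 1933370 l l)) (n 1964361 l (n 771276 l l))) l) (n 1422312 (n
      1398307 l (n 751292 l (n 543287 l (n 1424317 l l)))) (n 1061298 (n 1315314 l (n 463271 l (n 1288311 l (n
      1240303 l l)))) (n 1609341 (n 629272 l (n 113256 l (n 772282 l (n 444264 l l)))) (n 1245320 l (n 581279 l (n
      567277 l (n 746276 l l)))))))) l)))) (p (n 901280 (n 1095264 l (n 931317 l l)) (n 1002290 (n 595312 l l) (n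
      36286 l l))) (n 1569315 (n 918301 (n 731286 l (n 1255299 l l)) (n 924272 l (n 1860266 l (n 1757287 l (n
      321308 l l))))) (n 775315 (n 1108282 (n 619306 l (n 785286 l (n 563270 l l))) (n 1100310 l (n 941293 l (n
      1590292 l l)))) (n 1099314 (n 289268 (n 1460280 l (n 2032282 l l)) (n 1230309 l (n 1077340 l (n 659337 l
      l)))) l))) (n 1752324 (n 745287 (n 568303 (n 1279302 l (n 731279 l l)) (n 618310 l (n 1225273 l l))) (n
      216282 l (n 953303 (n 905301 (n 771297 (n 943301 l (n 19274 l (n 1084296 l l))) (n 1200285 l (n 1887294 l (n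
      244295 l l)))) (n 1276289 (n 1662325 l (n 800308 l (n 1032286 l l))) (n 1577295 l (n 1942303 l (n 604295 l
      l))))) (n 1758296 l (n 942303 l l))))) (n 1732277 (n 1652258 (n 565296 (n 1217321 (n 577283 l (n 589276 l
      l)) (n 770258 l (n 587246 l l))) (n 1099313 (n 1101333 l (n 705263 l l)) (n 190323 l (n 914271 l l)))) (n
      916295 (n 1084288 l l) (n 271343 (n 642292 l (n 1591292 l (n 876280 l (n 399319 l l)))) (n 1087315 l (n
      308334 l (n 46295 l (n 1249248 l l))))))) (n 1108280 (n 198252 (n 241289 (n 1097291 l (n 1668304 l (n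
      1485293 l l))) (n 1266294 l l)) (n 769263 (n 1592308 l (n 574255 l l)) (n 229302 l (n 414332 l l)))) (n
      1473299 (n 1579305 (n 984320 l (n 1567307 l l)) (n 21289 l (n 567303 l l))) (n 1269313 l (n 644309 (n
      1474307 l (n 1421294 l l)) (n 659327 l (n 931311 l l))))))))))) ?_ ?_
  · intro a b c
    simp only [wedge, Set.mem_ofPred_eq, Bool.and_eq_true, Bool.or_eq_true, blt_iff, ble_iff, beq_iff, nandL_iff, cor0,
      cor5, cor10, cor15, and_false, or_false, not_false_eq_true, and_true]
    omega
  · decide +kernel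

theorem cert_tip10_0 : HFS (tip 10 0) 0 := by
  refine HFS.ofT (p := fun a b c => (Nat.ble 1 b && Nat.blt (a + b + c) 11))
    ([(904292, (p (n 1085294 l (n 1450311 l (n 1256303 l l))) (n 1111308 (n 1761304 (n 1557282 l (n 1850336 l l))
      (n 1329317 l (n 1293312 l (n 1137315 l l)))) l) (n 1212280 (n 1912294 (n 1621317 (n 888276 (n 1242285 l (n
      1096298 l l)) (n 1097299 l (n 461315 l (n 1068286 l l)))) l) (n 1912298 l l)) (n 1544298 (n 1812320 l (n
      1550289 l (n 1292311 l (n 1984335 l l)))) (n 1565305 l (n 1240300 l (n 902289 l (n 29253 l l)))))))),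
      (1316305, (p (n 1097295 l (n 31274 l (n 1767323 l l))) (n 931307 (n 564282 l (n 600283 l (n 1279301 l l)))
      (n 1264282 l (n 1834287 l (n 979300 l l)))) (n 736302 (n 1267303 (n 718277 l (n 1239291 l (n 918301 l (n
      894304 l l)))) (n 1251290 l (n 927289 l (n 773293 l (n 556297 l l))))) (n 966294 (n 1108280 l (n 881315 l (n
      1460292 l (n 408288 l l)))) (n 745285 l (n 1429321 l (n 523272 l (n 904301 l l))))))))]) ?_ ?_
  · intro a b c
    simp only [tip, Set.mem_ofPred_eq, Bool.and_eq_true, Bool.or_eq_true, blt_iff, ble_iff, beq_iff, nandL_iff, cor0,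
      cor5, cor10, cor15, and_false, or_false, not_false_eq_true, and_true]
    omega
  · decide +kernel

theorem cert_tip10_5 : HFS (tip 10 5) 0 := by
  refine HFS.ofT (p := fun a b c => (Nat.ble 1 b && Nat.blt (a + b + c) 11) || (Nat.beq b 0 && (Nat.ble a 10 && Nat.ble c (10 - a) && Nat.blt (2 * (10 - a) + c) 6)))
    ([(1578312, (p (n 944304 (n 1448307 l (n 1239297 l l)) (n 1126314 (n 1602297 l (n 322314 l l)) (n 1275277 l
      (n 1282311 l (n 1268305 l l))))) (n 1732288 (n 1460296 l (n 941305 (n 965295 l (n 798307 l (n 1411293 l l)))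
      l)) (n 1281304 l (n 1844336 (n 1621310 l (n 1603301 l (n 957302 l l))) (n 1645320 l (n 827309 l (n 1460312 l
      l)))))) (n 1071286 (n 878266 l (n 579291 l (n 940301 l (n 1418287 l l)))) (n 943304 (n 1739321 (n 1407301 (n
      1304305 (n 771293 l (n 1960309 l (n 933307 l l))) (n 1856338 (n 93283 l (n 916295 l (n 887289 l (n 774301 l
      l)))) (n 706272 l (n 569284 l (n 1254300 l (n 1295315 l l)))))) (n 736286 l (n 1450309 l (n 1025293 l l))))
      (n 1575291 l (n 1549293 l (n 1256309 l l)))) (n 1110300 (n 1491327 (n 1256306 l (n 742269 l (n 417272 l (n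
      812306 l l)))) (n 1110297 (n 1459283 l (n 302282 l l)) (n 1935327 l (n 917301 l l)))) (n 1971318 (n 1412296
      (n 1323324 l (n 1073290 l l)) (n 722291 l (n 1439309 l l))) (n 771296 (n 1642312 l l) (n 1990316 l (n
      1239288 l (n 965313 l l))))))))))]) ?_ ?_
  · intro a b c
    simp only [tip, Set.mem_ofPred_eq, Bool.and_eq_true, Bool.or_eq_true, blt_iff, ble_iff, beq_iff, nandL_iff, cor0,
      cor5, cor10, cor15, and_false, or_false, not_false_eq_true, and_true]
    omega
  · decide +kernel

theorem cert_tip10_10 : HFS (tip 10 10) 0 := by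
  refine HFS.ofT (p := fun a b c => (Nat.ble 1 b && Nat.blt (a + b + c) 11) || (Nat.beq b 0 && (Nat.ble a 10 && Nat.ble c (10 - a) && Nat.blt (10 - a) 4)))
    ([(615293, (p (n 1369285 l (n 1240297 l l)) (n 634303 (n 1620318 l (n 929293 l (n 1126306 l (n 749290 l l))))
      (n 1934324 l (n 1096288 l (n 790312 l (n 1409297 l l))))) (n 1737318 (n 419283 (n 1667305 (n 718275 (n
      943308 l (n 940287 l l)) (n 744280 l (n 1110297 l l))) (n 1097299 (n 1320314 l (n 1505332 l (n 46277 l l)))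
      (n 916292 l (n 1086299 l l)))) (n 1764315 l l)) (n 1578316 (n 1254303 l (n 449281 l (n 451288 l (n 744280 l
      l)))) (n 1435313 l (n 1477318 l (n 788286 l (n 723283 l l)))))))), (1283318, (p (n 1207288 (n 1085294 l l)
      (n 1256302 l l)) (n 1425299 (n 941305 l (n 1111308 l l)) (n 1440310 (n 1555289 l (n 717285 l (n 1411300 l
      l))) (n 788306 l (n 1125309 l (n 954304 l (n 1315313 l l)))))) (n 1255294 (n 1504345 l l) (n 1304311 (n
      898284 (n 1072294 (n 916295 l (n 1278299 l l)) (n 436301 l (n 1252291 l (n 554299 l l)))) (n 1425302 (n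
      1239294 l (n 942302 l l)) (n 735292 l (n 1564296 l (n 1821311 l l))))) (n 1411294 (n 530270 (n 1290313 l (n
      1848348 l l)) (n 918296 l (n 1488324 l (n 1470310 l l)))) (n 1278306 (n 706274 l (n 1579298 l l)) (n 1472318
      l (n 1216283 l (n 746288 l l)))))))))]) ?_ ?_
  · intro a b c
    simp only [tip, Set.mem_ofPred_eq, Bool.and_eq_true, Bool.or_eq_true, blt_iff, ble_iff, beq_iff, nandL_iff, cor0,
      cor5, cor10, cor15, and_false, or_false, not_false_eq_true, and_true]
    omega
  · decide +kernel

theorem cert_tip10_15 : HFS (tip 10 15) 0 := by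
  refine HFS.ofT (p := fun a b c => (Nat.ble 1 b && Nat.blt (a + b + c) 11) || (Nat.beq b 0 && (Nat.ble a 10 && Nat.ble c (10 - a) && Nat.blt (10 - a) 5)))
    ([(1584328, (p (n 686280 (n 1019261 l l) (n 1126310 l l)) (n 1086298 (n 539271 (n 1500335 l l) (n 1280306 l
      (n 1488324 l l))) (n 1255306 (n 310312 (n 604288 l (n 615290 l (n 444288 l l))) (n 1304298 l (n 1127313 l (n
      311324 l (n 749302 l l))))) l)) (n 1491318 (n 304296 (n 1083297 l (n 244270 l (n 1409304 l (n 1394305 l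
      l)))) (n 583301 (n 279299 l (n 1123305 l l)) (n 893300 l (n 1121296 l l)))) (n 1900289 (n 943307 (n 1425303
      (n 1809311 l (n 384276 l (n 921299 l l))) (n 1603294 l (n 1280304 l (n 1251287 l (n 1085297 l l))))) (n
      553288 (n 944311 (n 579291 l (n 228285 l (n 734288 l l))) (n 748296 l l)) (n 1110298 l (n 1175319 l (n
      750308 l l))))) (n 1589308 (n 2077322 (n 1490324 (n 1591301 l (n 1625303 l (n 1548292 l l))) (n 1646324 l (n
      911283 l (n 1253297 l (n 304304 l l))))) (n 1301292 l (n 1721305 l (n 1226295 l l)))) (n 784290 (n 1612316 l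
      (n 237259 l l)) (n 1294311 l (n 1254302 l (n 1409306 l l)))))))))]) ?_ ?_
  · intro a b c
    simp only [tip, Set.mem_ofPred_eq, Bool.and_eq_true, Bool.or_eq_true, blt_iff, ble_iff, beq_iff, nandL_iff, cor0,
      cor5, cor10, cor15, and_false, or_false, not_false_eq_true, and_true]
    omega
  · decide +kernel

theorem cert_tip12_0 : HFS (tip 12 0) 0 := by
  refine HFS.ofT (p := fun a b c => (Nat.ble 1 b && Nat.blt (a + b + c) 13))
    ([(1425300, (p (n 784310 l (n 1124318 l l)) (n 1565280 (n 784314 l (n 1035255 l l)) (n 903286 l (n 941304 l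
      l))) (n 872264 (n 941307 (n 1122312 l (n 1075288 l l)) (n 910284 l (n 771307 l (n 1308332 l l)))) (n 536276
      (n 901283 l (n 1280307 l (n 784310 l (n 201268 l l)))) (n 146314 l (n 1527276 l l)))))), (976285, (p (n
      1097293 l (n 916295 l (n 758286 l l))) (n 952284 (n 529304 l (n 925265 l (n 746289 l l))) (n 1474303 l (n
      1635333 l (n 1218310 l l)))) (n 580306 (n 1259327 (n 916293 l (n 1790325 l (n 1774316 l (n 193290 l l)))) (n
      1244316 l (n 461287 l (n 1755271 l (n 1257320 l l))))) (n 1097293 (n 1648341 l (n 320318 l (n 1106256 l (n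
      954297 l l)))) (n 721290 l (n 1269312 l (n 616294 l (n 1558326 l l)))))))), (1142331, (p (n 74276 (n 1044282
      l (n 1643324 l l)) (n 1407288 l (n 536269 l (n 1749303 l l)))) (n 1071293 (n 1435305 (n 200269 l (n 1479323
      l (n 448302 l l))) (n 773293 l (n 1464320 l (n 453297 l (n 1629320 l l))))) (n 1593312 (n 772295 l (n 302294
      l (n 1424302 l l))) (n 255260 l (n 1862310 l (n 943296 l (n 40253 l l)))))) (n 939295 (n 1590307 (n 1478317
      (n 293300 l l) (n 1556305 (n 577284 l (n 1656311 l (n 956309 l l))) (n 642294 l (n 1761309 l (n 733283 l (n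
      827312 l l)))))) (n 1619322 (n 1217301 l (n 1569318 l l)) (n 1265305 (n 1044286 l (n 1932338 l l)) (n
      1643327 l (n 1399310 l (n 265254 l (n 1848342 l l))))))) (n 914292 (n 1561291 (n 1220290 (n 1464320 l (n
      2081301 l l)) (n 1333325 l (n 966309 l l))) (n 1318323 (n 733281 l (n 951300 l l)) (n 2141338 l (n 941299 l
      (n 1720298 l l))))) (n 1255301 (n 1280303 l (n 1030279 l (n 1998320 l (n 603297 l l)))) (n 1217296 l (n
      1821311 l (n 796295 l (n 1530303 l l)))))))))]) ?_ ?_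
  · intro a b c
    simp only [tip, Set.mem_ofPred_eq, Bool.and_eq_true, Bool.or_eq_true, blt_iff, ble_iff, beq_iff, nandL_iff, cor0,
      cor5, cor10, cor15, and_false, or_false, not_false_eq_true, and_true]
    omega
  · decide +kernel

theorem cert_tip12_5 : HFS (tip 12 5) 0 := by
  refine HFS.ofT (p := fun a b c => (Nat.ble 1 b && Nat.blt (a + b + c) 13) || (Nat.beq b 0 && (Nat.ble a 12 && Nat.ble c (12 - a) && Nat.blt (2 * (12 - a) + c) 6)))
    ([(1889326, (q 957311 (p (n 917296 (n 1537285 l (n 800298 l l)) (n 1464310 l (n 1506327 l l))) (n 1252295 (n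
      1113309 l (n 630297 l l)) (n 1800328 (n 1281307 (n 408288 l (n 1448303 l (n 1294308 l l))) (n 1446302 l (n
      1551291 l (n 1967323 l (n 1141313 l l))))) (n 1202281 l (n 1739318 l (n 593285 l l))))) (n 639294 (n 1591316
      (n 16256 (n 1083295 (n 1254303 (n 801306 l (n 712294 l l)) (n 1243307 l (n 1604311 l (n 440298 l l)))) l) (n
      267288 (n 168288 l (n 930298 l (n 746288 l l))) (n 1426310 l (n 250276 l (n 912283 l (n 1240297 l l)))))) (n
      1073296 l (n 904292 l l))) (n 1321319 (n 646308 (n 654299 l (n 295293 l (n 579292 l (n 263296 l l)))) (n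
      568292 l (n 1165314 l (n 1307310 l (n 1668316 l l))))) (n 1275301 (n 965304 l l) (n 1447313 (n 916292 l (n
      763296 l (n 787307 l l))) (n 449286 l (n 524255 l (n 1538290 l l)))))))) (p (n 711287 (n 1085292 l (n 930300
      l (n 1294317 l l))) (n 1097293 l (n 1642299 l (n 641298 l (n 1247319 l l))))) (n 1254297 (n 304322 (n 390258
      l (n 784304 l (n 581291 l (n 607310 l l)))) (n 1309327 l (n 1202255 l (n 928298 l l)))) (n 1084292 (n
      1108277 l (n 1034291 l (n 552291 l l))) (n 1216288 l (n 776312 l (n 1414318 l (n 632312 l l)))))) (n 556297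
      (n 978317 (n 432288 (n 1596316 l (n 982320 l l)) (n 564281 l (n 1057279 l (n 941302 l l)))) (n 942307 (n
      761296 (n 1316332 l l) (n 1071284 l (n 381271 l (n 1133314 l (n 1435302 l l))))) (n 1244288 (n 1700240 l (n
      347240 l (n 915290 l (n 967326 l l)))) (n 515253 l (n 958323 l l))))) (n 261267 (n 593310 (n 1709297 l (n
      868310 l (n 206312 l (n 941293 l l)))) (n 1293307 (n 1425315 l (n 1097291 l (n 1596334 l (n 1799299 l l))))
      l)) (n 135306 (n 1112308 (n 967300 l (n 1408290 l l)) (n 1801315 l (n 785300 l l))) (n 1283320 (n 1112308 l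
      (n 1697280 l l)) (n 843358 l (n 601288 l l)))))))))]) ?_ ?_
  · intro a b c
    simp only [tip, Set.mem_ofPred_eq, Bool.and_eq_true, Bool.or_eq_true, blt_iff, ble_iff, beq_iff, nandL_iff, cor0,
      cor5, cor10, cor15, and_false, or_false, not_false_eq_true, and_true]
    omega
  · decide +kernel

theorem cert_tip12_10 : HFS (tip 12 10) 0 := by
  refine HFS.ofT (p := fun a b c => (Nat.ble 1 b && Nat.blt (a + b + c) 13) || (Nat.beq b 0 && (Nat.ble a 12 && Nat.ble c (12 - a) && Nat.blt (12 - a) 4)))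
    ([(1123303, (p (n 600274 (n 1081268 l (n 527275 l (n 1598342 l l))) (n 1255303 l (n 564283 l (n 1958319 l
      l)))) (n 1280305 (n 1095285 (n 1095276 l (n 594318 l l)) (n 710296 l (n 1231306 l l))) (n 1245315 (n 1766327
      l (n 223251 l l)) (n 1110297 l (n 1214291 l l)))) (n 736314 (n 1977301 (n 1411306 (n 772296 (n 1811300 (n
      1082276 l (n 641293 l l)) (n 1439319 l (n 1087309 l l))) (n 888285 (n 1582311 l (n 927288 l l)) (n 184278 l
      (n 1052310 l l)))) (n 1233330 (n 394274 l (n 930303 l l)) (n 951269 l (n 755259 l (n 1802328 l l))))) (n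
      315271 (n 963285 (n 887278 l (n 1099303 l (n 275256 l l))) (n 1411314 l (n 1941340 l (n 602269 l (n 1424319
      l l))))) (n 1255303 (n 1761306 l l) (n 244289 (n 1568312 l (n 1473311 l (n 1400312 l l))) (n 1135298 l (n
      660311 l (n 423291 l l))))))) (n 927281 l l)))), (200282, (p (n 759294 (n 1411298 l (n 1447307 l l)) (n
      1085292 l (n 1882276 l l))) (n 1255300 (n 1060282 (n 592294 l (n 1085291 l (n 788316 l l))) (n 1083288 l (n
      1421293 l (n 1642318 l l)))) (n 1434306 (n 616295 l (n 384279 l (n 1828328 l l))) (n 420270 l (n 1630320 l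
      (n 695267 l l))))) (n 2071319 (n 1907300 (n 355256 (n 987342 (n 706260 l (n 1381267 l (n 903282 l (n 1429302
      l l)))) (n 1656329 l (n 1935295 l (n 840354 l (n 1623320 l l))))) (n 943307 (n 1976314 l (n 1838329 l (n
      732284 l (n 774304 l l)))) (n 1122314 (n 914287 l (n 1082286 l (n 1500328 l (n 178264 l l)))) l))) (n
      1930311 (n 977303 (n 825316 l (n 230295 l (n 953298 l (n 889280 l l)))) (n 1407285 l (n 801311 l (n 1648329
      l (n 1257304 l l))))) (n 1903306 (n 1172310 l (n 1282310 l (n 784298 l (n 941301 l l)))) (n 1086298 (n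
      280286 l (n 1255301 l l)) (n 709281 l (n 941298 l l)))))) (n 567275 (n 1266307 l (n 1449319 l (n 270263 l
      l))) (n 966299 l (n 1582313 l (n 52252 l l)))))))]) ?_ ?_
  · intro a b c
    simp only [tip, Set.mem_ofPred_eq, Bool.and_eq_true, Bool.or_eq_true, blt_iff, ble_iff, beq_iff, nandL_iff, cor0,
      cor5, cor10, cor15, and_false, or_false, not_false_eq_true, and_true]
    omega
  · decide +kernel

theorem cert_tip12_15 : HFS (tip 12 15) 0 := by
  refine HFS.ofT (p := fun a b c => (Nat.ble 1 b && Nat.blt (a + b + c) 13) || (Nat.beq b 0 && (Nat.ble a 12 && Nat.ble c (12 - a) && Nat.blt (12 - a) 5)))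
    ([(469287, (p (n 749296 (n 929292 l (n 647292 l l)) (n 1094272 l (n 1279298 l (n 1303294 l l)))) (n 925265 l
      (n 1461315 (n 1245318 (n 590289 (n 1655314 l (n 1912304 l (n 411281 l l))) (n 565292 l l)) (n 205318 (n
      409281 l (n 1951274 l (n 387306 l (n 1582321 l l)))) l)) (n 423264 l (n 928291 l (n 966297 l (n 1749323 l
      l)))))) (n 1221319 (n 1991333 (n 660309 (n 618287 l (n 974310 l (n 520263 l (n 120276 l l)))) (n 541286 (n
      1790329 l (n 1449313 l l)) (n 1906309 l (n 445285 l l)))) (n 469270 (n 1219307 l (n 1608330 l (n 925286 l (n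
      1280311 l l)))) (n 240263 (n 711274 l (n 917291 l l)) (n 308276 l (n 215263 l l))))) (n 1423302 (n 917307 (n
      191304 (n 804334 l (n 577287 l (n 1160299 l l))) (n 1087310 l (n 1087312 l (n 55268 l (n 1147287 l l))))) (n
      1278283 l l)) (n 1279301 (n 1461303 (n 1236263 l (n 1446288 l l)) (n 2025347 l (n 1244320 l l))) (n 1242308
      (n 1253298 l (n 1254304 l l)) (n 734284 l (n 1282316 l l)))))))), (1596314, (p (n 1281305 l (n 1255296 l (n
      709271 l (n 1655315 l l)))) (n 1861272 (n 1580291 (n 1085291 l (n 956316 l (n 1452315 l l))) (n 1363271 l (n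
      1069280 l (n 1623320 l l)))) (n 461304 (n 1438306 l (n 705271 l (n 955302 l (n 1030281 l l)))) (n 1112305 l
      (n 587290 l l)))) (n 822319 (n 1862287 (n 1805324 (n 1728294 l (n 565291 l (n 1317306 l (n 1136308 l l))))
      (n 315303 l (n 568291 l (n 1049289 l (n 1710286 l l))))) (n 1205295 (n 425288 (n 969307 l (n 771295 l l)) (n
      1218291 l (n 1761306 l l))) (n 787298 l (n 283298 l (n 1434300 l l))))) (n 1216260 l (n 1318329 (n 145313 (n
      1257301 l l) (n 917295 (n 606303 l (n 771304 l l)) (n 1094288 l (n 1084292 l (n 1116311 l l))))) (n 469323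
      (n 968318 l (n 1281311 l (n 1138325 l (n 1835340 l l)))) (n 1643326 l (n 1964318 l (n 1630321 l (n 135328 l
      l))))))))))]) ?_ ?_
  · intro a b c
    simp only [tip, Set.mem_ofPred_eq, Bool.and_eq_true, Bool.or_eq_true, blt_iff, ble_iff, beq_iff, nandL_iff, cor0,
      cor5, cor10, cor15, and_false, or_false, not_false_eq_true, and_true]
    omega
  · decide +kernel

theorem cert_tip16_0 : HFS (tip 16 0) 0 := by
  refine HFS.ofT (p := fun a b c => (Nat.ble 1 b && Nat.blt (a + b + c) 17))
    ([(1303318, (q 440313 (p (n 1288292 l (n 1884323 (n 556294 (n 745282 l (n 529271 l l)) l) (n 1290307 l l)))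
      (n 1407300 (n 731279 (n 1579309 (n 283297 l (n 1642316 l (n 699274 l l))) (n 1791351 (n 710280 l (n 1243309
      l l)) l)) (n 424296 (n 1240295 l l) (n 889285 l (n 1288296 l l)))) (n 748285 (n 959300 (n 554263 l l) (n
      77251 l (n 1313300 l l))) (n 1604312 l (n 1812326 l (n 912283 l l))))) (n 308277 (n 1433319 (n 882293 (n
      1001304 (n 115249 l (n 1561313 l (n 927289 l (n 148260 l l)))) l) (n 1591323 (n 1256311 l (n 1590318 l l))
      (n 906294 l (n 1614318 l (n 98243 l l))))) (n 1582331 l (n 735273 l (n 404249 l l)))) (n 748291 (n 967312 (n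
      542279 (n 1257309 (n 744284 (n 1111304 l (n 1667332 l (n 1393289 l (n 473291 l l)))) (n 1778320 l (n 891286
      l l))) (n 561265 (n 743269 (n 772285 l (n 262254 l (n 749292 l l))) (n 1109298 l (n 1471315 l (n 1473324 l
      l)))) l)) (n 2159329 (n 1720302 l (n 1057283 l (n 1256312 l (n 972318 l l)))) (n 966291 l (n 915288 l (n
      269278 l (n 901288 l l)))))) (n 735282 l l)) (n 903290 (n 615297 (n 1099304 l (n 1592312 l l)) (n 1974322 l
      (n 930300 l (n 1086297 l l)))) (n 758292 (n 1464316 (n 1112304 l l) (n 605291 (n 775299 l (n 1281314 l l))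
      (n 778315 (n 1809307 l (n 241281 l l)) (n 1395292 l (n 355265 l l))))) (n 615295 (n 1267303 l l) (n 952307
      (n 764302 (n 1540290 l (n 1446304 l (n 1667319 l l))) (n 325296 l (n 775304 l (n 1590296 l l)))) l))))))) (p
      (n 1461299 l (n 808290 (n 461298 l l) (n 1006331 l l))) (n 86294 (n 94248 l (n 1642306 l (n 355247 l l))) (n
      1471272 (n 1093240 l (n 1279292 l (n 770266 l l))) (n 895310 (n 1088306 (n 965309 l l) (n 1813319 l (n
      1399289 l l))) (n 953296 (n 918311 (n 540283 l (n 575271 l (n 395283 l l))) (n 1661343 l (n 655296 l (n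
      1213265 l l)))) (n 1083280 l l))))) (n 1823302 (n 1498290 (n 543329 (n 452338 (n 744267 (n 1400332 l (n
      1427347 l l)) (n 394274 l (n 905311 l (n 406274 l l)))) (n 1646334 l l)) (n 917309 (n 1409286 l (n 1107258 l
      (n 1449304 l l))) (n 1282325 l (n 1281315 l (n 1909364 l (n 917312 l l)))))) (n 1719272 (n 487317 (n 1220325
      l (n 744265 l (n 602283 l l))) (n 852274 l (n 401327 l (n 1210234 l (n 1419263 l l))))) (n 1449306 (n 927288
      l (n 746292 l (n 1114314 l (n 723304 l l)))) (n 1251276 l (n 1733290 l (n 958320 l (n 1127328 l l))))))) (n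
      575274 (n 631314 (n 1922349 (n 686292 (n 719265 l (n 556297 l l)) (n 1435299 l (n 1113315 l (n 1474312 l
      l)))) (n 1421292 l (n 1085298 l (n 1763336 l l)))) (n 1346350 (n 1075304 l (n 550262 l (n 385290 l (n
      1225263 l l)))) (n 758286 (n 943311 l (n 1380246 l l)) (n 985355 l (n 1293319 l l))))) (n 1833308 (n 561276
      (n 1122298 l (n 903288 l (n 720278 l (n 1471296 l (n 1123305 l l))))) (n 1086300 l l)) (n 1071283 (n 1085292
      l (n 1425302 l (n 737296 l l))) (n 1472309 l (n 772301 l (n 783305 l l)))))))))), (539262, (p (n 577278 (n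
      1569297 l (n 1256303 l (n 939294 l l))) (n 1034240 l (n 2066272 l (n 801325 l (n 1311345 l l))))) (n 1204261
      (n 1472333 (n 1640322 l l) (n 1202235 l (n 1907272 l l))) (n 1449320 (n 534244 l l) (n 1255301 l (n 1450323
      l l)))) (n 1980345 (n 796322 (n 851253 (n 1597311 (n 1525237 l (n 986334 l (n 1357245 l (n 1827346 l l))))
      (n 397271 l (n 985346 l (n 1266299 l l)))) (n 1584308 l l)) (n 1400271 (n 1138336 l (n 1633328 l (n 905275 l
      (n 912280 l l)))) (n 1422289 (n 1421285 l l) (n 1295322 l (n 1226266 l (n 1238278 l l)))))) (n 109273 (n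
      786292 (n 1620334 l (n 1203291 l (n 312250 l (n 612272 l l)))) (n 901279 (n 1747317 l (n 1186269 l l)) (n
      747279 l (n 705263 l l)))) (n 1397281 (n 1112315 (n 1564270 l (n 1476340 l (n 590287 l (n 526233 l l)))) l)
      (n 1635337 (n 1583300 l (n 858258 l l)) (n 930295 l (n 1316335 l l))))))))]) ?_ ?_
  · intro a b c
    simp only [tip, Set.mem_ofPred_eq, Bool.and_eq_true, Bool.or_eq_true, blt_iff, ble_iff, beq_iff, nandL_iff, cor0,
      cor5, cor10, cor15, and_false, or_false, not_false_eq_true, and_true]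
    omega
  · decide +kernel

theorem cert_tip16_5 : HFS (tip 16 5) 0 := by
  refine HFS.ofT (p := fun a b c => (Nat.ble 1 b && Nat.blt (a + b + c) 17) || (Nat.beq b 0 && (Nat.ble a 16 && Nat.ble c (16 - a) && Nat.blt (2 * (16 - a) + c) 6)))
    ([(1114316, (q 971313 (p (n 1657331 (n 2014325 l (n 1812318 l l)) (n 998311 l l)) (n 1280314 (n 1448314 (n
      1407298 (n 333301 l l) (n 210256 l (n 1940314 l l))) (n 1668335 (n 612260 l l) (n 2083331 l (n 595273 l
      l)))) (n 1410312 l l)) (n 1446315 (n 576292 (n 373266 (n 1622328 l (n 243258 l (n 1199284 l (n 650271 l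
      l)))) (n 1627307 (n 1659316 l (n 556294 l (n 214277 l (n 1789320 l l)))) (n 1557300 (n 773299 l l) (n 24263
      (n 1101309 (n 2110330 l (n 617281 l (n 488286 l (n 789297 l l)))) (n 771278 l l)) (n 1816330 (n 1576303 l (n
      1632315 l (n 1791323 l l))) (n 1552305 l (n 941292 l (n 1413317 l l)))))))) (n 618301 l (n 694284 l (n
      1097299 l (n 1149308 l l))))) (n 1618332 (n 504290 (n 1085298 l (n 1838341 l (n 1603327 l l))) (n 496288 l
      (n 644295 l (n 1448318 l (n 916288 l l))))) (n 1738337 (n 1111304 l (n 1709311 l (n 1069289 l (n 1617336 l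
      l)))) (n 1918358 (n 1281314 l (n 892284 l (n 1451328 l l))) (n 1097299 l (n 409242 l (n 1433325 l (n 957290
      l l))))))))) (p (n 777307 (n 944303 l (n 748283 l l)) (n 1183251 l l)) (n 1617315 (n 1291307 (n 621311 l l)
      (n 1323334 l (n 224270 l l))) (n 785304 (n 928291 l (n 1461319 l l)) (n 997346 l l))) (n 250282 (n 1434312
      (n 1461320 (n 236266 (n 2160326 l (n 1715312 l (n 747284 l (n 1475322 l l)))) (n 824314 (n 930301 l (n
      1487312 l l)) (n 1462318 l (n 901282 l l)))) (n 1413298 (n 1615321 (n 745281 l (n 1570292 l l)) (n 1641342 l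
      (n 1294326 l l))) (n 928293 (n 942299 l (n 813315 l l)) (n 1242292 l (n 1277309 l l))))) (n 1110306 l (n
      1084292 l (n 580272 l l)))) (n 972326 (n 568290 (n 1417293 (n 577289 l l) (n 2177336 l (n 522254 l (n 381271
      l (n 564283 l l))))) (n 626298 (n 1838310 l (n 1472300 l l)) (n 1993314 l (n 1901284 l (n 1380280 l l)))))
      (n 1981336 (n 1306326 (n 918296 l (n 956315 l l)) (n 1279309 l (n 587296 l (n 907281 l l)))) (n 1676363 (n
      930299 l l) (n 1984343 l (n 1421289 l (n 797328 l (n 1450318 l l))))))))))), (1027246, (p (n 1244311 (n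
      1086292 l (n 1399282 l (n 930302 l l))) (n 582326 l (n 1097289 l l))) (n 1424305 (n 785310 (n 1110301 l l)
      (n 991358 (n 1045253 l (n 301313 l l)) l)) (n 50323 (n 555300 l (n 1646333 l l)) (n 707276 l (n 1673340 l (n
      1083274 l l))))) (n 1387304 (n 1596316 (n 516246 (n 831371 (n 1551254 l (n 437304 l (n 916288 l l))) (n
      997368 l (n 1279311 l (n 712252 l l)))) (n 634339 (n 478340 l (n 1110304 l (n 641324 l l))) (n 512233 l (n
      1110304 l (n 1256299 l (n 954314 l l)))))) (n 1238271 (n 893299 (n 942307 l (n 1236254 l l)) (n 1844369 l (n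
      1829352 l (n 1875249 l l)))) (n 1601289 (n 733277 l (n 824318 l (n 747292 l l))) (n 221239 l (n 955311 l (n
      315310 l l)))))) (n 1237260 (n 1646329 (n 1289262 l l) (n 1346330 (n 297356 (n 739344 l (n 1648357 l l)) (n
      1769235 l (n 705254 l (n 2165323 l l)))) (n 930309 (n 1633332 l (n 928289 l l)) (n 479365 l (n 441366 l (n
      917308 l l)))))) (n 811299 (n 1448301 (n 1266293 l (n 263259 l (n 786300 l l))) (n 1626274 l (n 1243314 l (n
      1752348 l l)))) (n 2178340 (n 1424305 l (n 360300 l (n 915289 l l))) (n 1253291 l (n 1453337 l (n 1297339 l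
      (n 602279 l l)))))))))), (1967322, (p (n 1266296 l (n 1745288 l (n 212262 l l))) (n 1450315 (n 1266295 l (n
      775309 l (n 277288 l (n 618311 l l)))) (n 1257319 l (n 57262 l l))) (n 394276 (n 1287270 (n 399298 l (n
      410290 l (n 1281312 l l))) (n 660324 (n 774298 l (n 11294 l l)) (n 1503334 l (n 929297 l (n 1280308 l l)))))
      (n 476318 (n 775309 l (n 744277 l (n 775311 l l))) (n 1110296 l (n 1110298 l (n 787312 l (n 443290 l
      l))))))))]) ?_ ?_
  · intro a b c
    simp only [tip, Set.mem_ofPred_eq, Bool.and_eq_true, Bool.or_eq_true, blt_iff, ble_iff, beq_iff, nandL_iff, cor0,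
      cor5, cor10, cor15, and_false, or_false, not_false_eq_true, and_true]
    omega
  · decide +kernel

theorem cert_tip16_10 : HFS (tip 16 10) 0 := by
  refine HFS.ofT (p := fun a b c => (Nat.ble 1 b && Nat.blt (a + b + c) 17) || (Nat.beq b 0 && (Nat.ble a 16 && Nat.ble c (16 - a) && Nat.blt (16 - a) 4)))
    ([(941294, (p (n 930299 (n 1266308 (n 387273 l l) (n 1253308 l l)) (n 1211259 (n 1096278 l l) (n 1551287 l (n
      251259 l l)))) (n 1434302 (n 1251274 (n 1232339 l l) (n 1243314 l (n 1570336 l l))) (n 1267308 l (n 605274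
      (n 96219 l (n 802283 l l)) (n 943295 l (n 1276293 l l))))) (n 927289 (n 1496292 (n 1292298 (n 944322 (n
      248245 (n 699326 l (n 1268314 l l)) (n 1784276 l (n 1616288 l (n 1634332 l l)))) (n 1584358 (n 379243 l (n
      217322 l (n 888272 l l))) (n 1133251 l (n 1450316 l (n 1607330 l l))))) (n 930307 (n 1243316 (n 538273 (n
      845229 l (n 1425321 l l)) (n 1445279 l (n 387305 l (n 1594321 l l)))) (n 930303 (n 748292 l (n 1265292 l l))
      (n 1550280 l (n 897244 l l)))) (n 1422291 l l))) (n 915286 (n 945301 (n 1601336 (n 578261 l (n 1256311 l (n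
      1411321 l (n 683273 l l)))) (n 149216 l (n 747272 l l))) (n 1473315 (n 488283 l (n 787298 l (n 1773318 l
      l))) (n 493294 l (n 1307322 l (n 621300 l l))))) (n 763295 (n 937283 (n 1990337 l (n 447262 l l)) (n 1255309
      l (n 471256 l (n 1084298 l l)))) (n 942296 (n 1962360 l (n 1408304 l l)) (n 1661340 l (n 1311336 l (n
      1296327 l l))))))) (n 1720322 l (n 1043289 l (n 627276 l (n 1941343 l l))))))), (1838346, (q 892292 (p (n
      392268 (n 1439316 l (n 749294 l l)) (n 1086295 l (n 130288 l (n 1216281 l l)))) (n 1253295 (n 1557295 (n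
      1282314 (n 905287 l (n 674346 l l)) (n 1633326 l (n 1455339 l l))) (n 1635338 l (n 420280 l l))) (n 1909313
      (n 226274 l (n 1982320 l (n 1307317 l l))) (n 704260 l (n 486288 l (n 1616314 l (n 1691296 l l)))))) (n
      1558298 (n 1370269 (n 542275 (n 1074286 l (n 1480330 l (n 1569285 l (n 1113314 l l)))) (n 1054259 (n 745280
      l (n 354244 l l)) (n 1128324 l (n 956317 l l)))) (n 799312 (n 1229289 l (n 1460310 l (n 1813321 l (n 1291312
      l l)))) (n 762298 l (n 249283 l (n 1700272 l (n 1686336 l (n 590296 l l))))))) (n 2071304 (n 1112311 (n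
      706264 l (n 529275 l (n 1642314 l (n 1295319 l l)))) (n 1297339 (n 1672349 l (n 747288 l l)) (n 615296 l (n
      291313 l l)))) (n 407275 (n 799294 l (n 1292312 (n 1479329 l (n 1948345 l (n 814314 l l))) (n 628290 l (n
      570282 l l)))) (n 902288 l (n 1694298 l (n 1240300 l l))))))) (p (n 677251 (n 1452326 l l) (n 914287 l (n
      1596309 l l))) (n 743265 (n 2010345 l (n 1314282 l (n 688306 l l))) (n 534256 (n 1316297 l (n 1598333 l (n
      914282 l l))) (n 1225287 (n 913281 l (n 453316 l (n 1665291 l (n 889286 l l)))) (n 746289 l (n 1603300 l (n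
      574283 l (n 1631310 l l))))))) (n 606294 (n 1471308 l (n 1797319 l l)) (n 776315 (n 1632316 (n 917301 (n
      784298 (n 623307 l (n 1199283 l (n 47288 l l))) (n 971307 (n 2196318 l l) (n 735294 l (n 1451307 l (n
      1292305 l l))))) (n 199281 l (n 1064314 l l))) (n 1549280 (n 1315299 l (n 1746296 l l)) (n 692266 l (n
      1097297 l (n 642296 l l))))) (n 1255302 (n 365241 l (n 914284 l (n 908314 l l))) (n 1252285 (n 1450315 (n
      698298 l (n 745279 l (n 469273 l (n 1125315 l l)))) (n 192301 (n 951279 l (n 1240284 l l)) (n 1291292 l (n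
      1370268 l l)))) (n 1888280 (n 379255 l (n 709288 l (n 357285 l (n 1472290 l l)))) (n 931310 l l))))))))),
      (1258310, (p (n 331334 (n 1373274 l l) (n 139325 l (n 1202240 l l))) (n 475325 (n 928292 (n 1086296 l l) (n
      901278 (n 477315 l (n 969324 l l)) (n 1111306 l (n 577276 l (n 1449316 l l))))) (n 1701250 (n 1372235 l (n
      46255 l (n 905278 l (n 915287 l l)))) (n 984340 l (n 308335 l (n 231287 l l))))) (n 1750298 (n 1745279 (n
      2146328 (n 944315 l (n 880262 l (n 1217264 l (n 585276 l l)))) (n 769309 (n 1448312 l (n 786324 l l)) (n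
      1385244 l (n 313365 l l)))) (n 881259 (n 1254290 l (n 1381257 l (n 1607309 l (n 708250 l l)))) (n 1461322 (n
      1708258 l (n 1602303 l l)) (n 916288 l (n 415286 l l))))) (n 784296 (n 387255 (n 709260 l (n 786292 l l)) (n
      1083294 l (n 762286 l l))) (n 1186256 (n 1251292 (n 303307 l (n 1727290 l (n 1748298 l l))) (n 1071281 l (n
      1412294 l (n 378248 l l)))) (n 915287 (n 903278 l (n 1154332 l (n 145291 l l))) (n 956306 l (n 1888289 l (n
      463300 l (n 192249 l l))))))))))]) ?_ ?_
  · intro a b c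
    simp only [tip, Set.mem_ofPred_eq, Bool.and_eq_true, Bool.or_eq_true, blt_iff, ble_iff, beq_iff, nandL_iff, cor0,
      cor5, cor10, cor15, and_false, or_false, not_false_eq_true, and_true]
    omega
  · decide +kernel

theorem cert_tip16_15 : HFS (tip 16 15) 0 := by
  refine HFS.ofT (p := fun a b c => (Nat.ble 1 b && Nat.blt (a + b + c) 17) || (Nat.beq b 0 && (Nat.ble a 16 && Nat.ble c (16 - a) && Nat.blt (16 - a) 5)))
    ([(639299, (q 399291 (p (n 1734318 (n 901281 (n 953294 l l) (n 1578307 l l)) (n 412262 (n 929288 l l) (n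
      1960347 l (n 789294 l l)))) (n 393255 (n 1409317 (n 1317314 (n 748284 l (n 1409304 l l)) (n 616275 l (n
      879273 l (n 1670345 l l)))) (n 929287 l (n 1687346 l l))) (n 770285 (n 310284 l (n 1812325 l (n 535251 l
      l))) (n 1635327 (n 563279 l l) (n 983309 l (n 539263 l l))))) (n 1239309 (n 571270 (n 990306 (n 1253308 l (n
      691262 l (n 656277 l l))) (n 966302 l (n 1398303 l (n 1423315 l l)))) (n 602278 (n 1235293 (n 473267 (n
      1425326 l (n 799283 l (n 446256 l l))) (n 982307 (n 1673343 (n 1253302 l (n 2181364 l l)) (n 1629317 l (n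
      969302 l (n 369254 l l)))) (n 463283 l (n 808276 l (n 927285 (n 1579312 l (n 712294 l l)) (n 1062297 l (n
      917293 l l))))))) (n 1662343 (n 1455325 l (n 1619330 l l)) (n 956292 l (n 944295 l (n 1447320 l l))))) (n
      2005337 (n 1585331 (n 1739318 (n 1539289 l (n 1291305 l (n 122282 l (n 773296 l l)))) (n 1547282 l (n 946303
      l (n 602282 l (n 1497311 l l))))) (n 1294315 l (n 1455344 l l))) (n 1409302 (n 76276 (n 2030294 l (n 693259
      l l)) (n 943304 l (n 776309 l l))) (n 745278 l (n 1394302 (n 890282 l (n 1289308 l l)) (n 1227299 l (n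
      615282 l l)))))))) (n 774272 l (n 1436326 l (n 1295316 l (n 1839361 l l)))))) (p (n 399306 (n 733282 l l) (n
      1461299 l (n 889277 l l))) (n 386304 (n 1764323 (n 647326 (n 2102315 l l) (n 1621325 l l)) (n 456259 (n
      1590297 l l) (n 711295 l (n 634318 l l)))) (n 907335 (n 1613266 (n 680254 l (n 707276 l l)) (n 442248 l (n
      1889277 l (n 1284325 l l)))) (n 1097288 l (n 1279292 l l)))) (n 1245325 (n 717266 (n 1413318 (n 1246326 (n
      1041251 (n 1793348 l (n 1981321 l (n 601280 l l))) (n 1632319 l (n 641297 l (n 801320 l l)))) (n 1255303 l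
      (n 1474307 l (n 1435295 l (n 19268 l l))))) (n 983320 l (n 846242 l l))) (n 451317 (n 255289 l (n 1753321 (n
      796295 (n 943304 l l) (n 499303 l (n 1073297 l (n 2007316 l l)))) (n 1139315 (n 1933321 l (n 1422301 l l))
      (n 1086302 l (n 560263 l l))))) (n 290294 l (n 470292 l l)))) (n 917305 (n 606308 (n 801311 (n 1593320 l (n
      577273 l (n 745274 l l))) (n 315261 l (n 192293 l (n 980297 l l)))) (n 657318 (n 553291 l (n 1138314 l (n
      1243317 l l))) (n 955306 l (n 1240282 l (n 1277280 l l))))) (n 482252 (n 960361 (n 1760295 l (n 918317 l (n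
      465339 l l))) (n 1109275 l (n 759286 l (n 964257 l l)))) (n 1294320 (n 732276 (n 816348 l (n 800318 l (n
      1097290 l l))) (n 759290 l (n 615285 l (n 1257323 l l)))) l))))))), (1322337, (p (n 1399293 l l) (n 253285
      (n 745282 l (n 1046280 l l)) (n 968313 (n 1685320 l (n 926294 l (n 1399294 l l))) (n 1478322 l (n 2010338 l
      (n 182248 l (n 1228281 l l)))))) (n 644315 (n 1265302 (n 1230294 (n 790308 l (n 594297 l l)) (n 605299 l (n
      1411298 l (n 1645310 l l)))) (n 1459319 (n 1564295 l (n 244277 l (n 907292 l l))) (n 367248 l (n 864264 l (n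
      1267306 l l))))) (n 785308 (n 1460308 (n 787310 l (n 1109298 l l)) (n 541269 l (n 562276 l (n 772301 l l))))
      (n 787312 (n 1825327 l (n 718275 l l)) (n 1542265 l (n 1243288 l (n 600296 l (n 810324 l l))))))))),
      (1719290, (p (n 996349 (n 1961329 l l) (n 939296 l (n 1072276 l l))) (n 619320 (n 1111309 (n 478324 l (n
      871246 l l)) (n 1201248 l (n 281300 l (n 1581290 l l)))) (n 1216261 (n 1085287 l (n 1557258 l l)) (n 881274
      l (n 919303 l (n 939290 l l))))) (n 1496312 (n 889270 l (n 1335353 l l)) (n 888265 (n 1753295 (n 1970337 (n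
      543249 (n 953326 l (n 954329 l l)) (n 1667354 l (n 1429295 l (n 1083284 l (n 942311 l l))))) (n 941309 l l))
      (n 1421286 (n 1791328 l (n 2154348 l (n 725287 l (n 1435297 l l)))) (n 1110308 (n 1474329 l (n 202253 l l))
      (n 1114314 l (n 410280 l l))))) (n 918292 (n 1305331 (n 938299 l (n 759293 l (n 1715267 l l))) (n 1279312 l
      (n 1253293 l (n 581278 l l)))) (n 1630316 (n 1283318 l (n 620325 l (n 875259 l l))) (n 1086295 (n 285318 l
      (n 588291 l (n 1616308 l l))) (n 930299 l (n 1327319 l (n 1605309 l (n 1066268 l l)))))))))))]) ?_ ?_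
  · intro a b c
    simp only [tip, Set.mem_ofPred_eq, Bool.and_eq_true, Bool.or_eq_true, blt_iff, ble_iff, beq_iff, nandL_iff, cor0,
      cor5, cor10, cor15, and_false, or_false, not_false_eq_true, and_true]
    omega
  · decide +kernel

end TD
end

section
namespace TD

theorem mem_shift (S : Set E) (t1 t2 t3 a b c : ℕ) :
    (a, b, c) ∈ {x : E | ∃ y ∈ S, x = y + (t1, t2, t3)} ↔
      t1 ≤ a ∧ t2 ≤ b ∧ t3 ≤ c ∧ (a - t1, b - t2, c - t3) ∈ S := by
  constructor
  · rintro ⟨⟨x, y, z⟩, h, e⟩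
    simp only [Prod.mk_add_mk, Prod.mk.injEq] at e
    obtain ⟨rfl, rfl, rfl⟩ := e
    simpa using h
  · rintro ⟨h1, h2, h3, h⟩
    refine ⟨_, h, ?_⟩
    simp [h1, h2, h3]

theorem HBS.glue {S S1 S2 : Set E} {M N : ℕ} (H1 : HBS S1 M) (H2 : HBS S2 N) (u1 u2 u3 t1 t2 t3 : ℕ)
    (w1 w2 w3 k : ℤ) (hw : (w1, w2, w3) ≠ 0)
    (hS : ∀ a b c, (a, b, c) ∈ S ↔ (u1 ≤ a ∧ u2 ≤ b ∧ u3 ≤ c ∧ (a - u1, b - u2, c - u3) ∈ S1) ∨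
      (t1 ≤ a ∧ t2 ≤ b ∧ t3 ≤ c ∧ (a - t1, b - t2, c - t3) ∈ S2))
    (h1 : ∀ a b c : ℕ, u1 ≤ a ∧ u2 ≤ b ∧ u3 ≤ c ∧ (a - u1, b - u2, c - u3) ∈ S1 → w1 * a + w2 * b + w3 * c < k)
    (h2 : ∀ a b c : ℕ, t1 ≤ a ∧ t2 ≤ b ∧ t3 ≤ c ∧ (a - t1, b - t2, c - t3) ∈ S2 → k ≤ w1 * a + w2 * b + w3 * c) :
    HBS S (M + N) := by
  refine HBS.cut (w1, w2, w3) k (H1.shift (u1, u2, u3) rfl) (H2.shift (t1, t2, t3) rfl) hw ?_ ?_ ?_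
  · ext ⟨a, b, c⟩
    rw [Set.mem_union, mem_shift, mem_shift, hS]
  · rintro ⟨a, b, c⟩ h
    exact h1 a b c ((mem_shift _ _ _ _ _ _ _).1 h)
  · rintro ⟨a, b, c⟩ h
    exact h2 a b c ((mem_shift _ _ _ _ _ _ _).1 h)

theorem HFS.glue {S S1 S2 : Set E} {M N : ℕ} (H1 : HBS S1 M) (H2 : HFS S2 N) (u1 u2 u3 t1 t2 t3 : ℕ)
    (w1 w2 w3 k : ℤ) (hw : (w1, w2, w3) ≠ 0)
    (hS : ∀ a b c, (a, b, c) ∈ S ↔ (u1 ≤ a ∧ u2 ≤ b ∧ u3 ≤ c ∧ (a - u1, b - u2, c - u3) ∈ S1) ∨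
      (t1 ≤ a ∧ t2 ≤ b ∧ t3 ≤ c ∧ (a - t1, b - t2, c - t3) ∈ S2))
    (h1 : ∀ a b c : ℕ, u1 ≤ a ∧ u2 ≤ b ∧ u3 ≤ c ∧ (a - u1, b - u2, c - u3) ∈ S1 → w1 * a + w2 * b + w3 * c < k)
    (h2 : ∀ a b c : ℕ, t1 ≤ a ∧ t2 ≤ b ∧ t3 ≤ c ∧ (a - t1, b - t2, c - t3) ∈ S2 → k ≤ w1 * a + w2 * b + w3 * c) :
    HFS S (M + N) := by
  refine HFS.cut (w1, w2, w3) k (H1.shift (u1, u2, u3) rfl) (H2.shift (t1, t2, t3) rfl) hw ?_ ?_ ?_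
  · ext ⟨a, b, c⟩
    rw [Set.mem_union, mem_shift, mem_shift, hS]
  · rintro ⟨a, b, c⟩ h
    exact h1 a b c ((mem_shift _ _ _ _ _ _ _).1 h)
  · rintro ⟨a, b, c⟩ h
    exact h2 a b c ((mem_shift _ _ _ _ _ _ _).1 h)

theorem box4_coe : (((Finset.range 10) ×ˢ (Finset.range 4) ×ˢ (Finset.range 4) : Finset E) : Set E) = box4 := by
  ext ⟨a, b, c⟩
  simp [box4]

theorem box4_8 : HBS box4 8 := ⟨_, box4_coe, HB.of_mix cert_mix (by simp)⟩
theorem box4_0 : HBS box4 0 := ⟨_, box4_coe, HB.pure_of_mix (by norm_num) cert_mix (by simp)⟩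

theorem col_mix (L : ℕ) : ∀ j, Even L → 14 ≤ L → 13 + 4 * j ≤ L → HBS (col L) (8 * j) := by
  induction L using Nat.strong_induction_on with
  | _ L ih =>
    intro j he h14 hj
    obtain rfl | rfl | h18 : L = 14 ∨ L = 16 ∨ 18 ≤ L := by rcases he with ⟨t, rfl⟩; omega
    · obtain rfl : j = 0 := by omega
      exact cert_top14
    · obtain rfl : j = 0 := by omega
      exact cert_top16
    · have key : ∀ M N, HBS box4 M → HBS (col (L - 4)) N → HBS (col L) (M + N) := by
        intro M N H1 H2
        refine H1.glue H2 0 0 0 0 0 4 0 0 1 4 (by simp) ?_ ?_ ?_ <;> intro a b c <;>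
          simp only [col, box4, Set.mem_ofPred_eq] <;> omega
      have he' : Even (L - 4) := by rcases he with ⟨t, rfl⟩; exact ⟨t - 2, by omega⟩
      rcases j with _ | j
      · exact key 0 0 box4_0 (ih (L - 4) (by omega) 0 he' (by omega) (by omega))
      · have := key 8 (8 * j) box4_8 (ih (L - 4) (by omega) j he' (by omega) (by omega))
        rwa [show 8 * (j + 1) = 8 + 8 * j by ring]

theorem strip_step {n M N : ℕ} (hn : 4 ≤ n) (H1 : HBS (col n) M) (H2 : HBS (strip (n - 4)) N) : HBS (strip n) (M + N) := by
  refine H1.glue H2 0 0 0 0 4 0 0 1 0 4 (by simp) ?_ ?_ ?_ <;> intro a b c <;>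
    simp only [col, strip, Set.mem_ofPred_eq] <;> omega

theorem strip_0 (n : ℕ) : Even n → 10 ≤ n → HBS (strip n) 0 := by
  induction n using Nat.strong_induction_on with
  | _ n ih =>
    intro he h
    obtain rfl | rfl | h14 : n = 10 ∨ n = 12 ∨ 14 ≤ n := by rcases he with ⟨t, rfl⟩; omega
    · exact cert_strip10
    · exact cert_strip12
    · have he' : Even (n - 4) := by rcases he with ⟨t, rfl⟩; exact ⟨t - 2, by omega⟩
      exact strip_step (by omega) (col_mix n 0 he h14 (by omega)) (ih (n - 4) (by omega) he' (by omega))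

theorem strip_48 (n : ℕ) (he : Even n) (h : 38 ≤ n) : HBS (strip n) 48 := by
  have he' : Even (n - 4) := by rcases he with ⟨t, rfl⟩; exact ⟨t - 2, by omega⟩
  exact strip_step (by omega) (col_mix n 6 he (by omega) (by omega)) (strip_0 (n - 4) he' (by omega))

theorem tip_step {n r M N : ℕ} (hn : 20 ≤ n) (H1 : HBS (strip n) M) (H2 : HFS (tip (n - 10) r) N) : HFS (tip n r) (M + N) := by
  refine H2.glue (S := tip n r) H1 0 1 0 10 0 0 1 0 0 10 (by simp) ?_ ?_ ?_ <;> intro a b c <;>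
    simp only [strip, tip, cor, Set.mem_ofPred_eq] <;> omega

theorem slab_step {n r : ℕ} (hn : 14 ≤ n) (H1 : HBS (slab n) 0) (H2 : HFS (tip (n - 4) r) 0) : HFS (tip n r) 0 := by
  refine HFS.glue H1 H2 0 1 0 4 0 0 1 0 0 4 (by simp) ?_ ?_ ?_ <;> intro a b c <;>
    simp only [slab, tip, cor, Set.mem_ofPred_eq] <;> omega

theorem tip_0 (n r : ℕ) (hr : r = 0 ∨ r = 5 ∨ r = 10 ∨ r = 15) : Even n → 10 ≤ n → HFS (tip n r) 0 := by
  have h10 : HFS (tip 10 r) 0 := by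
    rcases hr with rfl | rfl | rfl | rfl
    · exact cert_tip10_0
    · exact cert_tip10_5
    · exact cert_tip10_10
    · exact cert_tip10_15
  have h12 : HFS (tip 12 r) 0 := by
    rcases hr with rfl | rfl | rfl | rfl
    · exact cert_tip12_0
    · exact cert_tip12_5
    · exact cert_tip12_10
    · exact cert_tip12_15
  have h16 : HFS (tip 16 r) 0 := by
    rcases hr with rfl | rfl | rfl | rfl
    · exact cert_tip16_0
    · exact cert_tip16_5
    · exact cert_tip16_10
    · exact cert_tip16_15
  have h14 : HFS (tip 14 r) 0 := slab_step (by norm_num) cert_w14 h10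
  have h18 : HFS (tip 18 r) 0 := slab_step (by norm_num) cert_w18 h14
  induction n using Nat.strong_induction_on with
  | _ n ih =>
    intro he h
    by_cases h20 : 20 ≤ n
    · have he' : Even (n - 10) := by rcases he with ⟨t, rfl⟩; exact ⟨t - 5, by omega⟩
      exact tip_step h20 (strip_0 n he (by omega)) (ih (n - 10) (by omega) he' (by omega))
    · obtain rfl | rfl | rfl | rfl | rfl : n = 10 ∨ n = 12 ∨ n = 14 ∨ n = 16 ∨ n = 18 := by
        rcases he with ⟨t, rfl⟩; omega
      all_goals assumption

theorem tip_48 (n r : ℕ) (hr : r = 0 ∨ r = 5 ∨ r = 10 ∨ r = 15) (he : Even n) (h : 38 ≤ n) : HFS (tip n r) 48 := by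
  have he' : Even (n - 10) := by rcases he with ⟨t, rfl⟩; exact ⟨t - 5, by omega⟩
  exact tip_step (by omega) (strip_48 n he h) (tip_0 (n - 10) r hr he' (by omega))

theorem col5_0 (L : ℕ) : L % 2 = 1 → 13 ≤ L → HBS (col5 L) 0 := by
  induction L using Nat.strong_induction_on with
  | _ L ih =>
    intro he h
    obtain rfl | rfl | h18 : L = 13 ∨ L = 15 ∨ 17 ≤ L := by omega
    · exact cert_t13
    · exact cert_t15
    · refine cert_box854.glue (ih (L - 4) (by omega) (by omega) (by omega)) 0 0 0 0 0 4 0 0 1 4 (by simp) ?_ ?_ ?_ <;>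
        intro a b c <;> simp only [col5, box5, Set.mem_ofPred_eq] <;> omega

theorem wedge_0 (n r : ℕ) : 11 ≤ n → (n % 8 = 3 ∧ r = 10 ∨ n % 8 = 5 ∧ r = 15 ∨ n % 8 = 7 ∧ r = 0 ∨ n % 8 = 1 ∧ r = 5) →
    HBS (wedge n r) 0 := by
  induction n using Nat.strong_induction_on with
  | _ n ih =>
    intro h hr
    by_cases h19 : 19 ≤ n
    · refine (col5_0 n (by omega) (by omega)).glue (ih (n - 8) (by omega) (by omega) (by omega)) 0 0 0 8 0 0 1 0 0 8
        (by simp) ?_ ?_ ?_ <;>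
        intro a b c <;> simp only [col5, wedge, cor, Set.mem_ofPred_eq] <;> omega
    · obtain ⟨rfl, rfl⟩ | ⟨rfl, rfl⟩ | ⟨rfl, rfl⟩ | ⟨rfl, rfl⟩ :
        (n = 11 ∧ r = 10) ∨ (n = 13 ∧ r = 15) ∨ (n = 15 ∧ r = 0) ∨ (n = 17 ∧ r = 5) := by omega
      · exact cert_wedge11
      · exact cert_wedge13
      · exact cert_wedge15
      · exact cert_wedge17

theorem odd_glue (n r : ℕ) (hn : 20 ≤ n) (w1 w2 w3 k : ℤ) (hw : (w1, w2, w3) ≠ 0) (H1 : HBS (wedge n r) 0)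
    (H2 : HFS (tip (n - 5) r) 48)
    (h1 : ∀ a b c : ℕ, (a, b, c) ∈ wedge n r → w1 * a + w2 * b + w3 * c < k)
    (h2 : ∀ a b c : ℕ, (a, b, c) ∈ tip (n - 5) r → k ≤ w1 * a + w2 * (b + 4) + w3 * c) : HFS (simp3 n) 48 := by
  refine HFS.glue (S := simp3 n) (M := 0) (N := 48) H1 H2 0 0 0 0 4 0 w1 w2 w3 k hw ?_ ?_ ?_
  · intro a b c
    simp only [simp3, tip, wedge, cor, Set.mem_ofPred_eq]
    omega
  · intro a b c h
    exact h1 a b c (by simpa using h)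
  · intro a b c h
    obtain ⟨-, hb, -, h⟩ := h
    have := h2 _ _ _ h
    have e : ((b - 4 : ℕ) : ℤ) = b - 4 := by omega
    rw [e] at this
    simpa using this

theorem simp3_48 (n : ℕ) (hn : 42 ≤ n) : HFS (simp3 n) 48 := by
  rcases Nat.even_or_odd n with he | ho
  · refine (tip_48 n 0 (by simp) he (by omega)).unshift (0, 1, 0) ?_
    ext ⟨a, b, c⟩
    rw [mem_shift]
    simp only [simp3, tip, cor, Set.mem_ofPred_eq]
    omega
  · obtain ⟨m, rfl⟩ : ∃ m, n = m + 5 := ⟨n - 5, by omega⟩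
    have hm : Even m := by rcases ho with ⟨t, ht⟩; exact ⟨t - 2, by omega⟩
    have h8 : m % 8 = 6 ∨ m % 8 = 0 ∨ m % 8 = 2 ∨ m % 8 = 4 := by rcases hm with ⟨t, rfl⟩; omega
    rcases h8 with h8 | h8 | h8 | h8
    · -- r = 10
      refine odd_glue (m + 5) 10 (by omega) 1 m 0 (4 * m + m - 3) (by simp)
        (wedge_0 _ _ (by omega) (by omega)) (tip_48 _ _ (by simp) (by simpa using hm) (by omega)) ?_ ?_
      · intro a b c
        simp only [wedge, cor5, cor10, cor15, Set.mem_ofPred_eq]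
        rintro ⟨hb, h⟩
        interval_cases b <;> simp only [true_and, not_and] at h <;> push_cast <;> omega
      · intro a b c
        simp only [tip, cor, Set.mem_ofPred_eq]
        rintro (⟨hb, h⟩ | ⟨rfl, h⟩)
        · have : (m : ℤ) * 1 ≤ m * b := by gcongr; exact_mod_cast hb
          rw [mul_add]; omega
        · push_cast; omega
    · -- r = 15
      refine odd_glue (m + 5) 15 (by omega) 1 m 0 (4 * m + m - 4) (by simp)
        (wedge_0 _ _ (by omega) (by omega)) (tip_48 _ _ (by simp) (by simpa using hm) (by omega)) ?_ ?_
      · intro a b c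
        simp only [wedge, cor5, cor10, cor15, Set.mem_ofPred_eq]
        rintro ⟨hb, h⟩
        interval_cases b <;> simp only [true_and, not_and] at h <;> push_cast <;> omega
      · intro a b c
        simp only [tip, cor, Set.mem_ofPred_eq]
        rintro (⟨hb, h⟩ | ⟨rfl, h⟩)
        · have : (m : ℤ) * 1 ≤ m * b := by gcongr; exact_mod_cast hb
          rw [mul_add]; omega
        · push_cast; omega
    · -- r = 0
      refine odd_glue (m + 5) 0 (by omega) 0 1 0 5 (by simp)
        (wedge_0 _ _ (by omega) (by omega)) (tip_48 _ _ (by simp) (by simpa using hm) (by omega)) ?_ ?_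
      · intro a b c
        simp only [wedge, cor, Set.mem_ofPred_eq]
        omega
      · intro a b c
        simp only [tip, cor, Set.mem_ofPred_eq]
        omega
    · -- r = 5
      refine odd_glue (m + 5) 5 (by omega) 2 (4 * m) (-1) (16 * m + 2 * m - 5) (by simp)
        (wedge_0 _ _ (by omega) (by omega)) (tip_48 _ _ (by simp) (by simpa using hm) (by omega)) ?_ ?_
      · intro a b c
        simp only [wedge, cor5, cor10, cor15, Set.mem_ofPred_eq]
        rintro ⟨hb, h⟩
        interval_cases b <;> simp only [true_and, not_and] at h <;> push_cast <;> omega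
      · intro a b c
        simp only [tip, cor, Set.mem_ofPred_eq]
        rintro (⟨hb, h⟩ | ⟨rfl, h⟩)
        · have : (m : ℤ) * 1 ≤ m * b := by gcongr; exact_mod_cast hb
          rw [mul_add, mul_assoc]; omega
        · push_cast; omega

/-- The combinatorial main theorem. -/
theorem simp3_main (n : ℕ) (hn : 42 ≤ n) :
    ∃ D : Finset E, (∀ a b c, (a, b, c) ∈ D ↔ a + b + c < n) ∧ Has D (FinF D.card) := by
  obtain ⟨D, e, H⟩ := simp3_48 n hn
  refine ⟨D, ?_, H.final le_rfl⟩
  intro a b c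
  rw [← Finset.mem_coe, e]
  rfl

end TD
end

section
namespace TD

/-- Rational falling factorials. -/
def fq (r : ℚ) : ℕ → ℚ
  | 0 => 1
  | k + 1 => (r - k) * fq r k

theorem fq_nat (n k : ℕ) : fq n k = (n.descFactorial k : ℚ) := by
  induction k with
  | zero => simp [fq]
  | succ k ih =>
    rw [fq, ih, Nat.descFactorial_succ]
    by_cases h : k ≤ n
    · push_cast [Nat.cast_sub h]; ring
    · rw [Nat.descFactorial_eq_zero_iff_lt.2 (not_le.1 h)]; simp

theorem Pol.fx {m : ℕ} {g : E → ℚ} (h : Pol m g) (k : ℕ) : Pol (m + k) (fun a => fq a.1 k * g a) := by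
  induction k with
  | zero => simpa [fq] using h
  | succ k ih =>
    have := Pol.add (Pol.mulx ih) (ih.smul (-k)).succ
    rw [← Nat.add_assoc]
    convert this using 1
    funext a
    simp only [fq]; ring

theorem Pol.fy {m : ℕ} {g : E → ℚ} (h : Pol m g) (k : ℕ) : Pol (m + k) (fun a => fq a.2.1 k * g a) := by
  induction k with
  | zero => simpa [fq] using h
  | succ k ih =>
    have := Pol.add (Pol.muly ih) (ih.smul (-k)).succ
    rw [← Nat.add_assoc]
    convert this using 1
    funext a
    simp only [fq]; ring

theorem Pol.fz {m : ℕ} {g : E → ℚ} (h : Pol m g) (k : ℕ) : Pol (m + k) (fun a => fq a.2.2 k * g a) := by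
  induction k with
  | zero => simpa [fq] using h
  | succ k ih =>
    have := Pol.add (Pol.mulz ih) (ih.smul (-k)).succ
    rw [← Nat.add_assoc]
    convert this using 1
    funext a
    simp only [fq]; ring

theorem Pol.fo {m : ℕ} {g : E → ℚ} (h : Pol m g) (d k : ℕ) :
    Pol (m + k) (fun a => fq ((d : ℚ) - a.1 - a.2.1 - a.2.2) k * g a) := by
  induction k with
  | zero => simpa [fq] using h
  | succ k ih =>
    have := Pol.add (Pol.add ((Pol.mulx ih).smul (-1)) ((Pol.muly ih).smul (-1)))
      (Pol.add ((Pol.mulz ih).smul (-1)) (ih.smul ((d : ℚ) - k)).succ)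
    rw [← Nat.add_assoc]
    convert this using 1
    funext a
    simp only [fq]; ring

/-- Products of falling factorials. -/
def fall (ν : E) (a : E) : ℚ := fq a.1 ν.1 * (fq a.2.1 ν.2.1 * fq a.2.2 ν.2.2)

/-- The relevant indices. -/
def FI (m : ℕ) : Finset E := {ν ∈ Finset.range m ×ˢ Finset.range m ×ˢ Finset.range m | ν.1 + ν.2.1 + ν.2.2 < m}

theorem mem_FI (m : ℕ) (ν : E) : ν ∈ FI m ↔ ν.1 + ν.2.1 + ν.2.2 < m := by
  simp only [FI, Finset.mem_filter, Finset.mem_product, Finset.mem_range]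
  omega

theorem Pol_fall (m : ℕ) (ν : E) (h : ν.1 + ν.2.1 + ν.2.2 < m) : Pol m (fall ν) := by
  have := (((Pol.const 0 1).fz ν.2.2).fy ν.2.1).fx ν.1
  simp only [mul_one] at this
  exact this.mono (by omega)

/-- The span of the falling factorials of degree `< m`. -/
def SF (m : ℕ) : Submodule ℚ (E → ℚ) := Submodule.span ℚ (fall '' {ν | ν.1 + ν.2.1 + ν.2.2 < m})

theorem fall_mem {m : ℕ} {ν : E} (h : ν.1 + ν.2.1 + ν.2.2 < m) : fall ν ∈ SF m :=
  Submodule.subset_span ⟨ν, h, rfl⟩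

theorem SF_mul {m : ℕ} {g X : E → ℚ} (hg : g ∈ SF m)
    (hX : ∀ ν : E, ν.1 + ν.2.1 + ν.2.2 < m → (fun a => X a * fall ν a) ∈ SF (m + 1)) :
    (fun a => X a * g a) ∈ SF (m + 1) := by
  unfold SF at hg
  induction hg using Submodule.span_induction with
  | mem x h => obtain ⟨ν, hν, rfl⟩ := h; exact hX ν hν
  | zero => simp only [Pi.zero_apply, mul_zero]; exact Submodule.zero_mem _
  | add x y _ _ hx hy =>
    simp only [Pi.add_apply, mul_add]
    exact Submodule.add_mem _ hx hy
  | smul r x _ hx =>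
    have := Submodule.smul_mem _ r hx
    convert this using 1
    funext a
    simp only [Pi.smul_apply, smul_eq_mul]
    ring

theorem Pol.mem_SF {m : ℕ} {g : E → ℚ} (h : Pol m g) : g ∈ SF m := by
  induction h with
  | const m c =>
    have := Submodule.smul_mem _ c (fall_mem (m := m + 1) (ν := (0, 0, 0)) (by simp))
    convert this using 1
    funext a
    simp [fall, fq]
  | add _ _ ih1 ih2 => exact Submodule.add_mem _ ih1 ih2
  | @mulx m g _ ih =>
    refine SF_mul ih fun ν hν => ?_
    have h1 := fall_mem (m := m + 1) (ν := (ν.1 + 1, ν.2.1, ν.2.2)) (by simp only; omega)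
    have h2 := Submodule.smul_mem _ (ν.1 : ℚ) (fall_mem (m := m + 1) (ν := ν) (by omega))
    convert Submodule.add_mem _ h1 h2 using 1
    funext a
    simp only [fall, fq, Pi.add_apply, Pi.smul_apply, smul_eq_mul]
    ring
  | @muly m g _ ih =>
    refine SF_mul ih fun ν hν => ?_
    have h1 := fall_mem (m := m + 1) (ν := (ν.1, ν.2.1 + 1, ν.2.2)) (by simp only; omega)
    have h2 := Submodule.smul_mem _ (ν.2.1 : ℚ) (fall_mem (m := m + 1) (ν := ν) (by omega))
    convert Submodule.add_mem _ h1 h2 using 1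
    funext a
    simp only [fall, fq, Pi.add_apply, Pi.smul_apply, smul_eq_mul]
    ring
  | @mulz m g _ ih =>
    refine SF_mul ih fun ν hν => ?_
    have h1 := fall_mem (m := m + 1) (ν := (ν.1, ν.2.1, ν.2.2 + 1)) (by simp only; omega)
    have h2 := Submodule.smul_mem _ (ν.2.2 : ℚ) (fall_mem (m := m + 1) (ν := ν) (by omega))
    convert Submodule.add_mem _ h1 h2 using 1
    funext a
    simp only [fall, fq, Pi.add_apply, Pi.smul_apply, smul_eq_mul]
    ring

variable {D : Finset E}

/-- The conditions of a fat point. -/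
noncomputable def cond (D : Finset E) (q : ℕ × Pt) : (D → ℚ) →ₗ[ℚ] (FI q.1 → ℚ) where
  toFun c ν := ∑ a : D, c a * (fall ν a * mon q.2 a)
  map_add' c c' := by funext ν; simp [add_mul, Finset.sum_add_distrib]
  map_smul' r c := by funext ν; simp [mul_assoc, Finset.mul_sum]

theorem cond_iff (q : ℕ × Pt) (c : D → ℚ) :
    cond D q c = 0 ↔ ∀ g, Pol q.1 g → ∑ a : D, c a * (g a * mon q.2 a) = 0 := by
  constructor
  · intro h g hg
    replace hg := hg.mem_SF
    unfold SF at hg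
    induction hg using Submodule.span_induction with
    | mem x hx =>
      obtain ⟨ν, hν, rfl⟩ := hx
      exact congrFun h ⟨ν, (mem_FI _ _).2 hν⟩
    | zero => simp
    | add x y _ _ hx hy =>
      simp only [Pi.add_apply, add_mul, mul_add, Finset.sum_add_distrib, hx, hy, add_zero]
    | smul r x _ hx =>
      have : ∑ a : D, c a * ((r • x) a * mon q.2 a) = r * ∑ a : D, c a * (x a * mon q.2 a) := by
        rw [Finset.mul_sum]
        refine Finset.sum_congr rfl fun a _ => ?_
        simp only [Pi.smul_apply, smul_eq_mul]; ring
      rw [this, hx, mul_zero]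
  · intro h
    funext ν
    exact h _ (Pol_fall _ _ ((mem_FI _ _).1 ν.2))

/-- The coefficient vectors satisfying all conditions. -/
noncomputable def KK (D : Finset E) : List (ℕ × Pt) → Submodule ℚ (D → ℚ)
  | [] => ⊤
  | q :: L => KK D L ⊓ LinearMap.ker (cond D q)

theorem mem_KK (L : List (ℕ × Pt)) (c : D → ℚ) : c ∈ KK D L ↔ ∀ q ∈ L, cond D q c = 0 := by
  induction L with
  | nil => simp [KK]
  | cons q L ih => simp [KK, ih, and_comm]

theorem KK_cons (q : ℕ × Pt) (L : List (ℕ × Pt)) :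
    Module.finrank ℚ (KK D L) ≤ Module.finrank ℚ (KK D (q :: L)) + (FI q.1).card := by
  have h := LinearMap.finrank_range_add_finrank_ker ((cond D q).domRestrict (KK D L))
  have h1 : Module.finrank ℚ (LinearMap.range ((cond D q).domRestrict (KK D L))) ≤ (FI q.1).card := by
    refine (Submodule.finrank_le _).trans ?_
    simp
  have h2 : Module.finrank ℚ (LinearMap.ker ((cond D q).domRestrict (KK D L))) =
      Module.finrank ℚ (KK D (q :: L)) := by
    rw [LinearMap.ker_domRestrict]
    have := Submodule.finrank_map_subtype_eq (KK D L) ((LinearMap.ker (cond D q)).comap (KK D L).subtype)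
    rw [Submodule.map_comap_subtype] at this
    exact this.symm
  omega

theorem KK_append (L1 L2 : List (ℕ × Pt)) :
    Module.finrank ℚ (KK D L2) ≤ Module.finrank ℚ (KK D (L1 ++ L2)) + ((L1.map Prod.fst).map fun m => (FI m).card).sum := by
  induction L1 with
  | nil => simp
  | cons q L1 ih =>
    have := KK_cons (D := D) q (L1 ++ L2)
    simp only [List.cons_append, List.map_cons, List.sum_cons]
    omega

theorem KK_zero (L : List (ℕ × Pt)) (h : Inj D (L : Multiset (ℕ × Pt))) : Module.finrank ℚ (KK D L) = 0 := by
  have : KK D L = ⊥ := by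
    rw [Submodule.eq_bot_iff]
    intro c hc
    rw [mem_KK] at hc
    have := h (fun a => if ha : a ∈ D then c ⟨a, ha⟩ else 0) (by
      intro q hq g hg
      rw [← (cond_iff q c).1 (hc q (by simpa using hq)) g hg, ← Finset.sum_coe_sort D]
      refine Finset.sum_congr rfl fun a _ => ?_
      simp)
    funext a
    simpa using this a a.2
  rw [this, finrank_bot]

theorem KK_nil : Module.finrank ℚ (KK D []) = D.card := by
  rw [KK, finrank_top]; simp

theorem exists_list (ms : List ℕ) : ∀ l : Multiset (ℕ × Pt), l.map Prod.fst = (ms : Multiset ℕ) →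
    ∃ L : List (ℕ × Pt), (L : Multiset (ℕ × Pt)) = l ∧ L.map Prod.fst = ms := by
  induction ms with
  | nil =>
    intro l h
    refine ⟨[], ?_, rfl⟩
    have : l = 0 := by simpa using h
    simp [this]
  | cons m ms ih =>
    intro l h
    rw [← Multiset.cons_coe, ← Multiset.map_eq_cons] at h
    obtain ⟨q, hq, rfl, h⟩ := h
    obtain ⟨L, hL, hm⟩ := ih _ h
    refine ⟨q :: L, ?_, by simp [hm]⟩
    rw [← Multiset.cons_coe, hL, Multiset.cons_erase hq]

/-- Both bounds for the dimension of the space of coefficient vectors. -/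
theorem exists_points (H : Has D (FinF D.card)) (x y z : ℕ) :
    ∃ L : List (ℕ × Pt), L.map Prod.fst = List.replicate x 4 ++ List.replicate y 3 ++ List.replicate z 2 ∧
      (L.map Prod.snd).Nodup ∧ (∀ q ∈ L, NZ q.2) ∧
      (Module.finrank ℚ (KK D L) : ℤ) = max ((D.card : ℤ) - (20 * x + 10 * y + 4 * z)) 0 := by
  have c4 : (FI 4).card = 20 := by decide
  have c3 : (FI 3).card = 10 := by decide
  have c2 : (FI 2).card = 4 := by decide
  have c1 : (FI 1).card = 1 := by decide
  obtain ⟨z', s, hs, hc⟩ : ∃ z' s, (x, y, z + z', s) ∈ FinF D.card ∧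
      (4 * z' + s : ℤ) = max ((D.card : ℤ) - (20 * x + 10 * y + 4 * z)) 0 := by
    by_cases h : D.card ≤ 20 * x + 10 * y + 4 * z
    · exact ⟨0, 0, Or.inl ⟨rfl, by simpa using h⟩, by omega⟩
    · refine ⟨(D.card - (20 * x + 10 * y + 4 * z)) / 4, (D.card - (20 * x + 10 * y + 4 * z)) % 4, Or.inr ⟨?_, ?_⟩, ?_⟩
      · simp only; omega
      · simp only; omega
      · omega
  obtain ⟨l, h1, h2, h3, h4⟩ := H _ hs
  obtain ⟨L, rfl, hL⟩ := exists_list ((List.replicate z' 2 ++ List.replicate s 1) ++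
    (List.replicate x 4 ++ List.replicate y 3 ++ List.replicate z 2)) l (by
      rw [h1]
      simp only [Ms, Multiset.replicate_add, ← Multiset.coe_add, Multiset.coe_replicate]
      abel)
  obtain ⟨L1, L2, rfl, e1, e2⟩ := List.map_eq_append_iff.1 hL
  have h0 := KK_zero _ h4
  have b1 := KK_append (D := D) L1 L2
  have b2 := KK_append (D := D) L2 []
  rw [KK_nil, List.append_nil, e2] at b2
  rw [h0, e1] at b1
  simp only [List.map_append, List.map_replicate, List.sum_append, List.sum_replicate, smul_eq_mul, c1, c2, c3, c4] at b1 b2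
  refine ⟨L2, e2, ?_, ?_, ?_⟩
  · rw [Multiset.map_coe, Multiset.coe_nodup, List.map_append] at h2
    exact h2.of_append_right
  · intro q hq
    exact h3 q (by simp [hq])
  · omega

end TD
end

namespace TD

theorem pderiv_pow (i : Fin 4) (k : ℕ) (s : Fin 4 →₀ ℕ) (c : ℚ) :
    ((pderiv i).toLinearMap ^ k : Module.End ℚ (MvPolynomial (Fin 4) ℚ)) (monomial s c) =
      monomial (s - Finsupp.single i k) (c * (s i).descFactorial k) := by
  induction k with
  | zero => simp
  | succ k ih =>
    rw [pow_succ', Module.End.mul_apply, ih]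
    show pderiv i _ = _
    rw [pderiv_monomial, tsub_tsub, ← Finsupp.single_add, Nat.descFactorial_succ]
    congr 1
    simp only [Finsupp.coe_tsub, Pi.sub_apply, Finsupp.single_eq_same]
    push_cast
    ring

theorem eval_diffOp (ν : Fin 4 → ℕ) (s : Fin 4 →₀ ℕ) (c : ℚ) (pt : Fin 4 → ℚ) :
    aeval pt (diffOp ν (monomial s c)) =
      c * ((((s 0).descFactorial (ν 0) * pt 0 ^ (s 0 - ν 0)) * ((s 1).descFactorial (ν 1) * pt 1 ^ (s 1 - ν 1))) *
        (((s 2).descFactorial (ν 2) * pt 2 ^ (s 2 - ν 2)) * ((s 3).descFactorial (ν 3) * pt 3 ^ (s 3 - ν 3)))) := by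
  simp only [diffOp, Module.End.mul_apply, pderiv_pow]
  rw [aeval_monomial, Finsupp.prod_fintype _ _ (by simp), Fin.prod_univ_four]
  simp
  ring

/-- The exponent vector. -/
noncomputable def ex (d : ℕ) (a : E) : Fin 4 →₀ ℕ :=
  Finsupp.equivFunOnFinite.symm ![d - (a.1 + a.2.1 + a.2.2), a.1, a.2.1, a.2.2]

theorem ex0 (d : ℕ) (a : E) : ex d a 0 = d - (a.1 + a.2.1 + a.2.2) := rfl
theorem ex1 (d : ℕ) (a : E) : ex d a 1 = a.1 := rfl
theorem ex2 (d : ℕ) (a : E) : ex d a 2 = a.2.1 := rfl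
theorem ex3 (d : ℕ) (a : E) : ex d a 3 = a.2.2 := rfl

theorem ex_inj (d : ℕ) {a b : E} (h : ex d a = ex d b) : a = b := by
  refine Prod.ext ?_ (Prod.ext ?_ ?_)
  · rw [← ex1 d a, h, ex1]
  · rw [← ex2 d a, h, ex2]
  · rw [← ex3 d a, h, ex3]

theorem degree_four (s : Fin 4 →₀ ℕ) : s.degree = s 0 + s 1 + s 2 + s 3 := by
  rw [Finsupp.degree_eq_sum, Fin.sum_univ_four]

theorem ex_degree {d : ℕ} {a : E} (h : a.1 + a.2.1 + a.2.2 ≤ d) : (ex d a).degree = d := by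
  rw [degree_four, ex0, ex1, ex2, ex3]; omega

theorem ex_surj {d : ℕ} {s : Fin 4 →₀ ℕ} (h : s.degree = d) : ex d (s 1, s 2, s 3) = s := by
  rw [degree_four] at h
  ext i
  fin_cases i
  · show ex d _ 0 = s 0
    rw [ex0]; simp only; omega
  · rfl
  · rfl
  · rfl

section
variable {d : ℕ} {D : Finset E}

/-- The polynomial with given coefficients. -/
noncomputable def poly (d : ℕ) (D : Finset E) : (D → ℚ) →ₗ[ℚ] MvPolynomial (Fin 4) ℚ :=
  ∑ a : D, (monomial (ex d a)) ∘ₗ (LinearMap.proj a : (D → ℚ) →ₗ[ℚ] ℚ)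

theorem poly_apply (c : D → ℚ) : poly d D c = ∑ a : D, monomial (ex d a) (c a) := by
  simp [poly]

theorem coeff_poly (c : D → ℚ) (a : D) : coeff (ex d a) (poly d D c) = c a := by
  rw [poly_apply, coeff_sum, Finset.sum_eq_single a]
  · simp
  · intro b _ hb
    rw [coeff_monomial, if_neg]
    intro h
    exact hb (Subtype.ext (ex_inj d h))
  · simp

theorem poly_inj : Function.Injective (poly d D) := by
  intro c c' h
  funext a
  rw [← coeff_poly (d := d) c a, h, coeff_poly]

theorem poly_range (hD : ∀ a b c, (a, b, c) ∈ D ↔ a + b + c < d + 1) (f : MvPolynomial (Fin 4) ℚ) :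
    f ∈ homogeneousSubmodule (Fin 4) ℚ d ↔ ∃ c, poly d D c = f := by
  constructor
  · intro h
    rw [mem_homogeneousSubmodule] at h
    refine ⟨fun a => coeff (ex d a) f, ?_⟩
    ext s
    by_cases hs : s.degree = d
    · have hm : (s 1, s 2, s 3) ∈ D := by
        rw [hD]; rw [degree_four] at hs; omega
      have := coeff_poly (d := d) (fun a : D => coeff (ex d a) f) ⟨_, hm⟩
      rw [ex_surj hs] at this
      exact this
    · rw [h.coeff_eq_zero hs, poly_apply, coeff_sum]
      refine Finset.sum_eq_zero fun a _ => ?_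
      rw [coeff_monomial, if_neg]
      rintro rfl
      refine hs (ex_degree ?_)
      have := (hD a.1.1 a.1.2.1 a.1.2.2).1 a.2
      omega
  · rintro ⟨c, rfl⟩
    rw [poly_apply]
    refine Submodule.sum_mem _ fun a _ => ?_
    refine isHomogeneous_monomial _ (ex_degree ?_)
    have := (hD a.1.1 a.1.2.1 a.1.2.2).1 a.2
    omega

theorem card_D (hD : ∀ a b c, (a, b, c) ∈ D ↔ a + b + c < d + 1) : D.card = (d + 3).choose 3 := by
  have h := Finset.card_finsuppAntidiag_nat_eq_choose (s := (Finset.univ : Finset (Fin 4))) d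
  have e : D.card = (Finset.finsuppAntidiag (Finset.univ : Finset (Fin 4)) d).card := by
    refine Finset.card_bij (fun a _ => ex d a) ?_ ?_ ?_
    · rintro ⟨a, b, c⟩ h
      rw [hD] at h
      rw [Finset.mem_finsuppAntidiag]
      refine ⟨?_, Finset.subset_univ _⟩
      rw [← Finsupp.degree_eq_sum]
      exact ex_degree (by simp only; omega)
    · intro a _ b _ h
      exact ex_inj d h
    · intro s hs
      rw [Finset.mem_finsuppAntidiag, ← Finsupp.degree_eq_sum] at hs
      refine ⟨(s 1, s 2, s 3), ?_, ex_surj hs.1⟩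
      have := hs.1
      rw [hD]; rw [degree_four] at this; omega
  rw [e, h]
  simp only [Finset.card_univ, Fintype.card_fin]
  rw [show 4 + d - 1 = d + 3 by omega, ← Nat.choose_symm_of_eq_add (show d + 3 = 3 + d by omega)]

/-- The projective point. -/
def pp (p : Pt) : Fin 4 → ℚ := ![1, p.1, p.2.1, p.2.2]

theorem fall_pow {p : ℚ} (hp : p ≠ 0) (n k : ℕ) :
    (n.descFactorial k : ℚ) * p ^ (n - k) = (p ^ k)⁻¹ * (fq n k * p ^ n) := by
  rw [fq_nat]
  by_cases h : k ≤ n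
  · rw [pow_sub₀ _ hp h]; ring
  · rw [Nat.descFactorial_eq_zero_iff_lt.2 (not_le.1 h)]; simp

theorem eval_poly (hD : ∀ a b c, (a, b, c) ∈ D ↔ a + b + c < d + 1) (ν : Fin 4 → ℕ) {p : Pt} (hp : NZ p) (c : D → ℚ) :
    aeval (pp p) (diffOp ν (poly d D c)) = ((p.1 ^ ν 1)⁻¹ * (p.2.1 ^ ν 2)⁻¹ * (p.2.2 ^ ν 3)⁻¹) *
      ∑ a : D, c a * ((fq ((d : ℚ) - a.1.1 - a.1.2.1 - a.1.2.2) (ν 0) * fall (ν 1, ν 2, ν 3) a) * mon p a) := by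
  rw [poly_apply, map_sum, map_sum, Finset.mul_sum]
  refine Finset.sum_congr rfl fun a _ => ?_
  obtain ⟨h1, h2, h3⟩ := hp
  have h := (hD a.1.1 a.1.2.1 a.1.2.2).1 a.2
  have e : (d : ℚ) - a.1.1 - a.1.2.1 - a.1.2.2 = ((d - (a.1.1 + a.1.2.1 + a.1.2.2) : ℕ) : ℚ) := by
    rw [Nat.cast_sub (by omega)]; push_cast; ring
  rw [eval_diffOp, ex0, ex1, ex2, ex3, e, fq_nat]
  rw [show pp p 0 = 1 from rfl, show pp p 1 = p.1 from rfl, show pp p 2 = p.2.1 from rfl, show pp p 3 = p.2.2 from rfl]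
  rw [fall_pow h1, fall_pow h2, fall_pow h3, one_pow, mul_one, mon, fall]
  ring

theorem vanish_iff (hD : ∀ a b c, (a, b, c) ∈ D ↔ a + b + c < d + 1) {q : ℕ × Pt} (hp : NZ q.2) (c : D → ℚ) :
    poly d D c ∈ vanishingSpace q.1 (pp q.2) ↔ cond D q c = 0 := by
  have hv : poly d D c ∈ vanishingSpace q.1 (pp q.2) ↔
      ∀ ν : Fin 4 → ℕ, ∑ j, ν j < q.1 → aeval (pp q.2) (diffOp ν (poly d D c)) = 0 := by
    simp [vanishingSpace, Submodule.mem_iInf]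
  rw [hv]
  constructor
  · intro h
    funext ν
    have hν := (mem_FI _ _).1 ν.2
    have := h ![0, ν.1.1, ν.1.2.1, ν.1.2.2] (by rw [Fin.sum_univ_four]; simpa using hν)
    rw [eval_poly hD _ hp] at this
    obtain ⟨h1, h2, h3⟩ := hp
    rcases mul_eq_zero.1 this with h0 | h0
    · exfalso
      revert h0
      positivity
    · show ∑ a : D, c a * (fall ν a * mon q.2 a) = 0
      simpa [fq] using h0
  · intro h ν hν
    rw [eval_poly hD _ hp]
    refine mul_eq_zero_of_right _ ((cond_iff q c).1 h
      (fun a => fq ((d : ℚ) - a.1 - a.2.1 - a.2.2) (ν 0) * fall (ν 1, ν 2, ν 3) a) ?_)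
    rw [Fin.sum_univ_four] at hν
    refine ((Pol_fall (q.1 - ν 0) (ν 1, ν 2, ν 3) ?_).fo d (ν 0)).mono ?_
    · simp only; omega
    · omega

theorem pp_indep {p q : Pt} (h : p ≠ q) : LinearIndependent ℚ ![pp p, pp q] := by
  rw [LinearIndependent.pair_iff]
  intro s t e
  have e0 := congrFun e 0
  have e1 := congrFun e 1
  have e2 := congrFun e 2
  have e3 := congrFun e 3
  simp only [pp, Pi.add_apply, Pi.smul_apply, smul_eq_mul, Pi.zero_apply, Matrix.cons_val, mul_one] at e0 e1 e2 e3
  have ht : t = -s := by linarith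
  subst ht
  by_cases hs : s = 0
  · simp [hs]
  · exfalso
    apply h
    refine Prod.ext ?_ (Prod.ext ?_ ?_)
    · exact mul_left_cancel₀ hs (by linarith)
    · exact mul_left_cancel₀ hs (by linarith)
    · exact mul_left_cancel₀ hs (by linarith)

theorem system_finrank (hD : ∀ a b c, (a, b, c) ∈ D ↔ a + b + c < d + 1) (L : List (ℕ × Pt)) (hL : ∀ q ∈ L, NZ q.2)
    (pts : Fin (L.map Prod.fst).length → Fin 4 → ℚ)
    (hpts : ∀ i, pts i = pp (L[(i : ℕ)]'(by simpa using i.2)).2) :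
    Module.finrank ℚ (systemSpace d (L.map Prod.fst) pts) = Module.finrank ℚ (KK D L) := by
  have e : systemSpace d (L.map Prod.fst) pts = (KK D L).map (poly d D) := by
    ext f
    rw [systemSpace, Submodule.mem_inf, poly_range hD, Submodule.mem_iInf, Submodule.mem_map]
    have key : ∀ c, (∀ i, poly d D c ∈ vanishingSpace ((L.map Prod.fst).get i) (pts i)) ↔ c ∈ KK D L := by
      intro c
      rw [mem_KK]
      constructor
      · intro h q hq
        obtain ⟨i, hi, rfl⟩ := List.getElem_of_mem hq
        have := h ⟨i, by simpa using hi⟩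
        rw [hpts] at this
        simp only [List.get_eq_getElem, List.getElem_map] at this
        exact (vanish_iff hD (hL _ hq) c).1 this
      · intro h i
        have hi : (i : ℕ) < L.length := by simpa using i.2
        rw [hpts]
        simp only [List.get_eq_getElem, List.getElem_map]
        exact (vanish_iff hD (hL _ (List.getElem_mem hi)) c).2 (h _ (List.getElem_mem hi))
    constructor
    · rintro ⟨⟨c, rfl⟩, h⟩
      exact ⟨c, (key c).1 h, rfl⟩
    · rintro ⟨c, h, rfl⟩
      exact ⟨⟨c, rfl⟩, (key c).2 h⟩
  rw [e]
  exact (Submodule.equivMapOfInjective _ poly_inj _).finrank_eq.symm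

theorem nonSpecial_of_list {ms : List ℕ} (hD : ∀ a b c, (a, b, c) ∈ D ↔ a + b + c < d + 1) (L : List (ℕ × Pt))
    (hms : L.map Prod.fst = ms) (hn : (L.map Prod.snd).Nodup) (hL : ∀ q ∈ L, NZ q.2)
    (hf : (Module.finrank ℚ (KK D L) : ℤ) = max (vdim d ms + 1) 0) : nonSpecial d ms := by
  subst hms
  refine ⟨fun i => pp (L[(i : ℕ)]'(by simpa using i.2)).2, ?_, ?_, ?_⟩
  · intro i h
    have := congrFun h 0
    simp [pp] at this
  · intro i j hij
    apply pp_indep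
    intro h
    apply hij
    have hi : (i : ℕ) < (L.map Prod.snd).length := by simpa using i.2
    have hj : (j : ℕ) < (L.map Prod.snd).length := by simpa using j.2
    exact Fin.ext ((hn.getElem_inj_iff (hi := hi) (hj := hj)).1 (by simpa using h))
  · rw [system_finrank hD L hL _ (fun i => rfl), hf]

end
end TD

theorem nonSpecial_of_ge_fortyone (d x y z : ℕ) (hd : 41 ≤ d) :
    nonSpecial d (List.replicate x 4 ++ List.replicate y 3 ++ List.replicate z 2) := by
  obtain ⟨D, hD, H⟩ := TD.simp3_main (d + 1) (by omega)
  obtain ⟨L, h1, h2, h3, h4⟩ := TD.exists_points H x y z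
  refine TD.nonSpecial_of_list hD L h1 h2 h3 ?_
  rw [h4, TD.card_D hD]
  have c4 : ((4 + 2).choose 3 : ℤ) = 20 := by decide
  have c3 : ((3 + 2).choose 3 : ℤ) = 10 := by decide
  have c2 : ((2 + 2).choose 3 : ℤ) = 4 := by decide
  simp only [vdim, List.map_append, List.map_replicate, List.sum_append, List.sum_replicate, nsmul_eq_mul, c4, c3, c2]
  congr 1
  ring
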